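/- arXiv:2008.08897 — 2 statements merged into one kernel-verified Lean document; each statement's English description precedes it below -/
import Mathlib

section
/- Maximal paraproduct estimate, bounded-integrand case: let 1 ≤ q_0 < ∞, and for each k let (g^{(k)}_n) be a martingale, (F^{(k)}_{s,t}) an adapted two-parameter process, and τ'_k ≤ τ_k stopping times. Then for 1 ≤ r_0 < ∞, ‖ (Σ_k sup_{τ'_k ≤ t ≤ τ_k} |Π(F^{(k)},g^{(k)})_{τ'_k,t}|^{r_0})^{1/r_0} ‖_{L^{q_0}} ≤ C ‖ sup_k sup_{τ'_k ≤ t < τ_k} |F^{(k)}_{τ'_k,t}| ‖_{L^∞} · ‖ (Σ_k (Sg^{(k)}_{τ'_k,τ_k})^{r_0})^{1/r_0} ‖_{L^{q_0}}, where Π(F,g)_{s,t} := Σ_{s<j≤t} F_{s,j-1} dg_j and (Sg_{s,t})² := Σ_{s<j≤t} |dg_j|². -/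
open MeasureTheory ENNReal

/-- Discrete-time paraproduct `Π(F,g)_{s,t}(ω) = Σ_{s<j≤t} F_{s,j-1}(ω) (g_j(ω) - g_{j-1}(ω))`. -/
noncomputable def pp {Ω : Type*} (F : ℕ → ℕ → Ω → ℝ) (g : ℕ → Ω → ℝ) (s t : ℕ) (ω : Ω) : ℝ :=
  ∑ j ∈ Finset.Ioc s t, F s (j - 1) ω * (g j ω - g (j - 1) ω)

/-- A sublinear functional of discrete paths in `E`, localized to the first `n` increments. -/
structure PathSeminorm (E : Type) [NormedAddCommGroup E] [MeasurableSpace E] where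
  toFun : ℕ → (ℕ → E) → ℝ
  zero_left : ∀ x, toFun 0 x = 0
  add_le : ∀ n x y, toFun n (x + y) ≤ toFun n x + toFun n y
  mono : ∀ x, Monotone fun n => toFun n x
  succ_le : ∀ n x, toFun (n + 1) x ≤ toFun n x + ‖x n‖
  congr : ∀ n x y, (∀ j < n, x j = y j) → toFun n x = toFun n y
  measurable : ∀ n, Measurable (toFun n)

namespace PathSeminorm

variable {E : Type} [NormedAddCommGroup E] [MeasurableSpace E]

instance : CoeFun (PathSeminorm E) fun _ => ℕ → (ℕ → E) → ℝ := ⟨toFun⟩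

lemma nonneg (X : PathSeminorm E) (n : ℕ) (x : ℕ → E) : 0 ≤ X n x := by
  rw [← X.zero_left x]
  exact X.mono x (Nat.zero_le n)

lemma le_sum (X : PathSeminorm E) (n : ℕ) (x : ℕ → E) :
    X n x ≤ ∑ j ∈ Finset.range n, ‖x j‖ := by
  induction n with
  | zero => simp [X.zero_left]
  | succ n ih =>
    rw [Finset.sum_range_succ]
    linarith [X.succ_le n x]

lemma eq_zero_of_forall (X : PathSeminorm E) (n : ℕ) (x : ℕ → E) (hx : ∀ j < n, x j = 0) :
    X n x = 0 := by
  refine le_antisymm ((X.le_sum n x).trans_eq ?_) (X.nonneg n x)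
  exact Finset.sum_eq_zero fun j hj => by simp [hx j (Finset.mem_range.1 hj)]

lemma le_of_forall_ge_eq_zero (X : PathSeminorm E) {m n : ℕ} (hmn : m ≤ n) (x : ℕ → E)
    (hx : ∀ j, m ≤ j → x j = 0) : X n x ≤ X m x := by
  induction n, hmn using Nat.le_induction with
  | base => exact le_rfl
  | succ n hn ih =>
    have := X.succ_le n x
    rw [hx n hn, norm_zero] at this
    linarith

/-- The functional along an adapted sequence is adapted. -/
lemma measurable_comp (X : PathSeminorm E) {Ω : Type} {m : MeasurableSpace Ω} (n : ℕ)
    {d : ℕ → Ω → E} (hd : ∀ j < n, Measurable (d j)) :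
    Measurable fun ω => X n fun j => d j ω := by
  have : (fun ω => X n fun j => d j ω) =
      fun ω => X n fun j => (if j < n then d j else 0) ω := by
    funext ω
    refine X.congr n _ _ fun j hj => ?_
    simp [hj]
  rw [this]
  refine (X.measurable n).comp (measurable_pi_lambda _ fun j => ?_)
  split_ifs with h
  · exact hd j h
  · exact measurable_const

/-- `X` dominates the size of every increment and decreases when increments are dropped. -/
structure IsSquareFunctionLike (Y : PathSeminorm E) : Prop where
  norm_le : ∀ n x, ‖x n‖ ≤ Y (n + 1) x
  indicator_le : ∀ n x (S : Set ℕ), Y n (S.indicator x) ≤ Y n x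

lemma exists_crossing (X : PathSeminorm E) {x y : ℕ → E} {ρ : ℕ → ℝ} (hρ : Monotone ρ)
    (hxρ : ∀ j, ‖x j‖ ≤ ρ j) {N : ℕ} {l : ℝ} (hl : 0 < l) (hρl : ρ N ≤ l)
    (hX : 3 * l < X (N + 1) x) (hy : ∀ j < N + 1, y j = Set.indicator {j | l < X j x} x j) :
    l ≤ X (N + 1) y := by
  classical
  have hex : ∃ j, l < X j x := ⟨N + 1, by linarith⟩
  set m := Nat.find hex with hm
  have hmX : l < X m x := Nat.find_spec hex
  have hmN : m ≤ N + 1 := Nat.find_min' hex (by linarith)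
  have hm0 : m ≠ 0 := by
    intro h
    rw [h, X.zero_left] at hmX
    linarith
  obtain ⟨k, hk⟩ := Nat.exists_eq_succ_of_ne_zero hm0
  have hkX : X k x ≤ l := not_lt.1 (Nat.find_min hex (by omega))
  have hm2 : X m x ≤ 2 * l := by
    have h1 := X.succ_le k x
    have h2 := hρ (show k ≤ N by omega)
    have h3 := hxρ k
    rw [hk]
    simp only [Nat.succ_eq_add_one]
    linarith
  have hiff : ∀ j, l < X j x ↔ m ≤ j :=
    fun j => ⟨fun h => Nat.find_min' hex h, fun h => hmX.trans_le (X.mono x h)⟩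
  have hsplit : x = Set.indicator {j | j < m} x + Set.indicator {j | l < X j x} x := by
    funext j
    by_cases h : m ≤ j
    · simp [hiff, h]
    · simp [hiff, h, not_le.1 h]
  have h1 : X (N + 1) (Set.indicator {j | j < m} x) ≤ 2 * l := by
    refine (X.le_of_forall_ge_eq_zero hmN _ fun j hj => by simp [hj]).trans ?_
    rw [X.congr m _ x fun j hj => by simp [hj]]
    exact hm2
  have h2 := X.add_le (N + 1) (Set.indicator {j | j < m} x) (Set.indicator {j | l < X j x} x)
  rw [← hsplit] at h2
  rw [X.congr (N + 1) y _ hy]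
  linarith

lemma IsSquareFunctionLike.indicator_le_of_le {Y : PathSeminorm E}
    (hY : Y.IsSquareFunctionLike) {x : ℕ → E} {S : Set ℕ} {b : ℝ} (hb : 0 ≤ b)
    (hS : ∀ j ∈ S, Y (j + 1) x ≤ b) (n : ℕ) : Y n (S.indicator x) ≤ b := by
  induction n with
  | zero => rwa [Y.zero_left]
  | succ n ih =>
    by_cases h : n ∈ S
    · exact (hY.indicator_le _ _ _).trans (hS n h)
    · have := Y.succ_le n (S.indicator x)
      rw [Set.indicator_of_notMem h, norm_zero] at this
      linarith

end PathSeminorm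

/-- `d j` is the increment from time `j` to time `j + 1` of a martingale. -/
structure IsMartingaleDiff {Ω E : Type} {mΩ : MeasurableSpace Ω} [NormedAddCommGroup E]
    [NormedSpace ℝ E] [CompleteSpace E] [MeasurableSpace E]
    (ℱ : Filtration ℕ mΩ) (μ : Measure Ω) (d : ℕ → Ω → E) : Prop where
  measurable : ∀ j, Measurable[ℱ (j + 1)] (d j)
  integrable : ∀ j, Integrable (d j) μ
  condExp_eq_zero : ∀ j, μ[d j | ℱ j] =ᵐ[μ] 0

lemma IsMartingaleDiff.indicator {Ω E : Type} {mΩ : MeasurableSpace Ω} [NormedAddCommGroup E]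
    [NormedSpace ℝ E] [CompleteSpace E] [MeasurableSpace E]
    {ℱ : Filtration ℕ mΩ} {μ : Measure Ω} {d : ℕ → Ω → E}
    (hd : IsMartingaleDiff ℱ μ d) {A : ℕ → Set Ω} (hA : ∀ j, MeasurableSet[ℱ j] (A j)) :
    IsMartingaleDiff ℱ μ fun j => (A j).indicator (d j) where
  measurable j := (hd.measurable j).indicator (ℱ.mono j.le_succ _ (hA j))
  integrable j := (hd.integrable j).indicator (ℱ.le j _ (hA j))
  condExp_eq_zero j := by
    refine (condExp_indicator (hd.integrable j) (hA j)).trans ?_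
    filter_upwards [hd.condExp_eq_zero j] with ω hω
    simp [hω]

section Bounds

variable {E : Type} [NormedAddCommGroup E] [NormedSpace ℝ E] [CompleteSpace E] [MeasurableSpace E]

/-- Weak type bound at exponent `r` of `X` by `Y`, for all martingales. -/
def WeakBound (X Y : PathSeminorm E) (r : ℝ) (C : ℝ≥0∞) : Prop :=
  ∀ (Ω : Type) (mΩ : MeasurableSpace Ω) (μ : Measure Ω), IsProbabilityMeasure μ →
    ∀ (ℱ : Filtration ℕ mΩ) (d : ℕ → Ω → E), IsMartingaleDiff ℱ μ d → ∀ (n : ℕ) (l : ℝ), 0 < l →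
      ENNReal.ofReal l ^ r * μ {ω | l ≤ X n fun j => d j ω} ≤
        C * ∫⁻ ω, ENNReal.ofReal (Y n fun j => d j ω) ^ r ∂μ

/-- Strong type bound at exponent `q` of `X` by `Y`, for all martingales. -/
def StrongBound (X Y : PathSeminorm E) (q : ℝ) (C : ℝ≥0∞) : Prop :=
  ∀ (Ω : Type) (mΩ : MeasurableSpace Ω) (μ : Measure Ω), IsProbabilityMeasure μ →
    ∀ (ℱ : Filtration ℕ mΩ) (d : ℕ → Ω → E), IsMartingaleDiff ℱ μ d → ∀ n : ℕ,
      ∫⁻ ω, ENNReal.ofReal (X n fun j => d j ω) ^ q ∂μ ≤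
        C * ∫⁻ ω, ENNReal.ofReal (Y n fun j => d j ω) ^ q ∂μ

lemma measure_lt_le_of_weakBound [BorelSpace E] [SecondCountableTopology E]
    {X Y : PathSeminorm E} (hY : Y.IsSquareFunctionLike) {r : ℝ} (hr : 1 ≤ r) {C : ℝ≥0∞}
    (hXY : WeakBound X Y r C) {Ω : Type} {mΩ : MeasurableSpace Ω} {μ : Measure Ω}
    [IsProbabilityMeasure μ] {ℱ : Filtration ℕ mΩ} {c : ℕ → Ω → E} (hc : IsMartingaleDiff ℱ μ c)
    {ρ : ℕ → Ω → ℝ} (hρm : ∀ j, Measurable[ℱ j] (ρ j)) (hρ : ∀ ω, Monotone fun j => ρ j ω)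
    (hYρ : ∀ᵐ ω ∂μ, ∀ j, Y (j + 1) (fun i => c i ω) ≤ ρ j ω) (N : ℕ) {δ l : ℝ} (hδ : 0 < δ)
    (hδ1 : δ ≤ 1) (hl : 0 < l) :
    μ {ω | 3 * l < X (N + 1) fun j => c j ω} ≤ μ {ω | δ * l < ρ N ω} +
      C * ENNReal.ofReal δ ^ r * μ {ω | l < X (N + 1) fun j => c j ω} := by
  set A : ℕ → Set Ω := fun j => {ω | l < X j fun i => c i ω} ∩ {ω | ρ j ω ≤ δ * l} with hA
  have hXm : ∀ j, Measurable[ℱ j] fun ω => X j fun i => c i ω := fun j =>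
    X.measurable_comp j fun i hi => (hc.measurable i).mono (ℱ.mono hi) le_rfl
  have hAm : ∀ j, MeasurableSet[ℱ j] (A j) := fun j =>
    (measurableSet_lt measurable_const (hXm j)).inter
      (measurableSet_le (hρm j) measurable_const)
  have he := hc.indicator hAm
  have hweak := hXY Ω mΩ μ inferInstance ℱ _ he (N + 1) l hl
  set U : Set Ω := {ω | l < X (N + 1) fun j => c j ω} with hU
  have hUm : MeasurableSet U := ℱ.le (N + 1) _ (measurableSet_lt measurable_const (hXm (N + 1)))
  have hYe : ∀ᵐ ω ∂μ, ENNReal.ofReal (Y (N + 1) fun j => (A j).indicator (c j) ω) ^ r ≤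
      U.indicator (fun _ => ENNReal.ofReal (δ * l) ^ r) ω := by
    filter_upwards [hYρ] with ω hω
    have hrw : (fun j => (A j).indicator (c j) ω) =
        Set.indicator {j | ω ∈ A j} (fun j => c j ω) := by
      funext j
      simp [Set.indicator_apply]
    by_cases h : ω ∈ U
    · rw [Set.indicator_of_mem h, hrw]
      gcongr
      exact hY.indicator_le_of_le (by positivity) (fun j hj => (hω j).trans hj.2) (N + 1)
    · rw [Set.indicator_of_notMem h, Y.eq_zero_of_forall (N + 1)]
      · simp [show 0 < r by linarith]
      · intro j hj
        refine Set.indicator_of_notMem (fun hjA => h ?_) _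
        exact lt_of_lt_of_le hjA.1 (X.mono _ hj.le)
  have hint : ∫⁻ ω, ENNReal.ofReal (Y (N + 1) fun j => (A j).indicator (c j) ω) ^ r ∂μ ≤
      ENNReal.ofReal (δ * l) ^ r * μ U := by
    refine (lintegral_mono_ae hYe).trans_eq ?_
    rw [lintegral_indicator hUm, setLIntegral_const]
  have hsub : μ {ω | 3 * l < X (N + 1) fun j => c j ω} ≤ μ {ω | δ * l < ρ N ω} +
      μ {ω | l ≤ X (N + 1) fun j => (A j).indicator (c j) ω} := by
    refine (measure_mono_ae ?_).trans (measure_union_le _ _)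
    filter_upwards [hYρ] with ω hω h3
    by_cases hρω : δ * l < ρ N ω
    · exact Or.inl hρω
    · refine Or.inr ?_
      have hρω' : ρ N ω ≤ δ * l := not_lt.1 hρω
      refine PathSeminorm.exists_crossing X (hρ ω) (fun j => (hY.norm_le j _).trans (hω j)) hl
        (hρω'.trans (by nlinarith)) h3 fun j hj => ?_
      have : ρ j ω ≤ δ * l := (hρ ω (Nat.lt_succ_iff.1 hj)).trans hρω'
      simp [Set.indicator_apply, hA, this]
  refine hsub.trans ?_
  gcongr
  have hl0 : ENNReal.ofReal l ^ r ≠ 0 := by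
    simp [hl, show 0 < r by linarith]
  have hlt : ENNReal.ofReal l ^ r ≠ ∞ := ENNReal.rpow_ne_top_of_nonneg (by linarith) (by simp)
  rw [← ENNReal.mul_le_mul_iff_right hl0 hlt]
  refine hweak.trans ((mul_le_mul_right hint C).trans_eq ?_)
  rw [ENNReal.ofReal_mul hδ.le, ENNReal.mul_rpow_of_nonneg _ _ (by linarith)]
  ring

end Bounds

lemma ENNReal.le_two_mul_of_le_add_half {a b : ℝ≥0∞} (ha : a ≠ ∞) (h : a ≤ b + 2⁻¹ * a) :
    a ≤ 2 * b := by
  rcases eq_or_ne b ∞ with rfl | hb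
  · simp
  lift a to NNReal using ha
  lift b to NNReal using hb
  have h' : (a : ℝ≥0∞) ≤ ((b + 2⁻¹ * a : NNReal) : ℝ≥0∞) := by
    simpa using h
  have h2 : (a : ℝ) ≤ b + 2⁻¹ * a := by exact_mod_cast h'
  have h3 : (a : ℝ) ≤ 2 * b := by linarith
  exact_mod_cast h3

section Integration

variable {Ω : Type} {mΩ : MeasurableSpace Ω} {μ : Measure Ω}

lemma lintegral_ofReal_rpow_eq {X : Ω → ℝ} (hX : Measurable X) (hX0 : ∀ ω, 0 ≤ X ω) {q : ℝ}
    (hq : 1 ≤ q) : ∫⁻ ω, ENNReal.ofReal (X ω) ^ q ∂μ =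
      ENNReal.ofReal q * ∫⁻ t in Set.Ioi 0, μ {ω | t < X ω} * ENNReal.ofReal (t ^ (q - 1)) := by
  rw [← lintegral_rpow_eq_lintegral_meas_lt_mul μ (ae_of_all _ hX0) hX.aemeasurable (by linarith)]
  exact lintegral_congr fun ω => ENNReal.ofReal_rpow_of_nonneg (hX0 ω) (by linarith)

lemma lintegral_rpow_le_of_goodLambda_of_le [IsFiniteMeasure μ] {X Z : Ω → ℝ} (hX : Measurable X)
    (hX0 : ∀ ω, 0 ≤ X ω) (hZ : Measurable Z) (hZ0 : ∀ ω, 0 ≤ Z ω) {q δ : ℝ} (hq : 1 ≤ q)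
    (hδ : 0 < δ) {ε : ℝ≥0∞} (hε : 3 ^ q * ε ≤ 2⁻¹)
    (h : ∀ l : ℝ, 0 < l → μ {ω | 3 * l < X ω} ≤ μ {ω | δ * l < Z ω} + ε * μ {ω | l < X ω})
    {T : ℝ} (hT : ∀ ω, X ω ≤ T) :
    ∫⁻ ω, ENNReal.ofReal (X ω) ^ q ∂μ ≤
      2 * (3 ^ q * ENNReal.ofReal δ⁻¹ ^ q * ∫⁻ ω, ENNReal.ofReal (Z ω) ^ q ∂μ) := by
  have hq0 : 0 ≤ q := by linarith
  have hanti : ∀ f : Ω → ℝ, Measurable fun t : ℝ => μ {ω | t < f ω} := fun f =>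
    Antitone.measurable fun s t hst => measure_mono fun ω (hω : t < f ω) => hst.trans_lt hω
  have hpow : Measurable fun t : ℝ => ENNReal.ofReal (t ^ (q - 1)) := by fun_prop
  have hX3 : ∫⁻ ω, ENNReal.ofReal (X ω / 3) ^ q ∂μ ≤
      ∫⁻ ω, ENNReal.ofReal (δ⁻¹ * Z ω) ^ q ∂μ + ε * ∫⁻ ω, ENNReal.ofReal (X ω) ^ q ∂μ := by
    rw [lintegral_ofReal_rpow_eq (hX.div_const 3) (fun ω => by have := hX0 ω; positivity) hq,
      lintegral_ofReal_rpow_eq (hZ.const_mul δ⁻¹) (fun ω => by have := hZ0 ω; positivity) hq,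
      lintegral_ofReal_rpow_eq hX hX0 hq, mul_left_comm ε, ← mul_add]
    gcongr
    have hm : ∀ f : Ω → ℝ, Measurable fun t : ℝ =>
        μ {ω | t < f ω} * ENNReal.ofReal (t ^ (q - 1)) := fun f => (hanti f).mul hpow
    rw [← lintegral_const_mul _ (hm X), ← lintegral_add_left (hm fun ω => δ⁻¹ * Z ω)]
    refine setLIntegral_mono' measurableSet_Ioi fun t ht => ?_
    rw [← mul_assoc, ← add_mul]
    gcongr
    convert! h t ht using 3
    · ext ω
      rw [lt_div_iff₀ (by norm_num), mul_comm]
    · ext ω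
      change t < δ⁻¹ * Z ω ↔ δ * t < Z ω
      rw [inv_mul_eq_div, lt_div_iff₀ hδ, mul_comm]
  have hscale : ∫⁻ ω, ENNReal.ofReal (X ω) ^ q ∂μ =
      3 ^ q * ∫⁻ ω, ENNReal.ofReal (X ω / 3) ^ q ∂μ := by
    rw [← lintegral_const_mul _ (by fun_prop)]
    refine lintegral_congr fun ω => ?_
    rw [← ENNReal.mul_rpow_of_nonneg _ _ hq0, ENNReal.ofReal_div_of_pos (by norm_num)]
    congr 1
    rw [ENNReal.ofReal_ofNat, ENNReal.mul_div_cancel (by norm_num) (by norm_num)]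
  have hZscale : ∫⁻ ω, ENNReal.ofReal (δ⁻¹ * Z ω) ^ q ∂μ =
      ENNReal.ofReal δ⁻¹ ^ q * ∫⁻ ω, ENNReal.ofReal (Z ω) ^ q ∂μ := by
    rw [← lintegral_const_mul _ (by fun_prop)]
    refine lintegral_congr fun ω => ?_
    rw [ENNReal.ofReal_mul (by positivity), ENNReal.mul_rpow_of_nonneg _ _ hq0]
  have hfin : ∫⁻ ω, ENNReal.ofReal (X ω) ^ q ∂μ ≠ ∞ := by
    refine ne_top_of_le_ne_top ?_ (lintegral_mono (g := fun _ => ENNReal.ofReal T ^ q) fun ω => ?_)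
    · rw [lintegral_const]
      exact ENNReal.mul_ne_top (ENNReal.rpow_ne_top_of_nonneg hq0 (by simp)) (by simp)
    · dsimp only
      gcongr
      exact hT ω
  refine ENNReal.le_two_mul_of_le_add_half hfin ?_
  calc ∫⁻ ω, ENNReal.ofReal (X ω) ^ q ∂μ
      = 3 ^ q * ∫⁻ ω, ENNReal.ofReal (X ω / 3) ^ q ∂μ := hscale
    _ ≤ 3 ^ q * (∫⁻ ω, ENNReal.ofReal (δ⁻¹ * Z ω) ^ q ∂μ +
          ε * ∫⁻ ω, ENNReal.ofReal (X ω) ^ q ∂μ) := by gcongr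
    _ = 3 ^ q * ENNReal.ofReal δ⁻¹ ^ q * ∫⁻ ω, ENNReal.ofReal (Z ω) ^ q ∂μ +
          (3 ^ q * ε) * ∫⁻ ω, ENNReal.ofReal (X ω) ^ q ∂μ := by rw [hZscale]; ring
    _ ≤ _ := by gcongr

lemma lintegral_rpow_le_of_goodLambda [IsFiniteMeasure μ] {X Z : Ω → ℝ} (hX : Measurable X)
    (hX0 : ∀ ω, 0 ≤ X ω) (hZ : Measurable Z) (hZ0 : ∀ ω, 0 ≤ Z ω) {q δ : ℝ} (hq : 1 ≤ q)
    (hδ : 0 < δ) {ε : ℝ≥0∞} (hε : 3 ^ q * ε ≤ 2⁻¹)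
    (h : ∀ l : ℝ, 0 < l → μ {ω | 3 * l < X ω} ≤ μ {ω | δ * l < Z ω} + ε * μ {ω | l < X ω}) :
    ∫⁻ ω, ENNReal.ofReal (X ω) ^ q ∂μ ≤
      2 * (3 ^ q * ENNReal.ofReal δ⁻¹ ^ q * ∫⁻ ω, ENNReal.ofReal (Z ω) ^ q ∂μ) := by
  have hlim : Filter.Tendsto (fun n : ℕ => ∫⁻ ω, ENNReal.ofReal (min (X ω) n) ^ q ∂μ)
      Filter.atTop (nhds (∫⁻ ω, ENNReal.ofReal (X ω) ^ q ∂μ)) := by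
    refine lintegral_tendsto_of_tendsto_of_monotone
      (fun n => (by fun_prop : Measurable _).aemeasurable)
      (ae_of_all _ fun ω m n hmn => ?_) (ae_of_all _ fun ω => ?_)
    · dsimp only
      gcongr
    · obtain ⟨n, hn⟩ := exists_nat_ge (X ω)
      refine tendsto_const_nhds.congr' ?_
      filter_upwards [Filter.eventually_ge_atTop n] with m hm
      rw [min_eq_left (hn.trans (by exact_mod_cast hm))]
  refine le_of_tendsto' hlim fun n => ?_
  refine lintegral_rpow_le_of_goodLambda_of_le (by fun_prop)
    (fun ω => le_min (hX0 ω) (by positivity)) hZ hZ0 hq hδ hε (fun l hl => ?_)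
    (T := n) fun ω => min_le_right _ _
  by_cases hn : 3 * l < n
  · have hn' : l < n := by linarith
    simpa [lt_min_iff, hn, hn'] using h l hl
  · simp [hn]

lemma Real.rpow_add_le_rpow_add_mul {x w q : ℝ} (hx : 0 ≤ x) (hw : 0 ≤ w) (hq : 1 ≤ q) :
    (x + w) ^ q ≤ x ^ q + q * ((x + w) ^ (q - 1) * w) := by
  rcases (add_nonneg hx hw).eq_or_lt with h | h
  · have hx' : x = 0 := by linarith
    have hw' : w = 0 := by linarith
    simp [hx', hw']
  · have hb := one_add_mul_self_le_rpow_one_add (s := -(w / (x + w))) (p := q)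
      (by rw [neg_le_neg_iff, div_le_one h]; linarith) hq
    have he : 1 + -(w / (x + w)) = x / (x + w) := by field_simp; ring
    rw [he, Real.div_rpow hx h.le, le_div_iff₀ (by positivity)] at hb
    have hp : (x + w) ^ q = (x + w) ^ (q - 1) * (x + w) := by
      rw [Real.rpow_sub_one h.ne']
      field_simp
    have : (1 + q * -(w / (x + w))) * (x + w) ^ q =
        (x + w) ^ q - q * ((x + w) ^ (q - 1) * w) := by
      rw [hp]
      field_simp
      ring
    linarith

lemma Real.sum_rpow_le {w : ℕ → ℝ} (hw : ∀ j, 0 ≤ w j) {q : ℝ} (hq : 1 ≤ q) (N : ℕ) :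
    (∑ j ∈ Finset.range N, w j) ^ q ≤
      q * ∑ j ∈ Finset.range N, (∑ i ∈ Finset.range (j + 1), w i) ^ (q - 1) * w j := by
  induction N with
  | zero => simp [show q ≠ 0 by linarith]
  | succ n ih =>
    have := Real.rpow_add_le_rpow_add_mul (Finset.sum_nonneg fun i (_ : i ∈ Finset.range n) => hw i)
      (hw n) hq
    rw [Finset.sum_range_succ _ n, Finset.sum_range_succ _ n, mul_add, Finset.sum_range_succ _ n]
    linarith

lemma lintegral_mul_condExp [IsProbabilityMeasure μ] {m : MeasurableSpace Ω} (hm : m ≤ mΩ)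
    {f a w : Ω → ℝ} (hf : Measurable[m] f) (hf0 : ∀ ω, 0 ≤ f ω) {T : ℝ} (hfT : ∀ ω, f ω ≤ T)
    (ha : Integrable a μ) (ha0 : ∀ ω, 0 ≤ a ω) (hw0 : ∀ ω, 0 ≤ w ω) (hw : w =ᵐ[μ] μ[a | m]) :
    ∫⁻ ω, ENNReal.ofReal (f ω * w ω) ∂μ = ∫⁻ ω, ENNReal.ofReal (f ω * a ω) ∂μ := by
  have hfb : ∀ᵐ ω ∂μ, ‖f ω‖ ≤ T := ae_of_all _ fun ω => by
    rw [Real.norm_of_nonneg (hf0 ω)]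
    exact hfT ω
  have hfm : AEStronglyMeasurable[mΩ] f μ := (hf.mono hm le_rfl).aestronglyMeasurable
  have hwi : Integrable w μ := integrable_condExp.congr hw.symm
  rw [← ofReal_integral_eq_lintegral_ofReal (hwi.bdd_mul hfm hfb)
      (ae_of_all _ fun ω => mul_nonneg (hf0 ω) (hw0 ω)),
    ← ofReal_integral_eq_lintegral_ofReal (ha.bdd_mul hfm hfb)
      (ae_of_all _ fun ω => mul_nonneg (hf0 ω) (ha0 ω))]
  congr 1
  rw [← integral_condExp hm (f := fun ω => f ω * a ω)]
  refine integral_congr_ae ?_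
  filter_upwards [condExp_stronglyMeasurable_mul_of_bound hm hf.stronglyMeasurable ha T hfb, hw]
    with ω h1 h2
  rw [h2]
  exact h1.symm

lemma Real.rpow_sub_one_mul_le {x a q : ℝ} (hx : 0 ≤ x) (ha : 0 ≤ a) (hq : 1 ≤ q) :
    q * (x ^ (q - 1) * a) ≤ (1 - q⁻¹) * x ^ q + q⁻¹ * (q * a) ^ q := by
  have hq0 : 0 < q := by linarith
  have h := Real.geom_mean_le_arith_mean2_weighted (w₁ := 1 - q⁻¹) (w₂ := q⁻¹) (p₁ := x ^ q)
    (p₂ := (q * a) ^ q) (by simpa using inv_le_one_of_one_le₀ hq) (by positivity) (by positivity)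
    (by positivity) (by ring)
  rw [← Real.rpow_mul hx, ← Real.rpow_mul (by positivity), mul_inv_cancel₀ hq0.ne',
    Real.rpow_one, show q * (1 - q⁻¹) = q - 1 by field_simp] at h
  linarith

lemma ENNReal.le_of_le_convex_comb {a b : ℝ≥0∞} {s : ℝ} (hs : 0 < s) (hs1 : s ≤ 1) (ha : a ≠ ∞)
    (h : a ≤ ENNReal.ofReal (1 - s) * a + ENNReal.ofReal s * b) : a ≤ b := by
  rcases eq_or_ne b ∞ with rfl | hb
  · simp
  have h' := (ENNReal.toReal_le_toReal ha (by finiteness)).2 h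
  rw [ENNReal.toReal_add (by finiteness) (by finiteness), ENNReal.toReal_mul, ENNReal.toReal_mul,
    ENNReal.toReal_ofReal (by linarith), ENNReal.toReal_ofReal hs.le] at h'
  exact (ENNReal.toReal_le_toReal ha hb).1 (by nlinarith)

/-- Dual Doob inequality, under an additional boundedness assumption. -/
lemma lintegral_sum_condExp_rpow_le_of_le [IsProbabilityMeasure μ] {ℱ : Filtration ℕ mΩ}
    {a w : ℕ → Ω → ℝ} (ham : ∀ j, Measurable (a j)) (ha : ∀ j, Integrable (a j) μ)
    (ha0 : ∀ j ω, 0 ≤ a j ω) (hwm : ∀ j, Measurable[ℱ j] (w j)) (hw0 : ∀ j ω, 0 ≤ w j ω)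
    (hw : ∀ j, w j =ᵐ[μ] μ[a j | ℱ j]) {q : ℝ} (hq : 1 ≤ q) {N : ℕ} {T : ℝ}
    (hT : ∀ ω, ∑ j ∈ Finset.range N, w j ω ≤ T) :
    ∫⁻ ω, ENNReal.ofReal (∑ j ∈ Finset.range N, w j ω) ^ q ∂μ ≤
      ENNReal.ofReal q ^ q * ∫⁻ ω, ENNReal.ofReal (∑ j ∈ Finset.range N, a j ω) ^ q ∂μ := by
  have hq0 : 0 ≤ q := by linarith
  set W : ℕ → Ω → ℝ := fun n ω => ∑ j ∈ Finset.range n, w j ω with hW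
  set A : Ω → ℝ := fun ω => ∑ j ∈ Finset.range N, a j ω with hA
  have hW0 : ∀ n ω, 0 ≤ W n ω := fun n ω => Finset.sum_nonneg fun j _ => hw0 j ω
  have hA0 : ∀ ω, 0 ≤ A ω := fun ω => Finset.sum_nonneg fun j _ => ha0 j ω
  have hWmono : ∀ ω, Monotone fun n => W n ω := fun ω m n hmn =>
    Finset.sum_le_sum_of_subset_of_nonneg (Finset.range_mono hmn) fun j _ _ => hw0 j ω
  have hWm : ∀ n, Measurable[ℱ n] (W (n + 1)) := fun n =>
    Finset.measurable_fun_sum _ fun j hj =>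
      (hwm j).mono (ℱ.mono (Nat.lt_succ_iff.1 (Finset.mem_range.1 hj))) le_rfl
  have hwm' : ∀ j, Measurable (w j) := fun j => (hwm j).mono (ℱ.le j) le_rfl
  have hWm' : ∀ n, Measurable (W n) := fun n => Finset.measurable_fun_sum _ fun j _ => hwm' j
  have hAm : Measurable A := Finset.measurable_fun_sum _ fun j _ => ham j
  have hfin : ∫⁻ ω, ENNReal.ofReal (W N ω) ^ q ∂μ ≠ ∞ := by
    refine ne_top_of_le_ne_top ?_ (lintegral_mono (g := fun _ => ENNReal.ofReal T ^ q) fun ω => ?_)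
    · rw [lintegral_const]
      exact ENNReal.mul_ne_top (ENNReal.rpow_ne_top_of_nonneg hq0 (by simp)) (by simp)
    · dsimp only
      gcongr
      exact hT ω
  have hsum : ∀ b : ℕ → Ω → ℝ, (∀ j, Measurable (b j)) → (∀ j ω, 0 ≤ b j ω) →
      ∫⁻ ω, ENNReal.ofReal (q * ∑ j ∈ Finset.range N, W (j + 1) ω ^ (q - 1) * b j ω) ∂μ =
        ENNReal.ofReal q *
          ∑ j ∈ Finset.range N, ∫⁻ ω, ENNReal.ofReal (W (j + 1) ω ^ (q - 1) * b j ω) ∂μ := by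
    intro b hb hb0
    have hm : ∀ j, Measurable fun ω => ENNReal.ofReal (W (j + 1) ω ^ (q - 1) * b j ω) :=
      fun j => (((hWm' (j + 1)).pow_const _).mul (hb j)).ennreal_ofReal
    rw [← lintegral_finsetSum _ fun j _ => hm j,
      ← lintegral_const_mul _ (Finset.measurable_fun_sum _ fun j _ => hm j)]
    refine lintegral_congr fun ω => ?_
    rw [ENNReal.ofReal_mul hq0, ENNReal.ofReal_sum_of_nonneg fun j _ =>
      mul_nonneg (Real.rpow_nonneg (hW0 _ ω) _) (hb0 j ω)]
  refine ENNReal.le_of_le_convex_comb (s := q⁻¹) (by positivity) (inv_le_one_of_one_le₀ hq) hfin ?_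
  calc ∫⁻ ω, ENNReal.ofReal (W N ω) ^ q ∂μ
      ≤ ∫⁻ ω, ENNReal.ofReal
          (q * ∑ j ∈ Finset.range N, W (j + 1) ω ^ (q - 1) * w j ω) ∂μ := by
        refine lintegral_mono fun ω => ?_
        dsimp only
        rw [ENNReal.ofReal_rpow_of_nonneg (hW0 N ω) hq0]
        exact ENNReal.ofReal_le_ofReal (Real.sum_rpow_le (fun j => hw0 j ω) hq N)
    _ = ∫⁻ ω, ENNReal.ofReal
          (q * ∑ j ∈ Finset.range N, W (j + 1) ω ^ (q - 1) * a j ω) ∂μ := by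
        rw [hsum w hwm' hw0, hsum a ham ha0]
        congr 1
        refine Finset.sum_congr rfl fun j hj => ?_
        refine lintegral_mul_condExp (ℱ.le j) ((hWm j).pow_const _)
          (fun ω => Real.rpow_nonneg (hW0 _ ω) _) (T := T ^ (q - 1)) (fun ω => ?_) (ha j) (ha0 j)
          (hw0 j) (hw j)
        exact Real.rpow_le_rpow (hW0 _ ω)
          ((hWmono ω (Finset.mem_range.1 hj)).trans (hT ω)) (by linarith)
    _ ≤ ∫⁻ ω, (ENNReal.ofReal (1 - q⁻¹) * ENNReal.ofReal (W N ω) ^ q +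
          ENNReal.ofReal q⁻¹ * (ENNReal.ofReal q ^ q * ENNReal.ofReal (A ω) ^ q)) ∂μ := by
        refine lintegral_mono fun ω => ?_
        dsimp only
        rw [← ENNReal.mul_rpow_of_nonneg _ _ hq0, ← ENNReal.ofReal_mul hq0,
          ENNReal.ofReal_rpow_of_nonneg (hW0 N ω) hq0,
          ENNReal.ofReal_rpow_of_nonneg (mul_nonneg hq0 (hA0 ω)) hq0,
          ← ENNReal.ofReal_mul (by simpa using inv_le_one_of_one_le₀ hq),
          ← ENNReal.ofReal_mul (by positivity), ← ENNReal.ofReal_add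
            (mul_nonneg (by simpa using inv_le_one_of_one_le₀ hq) (Real.rpow_nonneg (hW0 N ω) _))
            (mul_nonneg (by positivity) (Real.rpow_nonneg (mul_nonneg hq0 (hA0 ω)) _))]
        refine ENNReal.ofReal_le_ofReal
          (le_trans ?_ (Real.rpow_sub_one_mul_le (hW0 N ω) (hA0 ω) hq))
        refine mul_le_mul_of_nonneg_left ?_ hq0
        rw [hA, Finset.mul_sum]
        refine Finset.sum_le_sum fun j hj => mul_le_mul_of_nonneg_right ?_ (ha0 j ω)
        exact Real.rpow_le_rpow (hW0 _ ω) (hWmono ω (Finset.mem_range.1 hj)) (by linarith)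
    _ = _ := by
        have h1 : Measurable fun ω => ENNReal.ofReal (W N ω) ^ q :=
          (hWm' N).ennreal_ofReal.pow_const q
        have h2 : Measurable fun ω => ENNReal.ofReal (A ω) ^ q := hAm.ennreal_ofReal.pow_const q
        rw [lintegral_add_left (h1.const_mul _), lintegral_const_mul _ h1,
          lintegral_const_mul _ (h2.const_mul _), lintegral_const_mul _ h2]

/-- Dual Doob inequality: compensators of a sum of nonnegative functions are controlled by it. -/
lemma lintegral_sum_condExp_rpow_le [IsProbabilityMeasure μ] {ℱ : Filtration ℕ mΩ}
    {a w : ℕ → Ω → ℝ} (ham : ∀ j, Measurable (a j)) (ha : ∀ j, Integrable (a j) μ)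
    (ha0 : ∀ j ω, 0 ≤ a j ω) (hwm : ∀ j, Measurable[ℱ j] (w j)) (hw0 : ∀ j ω, 0 ≤ w j ω)
    (hw : ∀ j, w j =ᵐ[μ] μ[a j | ℱ j]) {q : ℝ} (hq : 1 ≤ q) (N : ℕ) :
    ∫⁻ ω, ENNReal.ofReal (∑ j ∈ Finset.range N, w j ω) ^ q ∂μ ≤
      ENNReal.ofReal q ^ q * ∫⁻ ω, ENNReal.ofReal (∑ j ∈ Finset.range N, a j ω) ^ q ∂μ := by
  have hWm : ∀ n, Measurable[ℱ n] fun ω => ∑ i ∈ Finset.range (n + 1), w i ω := fun n =>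
    Finset.measurable_fun_sum _ fun j hj =>
      (hwm j).mono (ℱ.mono (Nat.lt_succ_iff.1 (Finset.mem_range.1 hj))) le_rfl
  set S : ℕ → ℕ → Set Ω := fun T j => {ω | ∑ i ∈ Finset.range (j + 1), w i ω ≤ T} with hS
  have hSm : ∀ T j, MeasurableSet[ℱ j] (S T j) := fun T j =>
    measurableSet_le (hWm j) measurable_const
  have hmono : ∀ ω {i j : ℕ}, i ≤ j → ∑ k ∈ Finset.range i, w k ω ≤ ∑ k ∈ Finset.range j, w k ω :=
    fun ω i j hij => Finset.sum_le_sum_of_subset_of_nonneg (Finset.range_mono hij)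
      fun k _ _ => hw0 k ω
  have hind0 : ∀ (b : ℕ → Ω → ℝ), (∀ j ω, 0 ≤ b j ω) → ∀ T j ω, 0 ≤ (S T j).indicator (b j) ω :=
    fun b hb T j => Set.indicator_nonneg fun ω _ => hb j ω
  have hle : ∀ T ω N, ∑ j ∈ Finset.range N, (S T j).indicator (w j) ω ≤ T := by
    intro T ω N
    induction N with
    | zero => simp
    | succ n ih =>
      by_cases h : ω ∈ S T n
      · refine le_trans (Finset.sum_le_sum fun j _ => ?_) h
        exact Set.indicator_le_self' (fun ω _ => hw0 j ω) ω
      · rw [Finset.sum_range_succ, Set.indicator_of_notMem h, add_zero]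
        exact ih
  have hlim : Filter.Tendsto
      (fun T : ℕ => ∫⁻ ω, ENNReal.ofReal (∑ j ∈ Finset.range N, (S T j).indicator (w j) ω) ^ q ∂μ)
      Filter.atTop (nhds (∫⁻ ω, ENNReal.ofReal (∑ j ∈ Finset.range N, w j ω) ^ q ∂μ)) := by
    refine lintegral_tendsto_of_tendsto_of_monotone (fun T => Measurable.aemeasurable ?_)
      (ae_of_all _ fun ω m n hmn => ?_) (ae_of_all _ fun ω => ?_)
    · refine (Finset.measurable_fun_sum _ fun j _ => ?_).ennreal_ofReal.pow_const q
      exact ((hwm j).indicator (hSm T j)).mono (ℱ.le j) le_rfl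
    · dsimp only
      refine ENNReal.rpow_le_rpow (ENNReal.ofReal_le_ofReal
        (Finset.sum_le_sum fun j _ => ?_)) (by linarith)
      refine Set.indicator_le_indicator_of_subset (fun x hx => ?_) (fun ω => hw0 j ω) ω
      exact le_trans (show _ ≤ (m : ℝ) from hx) (by exact_mod_cast hmn)
    · obtain ⟨T, hT⟩ := exists_nat_ge (∑ j ∈ Finset.range N, w j ω)
      refine tendsto_const_nhds.congr' ?_
      filter_upwards [Filter.eventually_ge_atTop T] with T' hT'
      congr 2
      refine Finset.sum_congr rfl fun j hj => (Set.indicator_of_mem ?_ _).symm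
      exact (hmono ω (Finset.mem_range.1 hj)).trans (hT.trans (by exact_mod_cast hT'))
  refine le_of_tendsto' hlim fun T => ?_
  refine (lintegral_sum_condExp_rpow_le_of_le (ℱ := ℱ)
    (a := fun j => (S T j).indicator (a j)) (fun j => (ham j).indicator (ℱ.le j _ (hSm T j)))
    (fun j => (ha j).indicator (ℱ.le j _ (hSm T j))) (hind0 a ha0 T)
    (fun j => (hwm j).indicator (hSm T j)) (hind0 w hw0 T) (fun j => ?_) hq (hle T · N)).trans ?_
  · filter_upwards [hw j, condExp_indicator (ha j) (hSm T j)] with ω h1 h2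
    rw [h2]
    simp only [Set.indicator_apply, h1]
  · gcongr with ω j
    exact Set.indicator_le_self' (fun ω _ => ha0 j ω) ω

end Integration

lemma ENNReal.ofReal_add_rpow_le (a b : ℝ) {q : ℝ} (hq : 1 ≤ q) :
    ENNReal.ofReal (a + b) ^ q ≤
      2 ^ (q - 1) * (ENNReal.ofReal a ^ q + ENNReal.ofReal b ^ q) :=
  (ENNReal.rpow_le_rpow ENNReal.ofReal_add_le (by linarith)).trans
    (ENNReal.rpow_add_le_mul_rpow_add_rpow _ _ hq)

/-- Davis decomposition: a martingale is the sum of one whose square function is predictably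
controlled, and of one whose increments are summable. -/
lemma exists_davis_decomposition {E : Type} [NormedAddCommGroup E] [NormedSpace ℝ E]
    [CompleteSpace E] [MeasurableSpace E] [BorelSpace E] [SecondCountableTopology E]
    {Y : PathSeminorm E} (hY : Y.IsSquareFunctionLike) {Ω : Type} {mΩ : MeasurableSpace Ω}
    {μ : Measure Ω} [IsProbabilityMeasure μ] {ℱ : Filtration ℕ mΩ} {d : ℕ → Ω → E}
    (hd : IsMartingaleDiff ℱ μ d) :
    ∃ (b c : ℕ → Ω → E) (w : ℕ → Ω → ℝ), IsMartingaleDiff ℱ μ c ∧ (∀ j, d j = c j + b j) ∧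
      (∀ j, Measurable[ℱ j] (w j)) ∧ (∀ j ω, 0 ≤ w j ω) ∧
      (∀ᵐ ω ∂μ, ∀ j, Y (j + 1) (fun i => c i ω) ≤
        2 * Y j (fun i => d i ω) + ∑ i ∈ Finset.range (j + 1), w i ω) ∧
      (∀ᵐ ω ∂μ, ∀ n, ∑ j ∈ Finset.range n, ‖b j ω‖ ≤
        2 * Y n (fun i => d i ω) + ∑ i ∈ Finset.range n, w i ω) ∧
      ∀ (q : ℝ) (n : ℕ), 1 ≤ q → ∫⁻ ω, ENNReal.ofReal (∑ j ∈ Finset.range n, w j ω) ^ q ∂μ ≤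
        ENNReal.ofReal q ^ q * ∫⁻ ω, ENNReal.ofReal (2 * Y n fun i => d i ω) ^ q ∂μ := by
  have hYm : ∀ j, Measurable[ℱ j] fun ω => Y j fun i => d i ω := fun j =>
    Y.measurable_comp j fun i hi => (hd.measurable i).mono (ℱ.mono hi) le_rfl
  set B : ℕ → Set Ω := fun j => {ω | 2 * Y j (fun i => d i ω) < Y (j + 1) fun i => d i ω} with hB
  have hBm : ∀ j, MeasurableSet[ℱ (j + 1)] (B j) := fun j =>
    measurableSet_lt (((hYm j).mono (ℱ.mono j.le_succ) le_rfl).const_mul 2) (hYm (j + 1))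
  have hBm' : ∀ j, MeasurableSet (B j) := fun j => ℱ.le _ _ (hBm j)
  set u : ℕ → Ω → E := fun j => (B j).indicator (d j) with hu
  have hui : ∀ j, Integrable (u j) μ := fun j => (hd.integrable j).indicator (hBm' j)
  set v : ℕ → Ω → E := fun j => μ[u j | ℱ j] with hv
  set w : ℕ → Ω → ℝ := fun j ω => |(μ[fun ω => ‖u j ω‖ | ℱ j]) ω| with hw
  have hwm : ∀ j, Measurable[ℱ j] (w j) := fun j => by
    have h : Measurable[ℱ j] (μ[fun ω => ‖u j ω‖ | ℱ j]) := stronglyMeasurable_condExp.measurable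
    exact measurable_norm.comp h
  have hvw : ∀ᵐ ω ∂μ, ∀ j, ‖v j ω‖ ≤ w j ω := by
    refine ae_all_iff.2 fun j => ?_
    filter_upwards [norm_condExp_le (m := ℱ j) (μ := μ) (u j)] with ω h
    exact h.trans (le_abs_self _)
  have husum : ∀ ω n, ∑ j ∈ Finset.range n, ‖u j ω‖ ≤ 2 * Y n fun i => d i ω := by
    intro ω n
    have hstep : ∀ j, ‖u j ω‖ ≤ 2 * Y (j + 1) (fun i => d i ω) - 2 * Y j fun i => d i ω := by
      intro j
      have hmono := Y.mono (fun i => d i ω) j.le_succ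
      dsimp only [Nat.succ_eq_add_one] at hmono
      by_cases h : ω ∈ B j
      · have h1 := hY.norm_le j fun i => d i ω
        have h2 : 2 * Y j (fun i => d i ω) < Y (j + 1) fun i => d i ω := h
        simp only [hu, Set.indicator_of_mem h]
        linarith
      · simp only [hu, Set.indicator_of_notMem h, norm_zero]
        linarith
    refine (Finset.sum_le_sum fun j _ => hstep j).trans_eq ?_
    rw [Finset.sum_range_sub fun j => 2 * Y j fun i => d i ω, Y.zero_left]
    ring
  refine ⟨fun j => u j - v j, fun j => d j - u j + v j, w, ⟨fun j => ?_, fun j => ?_, fun j => ?_⟩,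
    fun j => by funext ω; simp only [Pi.add_apply, Pi.sub_apply]; abel,
    hwm, fun j ω => abs_nonneg _, ?_, ?_, fun q n hq => ?_⟩
  · exact ((hd.measurable j).sub ((hd.measurable j).indicator (hBm j))).add
      (stronglyMeasurable_condExp.measurable.mono (ℱ.mono j.le_succ) le_rfl)
  · exact ((hd.integrable j).sub (hui j)).add integrable_condExp
  · have h1 := condExp_add ((hd.integrable j).sub (hui j))
      (integrable_condExp (m := ℱ j) (f := u j)) (ℱ j)
    have h2 := condExp_sub (hd.integrable j) (hui j) (ℱ j)
    have h3 : μ[v j | ℱ j] = v j :=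
      condExp_of_stronglyMeasurable (ℱ.le j) stronglyMeasurable_condExp integrable_condExp
    filter_upwards [h1, h2, hd.condExp_eq_zero j] with ω h1 h2 h4
    rw [h1, Pi.add_apply, h2, Pi.sub_apply, h4]
    change 0 - v j ω + (μ[v j | ℱ j]) ω = 0
    rw [h3]
    simp
  · filter_upwards [hvw] with ω hω j
    have hsplit : (fun i => (d i - u i + v i) ω) =
        Set.indicator {i | ω ∉ B i} (fun i => d i ω) + fun i => v i ω := by
      funext i
      by_cases h : ω ∈ B i <;> simp [hu, h]
    rw [hsplit]
    refine (Y.add_le _ _ _).trans (add_le_add ?_ ((Y.le_sum _ _).trans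
      (Finset.sum_le_sum fun i _ => hω i)))
    have h0 := Y.nonneg j fun i => d i ω
    by_cases h : ω ∈ B j
    · have h1 := Y.succ_le j (Set.indicator {i | ω ∉ B i} fun i => d i ω)
      rw [Set.indicator_of_notMem (by simpa using h), norm_zero] at h1
      have h2 := hY.indicator_le j (fun i => d i ω) {i | ω ∉ B i}
      linarith
    · exact (hY.indicator_le _ _ _).trans (not_lt.1 h)
  · filter_upwards [hvw] with ω hω n
    refine le_trans (Finset.sum_le_sum fun j _ => norm_sub_le _ _) ?_
    rw [Finset.sum_add_distrib]
    exact add_le_add (husum ω n) (Finset.sum_le_sum fun i _ => hω i)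
  · refine (lintegral_sum_condExp_rpow_le (ℱ := ℱ) (a := fun j ω => ‖u j ω‖)
      (fun j => ?_) (fun j => (hui j).norm) (fun j ω => norm_nonneg _) hwm
      (fun j ω => abs_nonneg _) (fun j => ?_) hq n).trans ?_
    · exact (((hd.measurable j).mono (ℱ.le _) le_rfl).indicator (hBm' j)).norm
    · filter_upwards [condExp_nonneg (m := ℱ j) (μ := μ)
        (ae_of_all _ fun ω => norm_nonneg (u j ω))] with ω h
      exact abs_of_nonneg h
    · gcongr with ω
      exact husum ω n

lemma exists_pos_three_rpow_mul_le {C : ℝ≥0∞} (hC : C < ∞) (q : ℝ) {r : ℝ} (hr : 1 ≤ r) :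
    ∃ δ : ℝ, 0 < δ ∧ δ ≤ 1 ∧ 3 ^ q * (C * ENNReal.ofReal δ ^ r) ≤ 2⁻¹ := by
  lift C to NNReal using hC.ne
  have hK : (0 : ℝ) ≤ 3 ^ q * C := by positivity
  set δ : ℝ := (2 * (3 ^ q * C) + 1)⁻¹ with hδ
  have hδ0 : 0 < δ := by positivity
  have hδ1 : δ ≤ 1 := inv_le_one_of_one_le₀ (by linarith)
  refine ⟨δ, hδ0, hδ1, ?_⟩
  have h1 : ENNReal.ofReal δ ^ r ≤ ENNReal.ofReal δ := by
    simpa using ENNReal.rpow_le_rpow_of_exponent_ge (ENNReal.ofReal_le_one.2 hδ1) hr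
  have h2 : (3 : ℝ≥0∞) ^ q = ENNReal.ofReal (3 ^ q) := by
    rw [← ENNReal.ofReal_rpow_of_pos (by norm_num), ENNReal.ofReal_ofNat]
  have h3 : (2⁻¹ : ℝ≥0∞) = ENNReal.ofReal 2⁻¹ := by
    rw [ENNReal.ofReal_inv_of_pos (by norm_num), ENNReal.ofReal_ofNat]
  calc (3 : ℝ≥0∞) ^ q * (C * ENNReal.ofReal δ ^ r)
      ≤ 3 ^ q * (C * ENNReal.ofReal δ) := by gcongr
    _ = ENNReal.ofReal (3 ^ q * (C * δ)) := by
        rw [h2, ← ENNReal.ofReal_coe_nnreal, ← ENNReal.ofReal_mul (by positivity),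
          ← ENNReal.ofReal_mul (by positivity)]
    _ ≤ 2⁻¹ := by
        rw [h3]
        refine ENNReal.ofReal_le_ofReal ?_
        rw [← mul_assoc, hδ, ← div_eq_mul_inv, div_le_iff₀ (by positivity)]
        linarith

theorem exists_strongBound_of_weakBound {r q : ℝ} (hr : 1 ≤ r) (hq : 1 ≤ q) {C : ℝ≥0∞}
    (hC : C < ∞) : ∃ C' : ℝ≥0∞, C' < ∞ ∧ ∀ (E : Type) [NormedAddCommGroup E] [NormedSpace ℝ E]
      [CompleteSpace E] [MeasurableSpace E] [BorelSpace E] [SecondCountableTopology E]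
      (X Y : PathSeminorm E), Y.IsSquareFunctionLike → WeakBound X Y r C →
        StrongBound X Y q C' := by
  obtain ⟨δ, hδ0, hδ1, hδ⟩ := exists_pos_three_rpow_mul_le hC q hr
  have hq0 : 0 ≤ q := by linarith
  set G : ℝ≥0∞ := 2 * (3 ^ q * ENNReal.ofReal δ⁻¹ ^ q) with hG
  set K : ℝ≥0∞ := 2 ^ (q - 1) * ((1 + ENNReal.ofReal q ^ q) * 2 ^ q) with hK
  have h2 : (2 : ℝ≥0∞) ^ (q - 1) ≠ ∞ := ENNReal.rpow_ne_top_of_nonneg (by linarith) (by simp)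
  have hpow : ∀ a : ℝ≥0∞, a ≠ ∞ → a ^ q ≠ ∞ := fun a => ENNReal.rpow_ne_top_of_nonneg hq0
  have hGt : G ≠ ∞ := ENNReal.mul_ne_top (by simp) (ENNReal.mul_ne_top (hpow _ (by simp))
    (hpow _ (by simp)))
  have hKt : K ≠ ∞ := ENNReal.mul_ne_top h2 (ENNReal.mul_ne_top
    (ENNReal.add_ne_top.2 ⟨by simp, hpow _ (by simp)⟩) (hpow _ (by simp)))
  refine ⟨2 ^ (q - 1) * (G + 1) * K, lt_top_iff_ne_top.2 (ENNReal.mul_ne_top (ENNReal.mul_ne_top h2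
    (ENNReal.add_ne_top.2 ⟨hGt, by simp⟩)) hKt), ?_⟩
  intro E _ _ _ _ _ _ X Y hY hXY Ω mΩ μ _ ℱ d hd n
  cases n with
  | zero => simp [X.zero_left, show 0 < q by linarith]
  | succ N =>
  obtain ⟨b, c, w, hc, hdcb, hwm, hw0, hYc, hb, hwq⟩ := exists_davis_decomposition hY hd
  have hYm : ∀ j, Measurable[ℱ j] fun ω => Y j fun i => d i ω := fun j =>
    Y.measurable_comp j fun i hi => (hd.measurable i).mono (ℱ.mono hi) le_rfl
  have hWm : ∀ n, Measurable[ℱ n] fun ω => ∑ i ∈ Finset.range (n + 1), w i ω := fun n =>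
    Finset.measurable_fun_sum _ fun j hj =>
      (hwm j).mono (ℱ.mono (Nat.lt_succ_iff.1 (Finset.mem_range.1 hj))) le_rfl
  set ρ : ℕ → Ω → ℝ := fun j ω =>
    2 * Y j (fun i => d i ω) + ∑ i ∈ Finset.range (j + 1), w i ω with hρ
  have hρm : ∀ j, Measurable[ℱ j] (ρ j) := fun j => ((hYm j).const_mul 2).add (hWm j)
  have hW0 : ∀ n ω, 0 ≤ ∑ i ∈ Finset.range n, w i ω :=
    fun n ω => Finset.sum_nonneg fun i _ => hw0 i ω
  have hρ0 : ∀ j ω, 0 ≤ ρ j ω := fun j ω =>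
    add_nonneg (mul_nonneg (by norm_num) (Y.nonneg _ _)) (hW0 _ ω)
  have hρmono : ∀ ω, Monotone fun j => ρ j ω := fun ω i j hij =>
    add_le_add (mul_le_mul_of_nonneg_left (Y.mono _ hij) (by norm_num))
      (Finset.sum_le_sum_of_subset_of_nonneg (Finset.range_mono (by omega)) fun k _ _ => hw0 k ω)
  have hXcm : Measurable fun ω => X (N + 1) fun i => c i ω :=
    X.measurable_comp _ fun i _ => (hc.measurable i).mono (ℱ.le _) le_rfl
  have hXc := lintegral_rpow_le_of_goodLambda hXcm (fun ω => X.nonneg _ _)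
    ((hρm N).mono (ℱ.le N) le_rfl) (hρ0 N) hq hδ0 hδ fun l hl =>
      measure_lt_le_of_weakBound hY hr hXY hc hρm hρmono hYc N hδ0 hδ1 hl
  rw [← mul_assoc, ← hG] at hXc
  set Z : Ω → ℝ := fun ω =>
    2 * Y (N + 1) (fun i => d i ω) + ∑ i ∈ Finset.range (N + 1), w i ω with hZ
  have hρZ : ∀ ω, ρ N ω ≤ Z ω := fun ω =>
    add_le_add (mul_le_mul_of_nonneg_left (Y.mono _ N.le_succ) (by norm_num)) le_rfl
  have hYm' : Measurable fun ω => ENNReal.ofReal (Y (N + 1) fun i => d i ω) ^ q :=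
    (((hYm (N + 1)).mono (ℱ.le _) le_rfl).ennreal_ofReal.pow_const q)
  have h2Y : ∫⁻ ω, ENNReal.ofReal (2 * Y (N + 1) fun i => d i ω) ^ q ∂μ =
      2 ^ q * ∫⁻ ω, ENNReal.ofReal (Y (N + 1) fun i => d i ω) ^ q ∂μ := by
    rw [← lintegral_const_mul _ hYm']
    refine lintegral_congr fun ω => ?_
    rw [ENNReal.ofReal_mul (by norm_num), ENNReal.mul_rpow_of_nonneg _ _ hq0, ENNReal.ofReal_ofNat]
  have hZq : ∫⁻ ω, ENNReal.ofReal (Z ω) ^ q ∂μ ≤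
      K * ∫⁻ ω, ENNReal.ofReal (Y (N + 1) fun i => d i ω) ^ q ∂μ := by
    have hm1 : Measurable fun ω => ENNReal.ofReal (2 * Y (N + 1) fun i => d i ω) ^ q :=
      (((hYm (N + 1)).mono (ℱ.le _) le_rfl).const_mul 2).ennreal_ofReal.pow_const q
    have hm2 : Measurable fun ω => ENNReal.ofReal (∑ i ∈ Finset.range (N + 1), w i ω) ^ q :=
      ((hWm N).mono (ℱ.le _) le_rfl).ennreal_ofReal.pow_const q
    refine (lintegral_mono fun ω => ENNReal.ofReal_add_rpow_le _ _ hq).trans ?_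
    rw [lintegral_const_mul' _ _ h2, lintegral_add_left hm1, hK, mul_assoc]
    refine mul_le_mul_right ?_ _
    refine (add_le_add_right (hwq q (N + 1) hq) _).trans_eq ?_
    rw [h2Y]
    ring
  have hXm : Measurable fun ω => ENNReal.ofReal (X (N + 1) fun i => c i ω) ^ q :=
    hXcm.ennreal_ofReal.pow_const q
  have hZm : Measurable fun ω => ENNReal.ofReal (Z ω) ^ q :=
    ((((hYm (N + 1)).mono (ℱ.le _) le_rfl).const_mul 2).add
      ((hWm N).mono (ℱ.le _) le_rfl)).ennreal_ofReal.pow_const q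
  calc ∫⁻ ω, ENNReal.ofReal (X (N + 1) fun j => d j ω) ^ q ∂μ
      ≤ ∫⁻ ω, 2 ^ (q - 1) * (ENNReal.ofReal (X (N + 1) fun j => c j ω) ^ q +
          ENNReal.ofReal (Z ω) ^ q) ∂μ := by
        refine lintegral_mono_ae ?_
        filter_upwards [hb] with ω hω
        refine le_trans ?_ (ENNReal.ofReal_add_rpow_le _ _ hq)
        refine ENNReal.rpow_le_rpow (ENNReal.ofReal_le_ofReal ?_) hq0
        have hsplit : (fun j => d j ω) = (fun j => c j ω) + fun j => b j ω := by
          funext j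
          rw [hdcb j]
          rfl
        rw [hsplit]
        exact (X.add_le _ _ _).trans (add_le_add le_rfl
          ((X.le_sum _ _).trans (hω (N + 1))))
    _ = 2 ^ (q - 1) * (∫⁻ ω, ENNReal.ofReal (X (N + 1) fun j => c j ω) ^ q ∂μ +
          ∫⁻ ω, ENNReal.ofReal (Z ω) ^ q ∂μ) := by
        rw [lintegral_const_mul' _ _ h2, lintegral_add_left hXm]
    _ ≤ 2 ^ (q - 1) * (G * ∫⁻ ω, ENNReal.ofReal (Z ω) ^ q ∂μ +
          ∫⁻ ω, ENNReal.ofReal (Z ω) ^ q ∂μ) := by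
        refine mul_le_mul_right (add_le_add (hXc.trans (mul_le_mul_right
          (lintegral_mono fun ω => ?_) _)) le_rfl) _
        exact ENNReal.rpow_le_rpow (ENNReal.ofReal_le_ofReal (hρZ ω)) hq0
    _ = 2 ^ (q - 1) * (G + 1) * ∫⁻ ω, ENNReal.ofReal (Z ω) ^ q ∂μ := by ring
    _ ≤ 2 ^ (q - 1) * (G + 1) *
          (K * ∫⁻ ω, ENNReal.ofReal (Y (N + 1) fun i => d i ω) ^ q ∂μ) := by gcongr
    _ = _ := by ring
/-- The square function of a real path, as a functional of its increments. -/
noncomputable def PathSeminorm.squareFunction : PathSeminorm ℝ where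
  toFun n x := √(∑ j ∈ Finset.range n, x j ^ 2)
  zero_left x := by simp
  add_le n x y := by
    refine Real.sqrt_le_iff.2 ⟨by positivity, ?_⟩
    have hx : 0 ≤ ∑ j ∈ Finset.range n, x j ^ 2 := by positivity
    have hy : 0 ≤ ∑ j ∈ Finset.range n, y j ^ 2 := by positivity
    have h := Real.sum_mul_le_sqrt_mul_sqrt (Finset.range n) x y
    simp only [Pi.add_apply, add_sq, Finset.sum_add_distrib, Real.sq_sqrt hx, Real.sq_sqrt hy,
      mul_assoc, ← Finset.mul_sum]
    linarith
  mono x m n hmn := Real.sqrt_le_sqrt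
    (Finset.sum_le_sum_of_subset_of_nonneg (Finset.range_mono hmn) fun j _ _ => sq_nonneg _)
  succ_le n x := by
    have hx : 0 ≤ ∑ j ∈ Finset.range n, x j ^ 2 := by positivity
    refine Real.sqrt_le_iff.2 ⟨by positivity, ?_⟩
    rw [Finset.sum_range_succ, add_sq, Real.sq_sqrt hx, Real.norm_eq_abs, sq_abs]
    have : 0 ≤ 2 * √(∑ j ∈ Finset.range n, x j ^ 2) * |x n| := by positivity
    linarith
  congr n x y h := by
    rw [Finset.sum_congr rfl fun j hj => by rw [h j (Finset.mem_range.1 hj)]]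
  measurable n := (Finset.measurable_fun_sum _ fun j _ => (measurable_pi_apply j).pow_const 2).sqrt

lemma PathSeminorm.isSquareFunctionLike_squareFunction : squareFunction.IsSquareFunctionLike where
  norm_le n x := Real.abs_le_sqrt
    (Finset.single_le_sum (f := fun j => x j ^ 2) (fun j _ => sq_nonneg _)
      (Finset.self_mem_range_succ n))
  indicator_le n x S := by
    refine Real.sqrt_le_sqrt (Finset.sum_le_sum fun j _ => ?_)
    by_cases h : j ∈ S
    · simp [h]
    · simp [h, sq_nonneg]

/-- The largest absolute value among the first partial sums of a sequence. -/
noncomputable def maxAbsSum : ℕ → (ℕ → ℝ) → ℝ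
  | 0, _ => 0
  | n + 1, x => max (maxAbsSum n x) |∑ j ∈ Finset.range (n + 1), x j|

lemma maxAbsSum_mono (x : ℕ → ℝ) : Monotone fun n => maxAbsSum n x :=
  monotone_nat_of_le_succ fun _ => le_max_left _ _

lemma abs_sum_le_maxAbsSum {m n : ℕ} (hmn : m ≤ n) (x : ℕ → ℝ) :
    |∑ j ∈ Finset.range m, x j| ≤ maxAbsSum n x := by
  refine le_trans ?_ (maxAbsSum_mono x hmn)
  cases m with
  | zero => simp [maxAbsSum]
  | succ m => exact le_max_right _ _

lemma maxAbsSum_le {n : ℕ} {x : ℕ → ℝ} {b : ℝ}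
    (h : ∀ m ≤ n, |∑ j ∈ Finset.range m, x j| ≤ b) : maxAbsSum n x ≤ b := by
  induction n with
  | zero => simpa [maxAbsSum] using h 0 le_rfl
  | succ n ih => exact max_le (ih fun m hm => h m (hm.trans n.le_succ)) (h _ le_rfl)

lemma exists_maxAbsSum_eq (n : ℕ) (x : ℕ → ℝ) :
    ∃ m ≤ n, maxAbsSum n x = |∑ j ∈ Finset.range m, x j| := by
  induction n with
  | zero => exact ⟨0, le_rfl, by simp [maxAbsSum]⟩
  | succ n ih =>
    obtain ⟨m, hm, h⟩ := ih
    rcases max_choice (maxAbsSum n x) |∑ j ∈ Finset.range (n + 1), x j| with h' | h'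
    · exact ⟨m, hm.trans n.le_succ, h'.trans h⟩
    · exact ⟨n + 1, le_rfl, h'⟩

/-- The maximal function of a real path, as a functional of its increments. -/
noncomputable def PathSeminorm.maximalFunction : PathSeminorm ℝ where
  toFun := maxAbsSum
  zero_left _ := rfl
  add_le n x y := by
    refine maxAbsSum_le fun m hm => ?_
    simp only [Pi.add_apply, Finset.sum_add_distrib]
    exact (abs_add_le _ _).trans
      (add_le_add (abs_sum_le_maxAbsSum hm x) (abs_sum_le_maxAbsSum hm y))
  mono := maxAbsSum_mono
  succ_le n x := by
    refine max_le (le_add_of_nonneg_right (norm_nonneg _)) ?_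
    rw [Finset.sum_range_succ]
    exact (abs_add_le _ _).trans (add_le_add (abs_sum_le_maxAbsSum le_rfl x) le_rfl)
  congr n x y h := by
    have hsum : ∀ m ≤ n, ∑ j ∈ Finset.range m, x j = ∑ j ∈ Finset.range m, y j := fun m hm =>
      Finset.sum_congr rfl fun j hj => h j ((Finset.mem_range.1 hj).trans_le hm)
    refine le_antisymm (maxAbsSum_le fun m hm => ?_) (maxAbsSum_le fun m hm => ?_)
    · rw [hsum m hm]
      exact abs_sum_le_maxAbsSum hm y
    · rw [← hsum m hm]
      exact abs_sum_le_maxAbsSum hm x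
  measurable n := by
    induction n with
    | zero => exact measurable_const
    | succ n ih =>
      exact ih.max (measurable_norm.comp
        (Finset.measurable_fun_sum _ fun j _ => measurable_pi_apply j))

namespace IsMartingaleDiff

section

variable {Ω E : Type} {mΩ : MeasurableSpace Ω} [NormedAddCommGroup E] [NormedSpace ℝ E]
  [CompleteSpace E] [MeasurableSpace E] {ℱ : Filtration ℕ mΩ} {μ : Measure Ω} {d : ℕ → Ω → E}

lemma truncate (hd : IsMartingaleDiff ℱ μ d) (n : ℕ) :
    IsMartingaleDiff ℱ μ fun j => if j < n then d j else 0 where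
  measurable j := by
    split_ifs
    · exact hd.measurable j
    · exact measurable_const
  integrable j := by
    split_ifs
    · exact hd.integrable j
    · exact integrable_zero _ _ _
  condExp_eq_zero j := by
    split_ifs
    · exact hd.condExp_eq_zero j
    · rw [condExp_zero]

end

variable {Ω : Type} {mΩ : MeasurableSpace Ω} {ℱ : Filtration ℕ mΩ} {μ : Measure Ω}
  {d : ℕ → Ω → ℝ}

lemma condExp_sum_mul_eq_zero (hd : IsMartingaleDiff ℱ μ d) (hd2 : ∀ j, MemLp (d j) 2 μ) (m : ℕ) :
    μ[(fun ω => ∑ j ∈ Finset.range m, d j ω) * d m | ℱ m] =ᵐ[μ] 0 := by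
  have hm : StronglyMeasurable[ℱ m] fun ω => ∑ j ∈ Finset.range m, d j ω :=
    (Finset.measurable_fun_sum _ fun j hj =>
      (hd.measurable j).mono (ℱ.mono (Finset.mem_range.1 hj)) le_rfl).stronglyMeasurable
  have h2 : MemLp (fun ω => ∑ j ∈ Finset.range m, d j ω) 2 μ := memLp_finsetSum _ fun j _ => hd2 j
  filter_upwards [condExp_mul_of_stronglyMeasurable_left hm (h2.integrable_mul (hd2 m))
    (hd.integrable m), hd.condExp_eq_zero m] with ω h h'
  rw [h, Pi.mul_apply, h', Pi.zero_apply, mul_zero]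

variable [IsProbabilityMeasure μ]

lemma integral_sum_sq (hd : IsMartingaleDiff ℱ μ d) (hd2 : ∀ j, MemLp (d j) 2 μ) (n : ℕ) :
    ∫ ω, (∑ j ∈ Finset.range n, d j ω) ^ 2 ∂μ = ∑ j ∈ Finset.range n, ∫ ω, d j ω ^ 2 ∂μ := by
  induction n with
  | zero => simp
  | succ n ih =>
    have h2 : MemLp (fun ω => ∑ j ∈ Finset.range n, d j ω) 2 μ :=
      memLp_finsetSum _ fun j _ => hd2 j
    have hmul : Integrable ((fun ω => ∑ j ∈ Finset.range n, d j ω) * d n) μ :=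
      h2.integrable_mul (hd2 n)
    have h0 : ∫ ω, ((fun ω => ∑ j ∈ Finset.range n, d j ω) * d n) ω ∂μ = 0 := by
      rw [← integral_condExp (ℱ.le n), integral_congr_ae (hd.condExp_sum_mul_eq_zero hd2 n)]
      simp
    have hexp : ∀ ω, (∑ j ∈ Finset.range (n + 1), d j ω) ^ 2 =
        (∑ j ∈ Finset.range n, d j ω) ^ 2 +
          2 * ((fun ω => ∑ j ∈ Finset.range n, d j ω) * d n) ω + d n ω ^ 2 := fun ω => by
      rw [Finset.sum_range_succ, Pi.mul_apply]
      ring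
    have h1 := integral_add h2.integrable_sq (hmul.const_mul 2)
    have h3 := integral_add (h2.integrable_sq.add (hmul.const_mul 2)) (hd2 n).integrable_sq
    refine (integral_congr_ae (ae_of_all _ hexp)).trans (h3.trans ?_)
    rw [show ∫ ω, ((fun ω => (∑ j ∈ Finset.range n, d j ω) ^ 2) + fun ω =>
      2 * ((fun ω => ∑ j ∈ Finset.range n, d j ω) * d n) ω) ω ∂μ = _ from h1,
      integral_const_mul, h0, ih,
      Finset.sum_range_succ]
    ring

lemma submartingale_sum_sq (hd : IsMartingaleDiff ℱ μ d) (hd2 : ∀ j, MemLp (d j) 2 μ) :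
    Submartingale (fun n ω => (∑ j ∈ Finset.range n, d j ω) ^ 2) ℱ μ := by
  have h2 : ∀ m, MemLp (fun ω => ∑ j ∈ Finset.range m, d j ω) 2 μ := fun m =>
    memLp_finsetSum _ fun j _ => hd2 j
  have hm : ∀ m, StronglyMeasurable[ℱ m] fun ω => (∑ j ∈ Finset.range m, d j ω) ^ 2 := fun m =>
    ((Finset.measurable_fun_sum _ fun j hj =>
      (hd.measurable j).mono (ℱ.mono (Finset.mem_range.1 hj)) le_rfl).pow_const 2).stronglyMeasurable
  refine submartingale_nat hm (fun m => (h2 m).integrable_sq) fun m => ?_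
  set a : Ω → ℝ := fun ω => (∑ j ∈ Finset.range m, d j ω) ^ 2 with ha
  set b : Ω → ℝ := (fun ω => ∑ j ∈ Finset.range m, d j ω) * d m with hb
  have hb' : Integrable b μ := (h2 m).integrable_mul (hd2 m)
  have hexp : (fun ω => (∑ j ∈ Finset.range (m + 1), d j ω) ^ 2) =
      a + ((2 : ℝ) • b + fun ω => d m ω ^ 2) := by
    funext ω
    simp only [Finset.sum_range_succ, Pi.add_apply, Pi.smul_apply, Pi.mul_apply, smul_eq_mul, ha, hb]
    ring
  rw [hexp]
  filter_upwards [condExp_add (h2 m).integrable_sq ((hb'.smul (2 : ℝ)).add (hd2 m).integrable_sq)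
      (ℱ m), condExp_add (hb'.smul (2 : ℝ)) (hd2 m).integrable_sq (ℱ m),
    condExp_smul (2 : ℝ) b (m := ℱ m) (μ := μ), hd.condExp_sum_mul_eq_zero hd2 m,
    condExp_nonneg (m := ℱ m) (ae_of_all μ fun ω => sq_nonneg (d m ω))] with ω h3 h4 h5 h6 h7
  rw [h3, Pi.add_apply, h4, Pi.add_apply, h5, Pi.smul_apply, h6,
    condExp_of_stronglyMeasurable (ℱ.le m) (hm m) (h2 m).integrable_sq]
  simpa [ha] using h7

end IsMartingaleDiff

lemma weakBound_maximalFunction_squareFunction :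
    WeakBound PathSeminorm.maximalFunction PathSeminorm.squareFunction 2 1 := by
  intro Ω mΩ μ _ ℱ d hd n l hl
  have hY : ∀ x : ℕ → ℝ, ENNReal.ofReal (PathSeminorm.squareFunction n x) ^ (2 : ℝ) =
      ∑ j ∈ Finset.range n, ENNReal.ofReal (x j ^ 2) := fun x => by
    change ENNReal.ofReal √(∑ j ∈ Finset.range n, x j ^ 2) ^ (2 : ℝ) = _
    rw [ENNReal.rpow_two, ← ENNReal.ofReal_pow (Real.sqrt_nonneg _), Real.sq_sqrt (by positivity),
      ENNReal.ofReal_sum_of_nonneg fun j _ => sq_nonneg _]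
  have hdm : ∀ j, Measurable (d j) := fun j => (hd.measurable j).mono (ℱ.le _) le_rfl
  rw [one_mul, lintegral_congr fun ω => hY fun j => d j ω, lintegral_finsetSum _ fun j _ =>
    ((hdm j).pow_const 2).ennreal_ofReal]
  by_cases hfin : ∃ j ∈ Finset.range n, ∫⁻ ω, ENNReal.ofReal (d j ω ^ 2) ∂μ = ∞
  · rw [ENNReal.sum_eq_top.2 hfin]
    exact le_top
  push Not at hfin
  set e : ℕ → Ω → ℝ := fun j => if j < n then d j else 0 with he
  have hed : IsMartingaleDiff ℱ μ e := hd.truncate n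
  have hej : ∀ j ∈ Finset.range n, e j = d j := fun j hj => by simp [he, Finset.mem_range.1 hj]
  have he2 : ∀ j, MemLp (e j) 2 μ := fun j => by
    by_cases hj : j ∈ Finset.range n
    · rw [hej j hj, memLp_two_iff_integrable_sq (hdm j).aestronglyMeasurable]
      exact ⟨((hdm j).pow_const 2).aestronglyMeasurable,
        (hasFiniteIntegral_iff_ofReal (ae_of_all _ fun ω => sq_nonneg _)).2
          (lt_top_iff_ne_top.2 (hfin j hj))⟩
    · rw [he]
      simp only [if_neg (mt Finset.mem_range.2 hj)]
      exact MemLp.zero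
  have hsub := hed.submartingale_sum_sq he2
  set ε : NNReal := ⟨l ^ 2, sq_nonneg l⟩ with hε
  have hmax := maximal_ineq hsub (fun m ω => sq_nonneg _) (ε := ε) n
  have hl2 : ENNReal.ofReal l ^ (2 : ℝ) = ε := by
    rw [ENNReal.rpow_two, ← ENNReal.ofReal_pow hl.le, ENNReal.ofReal_eq_coe_nnreal (sq_nonneg l)]
    rfl
  calc ENNReal.ofReal l ^ (2 : ℝ) * μ {ω | l ≤ PathSeminorm.maximalFunction n fun j => d j ω}
      ≤ ε * μ {ω | (ε : ℝ) ≤ (Finset.range (n + 1)).sup' Finset.nonempty_range_add_one fun k =>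
          (∑ j ∈ Finset.range k, e j ω) ^ 2} := by
        rw [hl2]
        refine mul_le_mul_right (measure_mono fun ω hω => ?_) _
        change l ≤ maxAbsSum n fun j => d j ω at hω
        obtain ⟨m, hm, h⟩ := exists_maxAbsSum_eq n fun j => d j ω
        have hsum : ∑ j ∈ Finset.range m, e j ω = ∑ j ∈ Finset.range m, d j ω :=
          Finset.sum_congr rfl fun j hj => by rw [hej j (Finset.range_mono hm hj)]
        refine le_trans ?_ (Finset.le_sup' (fun k => (∑ j ∈ Finset.range k, e j ω) ^ 2)
          (Finset.mem_range.2 (Nat.lt_succ_of_le hm)))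
        change l ^ 2 ≤ (∑ j ∈ Finset.range m, e j ω) ^ 2
        rw [hsum, ← sq_abs (∑ j ∈ Finset.range m, d j ω), ← h]
        exact pow_le_pow_left₀ hl.le hω 2
    _ ≤ ENNReal.ofReal (∫ ω, (∑ j ∈ Finset.range n, e j ω) ^ 2 ∂μ) :=
        hmax.trans (ENNReal.ofReal_le_ofReal
          (setIntegral_le_integral (hsub.integrable n) (ae_of_all _ fun ω => sq_nonneg _)))
    _ = ∑ j ∈ Finset.range n, ∫⁻ ω, ENNReal.ofReal (d j ω ^ 2) ∂μ := by
        rw [hed.integral_sum_sq he2, ENNReal.ofReal_sum_of_nonneg fun j _ =>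
          integral_nonneg fun ω => sq_nonneg _]
        refine Finset.sum_congr rfl fun j hj => ?_
        rw [ofReal_integral_eq_lintegral_ofReal (he2 j).integrable_sq
          (ae_of_all _ fun ω => sq_nonneg _), hej j hj]

section Lp

variable {ι : Type} [Fintype ι] {p : ℝ≥0∞} [hp1 : Fact (1 ≤ p)]

lemma PiLp.ofReal_norm_rpow (hp : p ≠ ∞) (x : PiLp p fun _ : ι => ℝ) :
    ENNReal.ofReal ‖x‖ ^ p.toReal = ∑ k, ENNReal.ofReal |x k| ^ p.toReal := by
  have hp0 : 0 < p.toReal := ENNReal.toReal_pos (zero_lt_one.trans_le hp1.out).ne' hp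
  rw [ENNReal.ofReal_rpow_of_nonneg (norm_nonneg _) hp0.le, PiLp.norm_eq_sum hp0,
    ← Real.rpow_mul (Finset.sum_nonneg fun k _ => by positivity), one_div,
    inv_mul_cancel₀ hp0.ne', Real.rpow_one, ENNReal.ofReal_sum_of_nonneg fun k _ => by positivity]
  refine Finset.sum_congr rfl fun k _ => ?_
  rw [ENNReal.ofReal_rpow_of_nonneg (abs_nonneg _) hp0.le, Real.norm_eq_abs]

lemma PiLp.norm_le_norm_of_forall_abs_le (hp : p ≠ ∞) {x y : PiLp p fun _ : ι => ℝ}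
    (h : ∀ k, |x k| ≤ |y k|) : ‖x‖ ≤ ‖y‖ := by
  have hp0 : 0 < p.toReal := ENNReal.toReal_pos (zero_lt_one.trans_le hp1.out).ne' hp
  rw [PiLp.norm_eq_sum hp0, PiLp.norm_eq_sum hp0]
  simp only [Real.norm_eq_abs]
  exact Real.rpow_le_rpow (by positivity) (Finset.sum_le_sum fun k _ =>
    Real.rpow_le_rpow (abs_nonneg _) (h k) hp0.le) (by positivity)

namespace PathSeminorm

variable (ι) in
/-- The `ℓᵖ` norm of the values of a functional on the coordinates of a path. -/
noncomputable def lp (X : PathSeminorm ℝ) (hp : p ≠ ∞) : PathSeminorm (PiLp p fun _ : ι => ℝ) where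
  toFun n x := ‖WithLp.toLp p fun k => X n fun j => x j k‖
  zero_left x := by
    simp only [X.zero_left]
    exact norm_zero
  add_le n x y := by
    refine le_trans (PiLp.norm_le_norm_of_forall_abs_le hp fun k => ?_)
      (norm_add_le (WithLp.toLp p fun k => X n fun j => x j k) _)
    exact abs_le_abs_of_nonneg (X.nonneg _ _) (X.add_le n (fun j => x j k) fun j => y j k)
  mono x m n hmn := PiLp.norm_le_norm_of_forall_abs_le hp fun k =>
    abs_le_abs_of_nonneg (X.nonneg _ _) (X.mono _ hmn)
  succ_le n x := by
    have h1 : ‖WithLp.toLp p fun k => |x n k|‖ ≤ ‖x n‖ :=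
      PiLp.norm_le_norm_of_forall_abs_le hp fun k => (abs_abs _).le
    refine le_trans (PiLp.norm_le_norm_of_forall_abs_le hp fun k => ?_)
      ((norm_add_le (WithLp.toLp p fun k => X n fun j => x j k) _).trans (add_le_add le_rfl h1))
    exact abs_le_abs_of_nonneg (X.nonneg _ _) (X.succ_le n fun j => x j k)
  congr n x y h := by
    congr! 3 with k
    exact X.congr n _ _ fun j hj => by rw [h j hj]
  measurable n := measurable_norm.comp ((WithLp.measurable_toLp p _).comp
    (measurable_pi_lambda _ fun k => (X.measurable n).comp (measurable_pi_lambda _ fun j =>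
      (measurable_pi_apply k).comp ((WithLp.measurable_ofLp p _).comp (measurable_pi_apply j)))))

lemma IsSquareFunctionLike.lp {X : PathSeminorm ℝ} (hX : X.IsSquareFunctionLike) (hp : p ≠ ∞) :
    (X.lp ι hp).IsSquareFunctionLike where
  norm_le n x := PiLp.norm_le_norm_of_forall_abs_le hp fun k =>
    (hX.norm_le n fun j => x j k).trans (le_abs_self _)
  indicator_le n x S := by
    refine PiLp.norm_le_norm_of_forall_abs_le hp fun k =>
      abs_le_abs_of_nonneg (X.nonneg _ _) ?_
    have : (fun j => S.indicator x j k) = S.indicator fun j => x j k := by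
      funext j
      by_cases h : j ∈ S <;> simp [h]
    change X n (fun j => S.indicator x j k) ≤ X n fun j => x j k
    rw [this]
    exact hX.indicator_le n _ S

lemma ofReal_lp_rpow (X : PathSeminorm ℝ) (hp : p ≠ ∞) (n : ℕ)
    (x : ℕ → PiLp p fun _ : ι => ℝ) :
    ENNReal.ofReal (X.lp ι hp n x) ^ p.toReal =
      ∑ k, ENNReal.ofReal (X n fun j => x j k) ^ p.toReal := by
  refine (PiLp.ofReal_norm_rpow hp _).trans (Finset.sum_congr rfl fun k _ => ?_)
  rw [abs_of_nonneg (X.nonneg _ _)]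

end PathSeminorm

lemma IsMartingaleDiff.piLp_apply {Ω : Type} {mΩ : MeasurableSpace Ω} {ℱ : Filtration ℕ mΩ}
    {μ : Measure Ω} {d : ℕ → Ω → PiLp p fun _ : ι => ℝ} (hd : IsMartingaleDiff ℱ μ d) (k : ι) :
    IsMartingaleDiff ℱ μ fun j ω => d j ω k where
  measurable j := (measurable_pi_apply k).comp
    ((WithLp.measurable_ofLp p _).comp (hd.measurable j))
  integrable j := integrable_piLp_iff.1 (hd.integrable j) k
  condExp_eq_zero j := by
    have h := (PiLp.proj (𝕜 := ℝ) p (fun _ : ι => ℝ) k).comp_condExp_comm (m := ℱ j)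
      (hd.integrable j)
    filter_upwards [h, hd.condExp_eq_zero j] with ω h1 h2
    refine h1.symm.trans ?_
    rw [Function.comp_apply, h2]
    simp

lemma IsMartingaleDiff.toLp {Ω : Type} {mΩ : MeasurableSpace Ω} {ℱ : Filtration ℕ mΩ}
    {μ : Measure Ω} {d : ι → ℕ → Ω → ℝ} (hd : ∀ k, IsMartingaleDiff ℱ μ (d k)) :
    IsMartingaleDiff ℱ μ fun j ω => WithLp.toLp p fun k => d k j ω where
  measurable j := by
    have h : Measurable[ℱ (j + 1)] fun ω k => d k j ω :=
      @measurable_pi_lambda _ _ _ (ℱ (j + 1)) _ _ fun k => (hd k).measurable j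
    exact (WithLp.measurable_toLp p _).comp h
  integrable j := integrable_piLp_iff.2 fun k => (hd k).integrable j
  condExp_eq_zero j := by
    have hint : Integrable (fun ω => WithLp.toLp p fun k => d k j ω) μ :=
      integrable_piLp_iff.2 fun k => (hd k).integrable j
    have h : ∀ᵐ ω ∂μ, ∀ k, (μ[fun ω => WithLp.toLp p fun k => d k j ω | ℱ j]) ω k = 0 := by
      refine ae_all_iff.2 fun k => ?_
      filter_upwards [(PiLp.proj (𝕜 := ℝ) p (fun _ : ι => ℝ) k).comp_condExp_comm (m := ℱ j) hint,
        (hd k).condExp_eq_zero j] with ω h1 h2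
      exact h1.trans h2
    filter_upwards [h] with ω hω
    ext k
    exact hω k

lemma StrongBound.weakBound_lp {X Y : PathSeminorm ℝ} (hp : p ≠ ∞) {C : ℝ≥0∞}
    (h : StrongBound X Y p.toReal C) : WeakBound (X.lp ι hp) (Y.lp ι hp) p.toReal C := by
  intro Ω mΩ μ hμ ℱ d hd n l hl
  have hdm : ∀ k j, Measurable fun ω => d j ω k := fun k j =>
    ((hd.piLp_apply k).measurable j).mono (ℱ.le _) le_rfl
  have hlint : ∀ Z : PathSeminorm ℝ,
      ∫⁻ ω, ENNReal.ofReal (Z.lp ι hp n fun j => d j ω) ^ p.toReal ∂μ =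
        ∑ k, ∫⁻ ω, ENNReal.ofReal (Z n fun j => d j ω k) ^ p.toReal ∂μ := fun Z => by
    rw [lintegral_congr fun ω => Z.ofReal_lp_rpow hp n fun j => d j ω]
    exact lintegral_finsetSum _ fun k _ =>
      (Z.measurable_comp n fun j _ => hdm k j).ennreal_ofReal.pow_const _
  have hm : Measurable fun ω => ENNReal.ofReal (X.lp ι hp n fun j => d j ω) ^ p.toReal :=
    ((X.lp ι hp).measurable_comp n fun j _ =>
      (hd.measurable j).mono (ℱ.le _) le_rfl).ennreal_ofReal.pow_const _
  calc ENNReal.ofReal l ^ p.toReal * μ {ω | l ≤ X.lp ι hp n fun j => d j ω}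
      ≤ ENNReal.ofReal l ^ p.toReal * μ {ω | ENNReal.ofReal l ^ p.toReal ≤
          ENNReal.ofReal (X.lp ι hp n fun j => d j ω) ^ p.toReal} := by
        refine mul_le_mul_right (measure_mono fun ω hω => ?_) _
        exact ENNReal.rpow_le_rpow (ENNReal.ofReal_le_ofReal hω) ENNReal.toReal_nonneg
    _ ≤ ∫⁻ ω, ENNReal.ofReal (X.lp ι hp n fun j => d j ω) ^ p.toReal ∂μ :=
        mul_meas_ge_le_lintegral hm _
    _ ≤ ∑ k, C * ∫⁻ ω, ENNReal.ofReal (Y n fun j => d j ω k) ^ p.toReal ∂μ := by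
        rw [hlint]
        exact Finset.sum_le_sum fun k _ => h Ω mΩ μ hμ ℱ _ (hd.piLp_apply k) n
    _ = _ := by rw [hlint, Finset.mul_sum]

end Lp

theorem exists_strongBound_lp {p : ℝ≥0∞} [hp1 : Fact (1 ≤ p)] (hp : p ≠ ∞) {q : ℝ} (hq : 1 ≤ q) :
    ∃ C : ℝ≥0∞, C < ∞ ∧ ∀ (ι : Type) [Fintype ι],
      StrongBound (PathSeminorm.maximalFunction.lp ι hp) (PathSeminorm.squareFunction.lp ι hp)
        q C := by
  have hr : 1 ≤ p.toReal := by simpa using ENNReal.toReal_mono hp hp1.out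
  obtain ⟨C₁, hC₁, h₁⟩ := exists_strongBound_of_weakBound (r := 2) (by norm_num) hr one_lt_top
  obtain ⟨C₂, hC₂, h₂⟩ := exists_strongBound_of_weakBound hr hq hC₁
  refine ⟨C₂, hC₂, fun ι _ => h₂ _ _ _
    (PathSeminorm.isSquareFunctionLike_squareFunction.lp hp) (StrongBound.weakBound_lp hp ?_)⟩
  exact h₁ ℝ _ _ PathSeminorm.isSquareFunctionLike_squareFunction
    weakBound_maximalFunction_squareFunction

lemma ENNReal.rpow_tsum_iSup_le_iSup {a : ℕ → ℕ → ℝ≥0∞} (ha : ∀ k, Monotone (a k)) {r q : ℝ}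
    (hr : 0 < r) (hq : 0 < q) :
    (∑' k, (⨆ n, a k n) ^ r) ^ q ≤ ⨆ N, (∑ k ∈ Finset.range N, a k N ^ r) ^ q := by
  have hpow : ∀ {y : ℝ}, 0 < y → ∀ f : ℕ → ℝ≥0∞, (⨆ n, f n) ^ y = ⨆ n, f n ^ y :=
    fun hy f => (ENNReal.orderIsoRpow _ hy).map_iSup f
  have h : ∑' k, (⨆ n, a k n) ^ r ≤ ⨆ N, ∑ k ∈ Finset.range N, a k N ^ r := by
    rw [ENNReal.tsum_eq_iSup_nat]
    refine iSup_le fun M => ?_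
    simp only [hpow hr]
    rw [ENNReal.finsetSum_iSup_of_monotone fun k m n hmn => ENNReal.rpow_le_rpow (ha k hmn) hr.le]
    refine iSup_le fun n => le_iSup_of_le (max M n) ?_
    refine le_trans (Finset.sum_le_sum fun k _ =>
      ENNReal.rpow_le_rpow (ha k (le_max_right M n)) hr.le) ?_
    exact Finset.sum_le_sum_of_subset (Finset.range_mono (le_max_left M n))
  exact (ENNReal.rpow_le_rpow h hq.le).trans_eq (hpow hq _)

lemma MeasureTheory.Martingale.isMartingaleDiff {Ω : Type} {mΩ : MeasurableSpace Ω}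
    {ℱ : Filtration ℕ mΩ} {μ : Measure Ω} {g : ℕ → Ω → ℝ} [IsFiniteMeasure μ]
    (hg : Martingale g ℱ μ) : IsMartingaleDiff ℱ μ fun j ω => g (j + 1) ω - g j ω where
  measurable j := (hg.stronglyMeasurable (j + 1)).measurable.sub
    ((hg.stronglyMeasurable j).measurable.mono (ℱ.mono j.le_succ) le_rfl)
  integrable j := (hg.integrable (j + 1)).sub (hg.integrable j)
  condExp_eq_zero j := by
    filter_upwards [condExp_sub (hg.integrable (j + 1)) (hg.integrable j) (ℱ j),
      hg.condExp_ae_eq j.le_succ, hg.condExp_ae_eq (le_refl j)] with ω h1 h2 h3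
    refine h1.trans ?_
    rw [Pi.sub_apply, h2, h3, sub_self, Pi.zero_apply]

lemma IsMartingaleDiff.bounded_mul {Ω : Type} {mΩ : MeasurableSpace Ω} {ℱ : Filtration ℕ mΩ}
    {μ : Measure Ω} {a d : ℕ → Ω → ℝ} (hd : IsMartingaleDiff ℱ μ d)
    (ha : ∀ j, Measurable[ℱ j] (a j)) {T : ℝ} (haT : ∀ j ω, |a j ω| ≤ T) :
    IsMartingaleDiff ℱ μ fun j ω => a j ω * d j ω := by
  have hint : ∀ j, Integrable (a j * d j) μ := fun j =>
    (hd.integrable j).bdd_mul ((ha j).mono (ℱ.le j) le_rfl).aestronglyMeasurable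
      (ae_of_all _ (haT j))
  refine ⟨fun j => ((ha j).mono (ℱ.mono j.le_succ) le_rfl).mul (hd.measurable j), hint,
    fun j => ?_⟩
  filter_upwards [condExp_mul_of_stronglyMeasurable_left (ha j).stronglyMeasurable (hint j)
    (hd.integrable j), hd.condExp_eq_zero j] with ω h1 h2
  refine h1.trans ?_
  rw [Pi.mul_apply, h2, Pi.zero_apply, mul_zero]

section Window

variable {Ω : Type}

/-- The integrand `F_{σ, j}` on the window `σ ≤ j < τ`, truncated at height `T`. -/
noncomputable def windowIntegrand (F : ℕ → ℕ → Ω → ℝ) (σ τ : Ω → ℕ∞) (T : ℝ) (j : ℕ) (ω : Ω) : ℝ :=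
  ∑ s ∈ Finset.range (j + 1), if σ ω = s ∧ (j : ℕ∞) < τ ω then max (-T) (min T (F s j ω)) else 0

variable {F : ℕ → ℕ → Ω → ℝ} {σ τ : Ω → ℕ∞} {T : ℝ}

lemma windowIntegrand_eq {s j : ℕ} {ω : Ω} (hs : σ ω = s) (hsj : s ≤ j) (hj : (j : ℕ∞) < τ ω) :
    windowIntegrand F σ τ T j ω = max (-T) (min T (F s j ω)) := by
  rw [windowIntegrand, Finset.sum_eq_single s, if_pos ⟨hs, hj⟩]
  · intro i _ hi
    refine if_neg fun h => hi ?_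
    exact_mod_cast h.1.symm.trans hs
  · intro h
    exact absurd (Finset.mem_range.2 (Nat.lt_succ_of_le hsj)) h

lemma windowIntegrand_eq_zero {j : ℕ} {ω : Ω} (h : ¬(σ ω ≤ j ∧ (j : ℕ∞) < τ ω)) :
    windowIntegrand F σ τ T j ω = 0 := by
  refine Finset.sum_eq_zero fun s hs => if_neg fun h' => h ⟨?_, h'.2⟩
  rw [h'.1]
  exact_mod_cast Nat.lt_succ_iff.1 (Finset.mem_range.1 hs)

lemma abs_windowIntegrand_le (hT : 0 ≤ T) (j : ℕ) (ω : Ω) :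
    |windowIntegrand F σ τ T j ω| ≤ T := by
  by_cases h : σ ω ≤ j ∧ (j : ℕ∞) < τ ω
  · obtain ⟨s, hs⟩ := ENat.ne_top_iff_exists.1 (ne_top_of_le_ne_top (ENat.natCast_ne_top j) h.1)
    have hsj : s ≤ j := by
      have := h.1
      rw [← hs] at this
      exact_mod_cast this
    rw [windowIntegrand_eq hs.symm hsj h.2]
    exact abs_le.2 ⟨le_max_left _ _, max_le (by linarith) (min_le_left _ _)⟩
  · rw [windowIntegrand_eq_zero h, abs_zero]
    exact hT

lemma measurable_windowIntegrand {mΩ : MeasurableSpace Ω} {ℱ : Filtration ℕ mΩ}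
    (hF : ∀ s t, s ≤ t → StronglyMeasurable[ℱ t] (F s t)) (hσ : IsStoppingTime ℱ σ)
    (hτ : IsStoppingTime ℱ τ) (j : ℕ) : Measurable[ℱ j] (windowIntegrand F σ τ T j) := by
  refine Finset.measurable_fun_sum _ fun s hs => ?_
  have hsj : s ≤ j := Nat.lt_succ_iff.1 (Finset.mem_range.1 hs)
  refine Measurable.ite ((ℱ.mono hsj _ (hσ.measurableSet_eq s)).inter (hτ.measurableSet_gt j))
    ?_ measurable_const
  exact measurable_const.max (measurable_const.min (hF s j hsj).measurable)

lemma pp_eq_sum_windowIntegrand {g : ℕ → Ω → ℝ} {s t : ℕ} {ω : Ω} (hs : σ ω = s) (hst : s ≤ t)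
    (ht : (t : ℕ∞) ≤ τ ω) (hFT : ∀ j, s ≤ j → j < t → |F s j ω| ≤ T) :
    pp F g s t ω =
      ∑ j ∈ Finset.range t, windowIntegrand F σ τ T j ω * (g (j + 1) ω - g j ω) := by
  rw [Finset.range_eq_Ico, ← Finset.sum_Ico_consecutive _ (Nat.zero_le s) hst,
    Finset.sum_eq_zero, zero_add, pp]
  · have h : Finset.Ioc s t = (Finset.Ico s t).image (· + 1) := by
      ext j
      simp only [Finset.mem_Ioc, Finset.mem_image, Finset.mem_Ico]
      exact ⟨fun h => ⟨j - 1, by omega⟩, fun ⟨i, h⟩ => by omega⟩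
    rw [h, Finset.sum_image fun _ _ _ _ h => Nat.succ_injective h]
    refine Finset.sum_congr rfl fun j hj => ?_
    obtain ⟨hj1, hj2⟩ := Finset.mem_Ico.1 hj
    have hFj := abs_le.1 (hFT j hj1 hj2)
    rw [windowIntegrand_eq hs hj1 ((Nat.cast_lt.2 hj2).trans_le ht), min_eq_right hFj.2,
      max_eq_right hFj.1, Nat.succ_sub_one]
  · intro j hj
    rw [windowIntegrand_eq_zero, zero_mul]
    rw [hs, Nat.cast_le]
    exact fun h => absurd h.1 (not_le.2 (Finset.mem_Ico.1 hj).2)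

lemma ofReal_squareFunction_windowIntegrand_le {g : ℕ → Ω → ℝ} (hT : 0 ≤ T) (n : ℕ) (ω : Ω) :
    ENNReal.ofReal (PathSeminorm.squareFunction n fun j =>
        windowIntegrand F σ τ T j ω * (g (j + 1) ω - g j ω)) ≤
      ENNReal.ofReal T * (∑' j : {j : ℕ // σ ω < (j : ℕ∞) ∧ (j : ℕ∞) ≤ τ ω},
        ENNReal.ofReal ((g (j : ℕ) ω - g ((j : ℕ) - 1) ω) ^ 2)) ^ ((2 : ℝ)⁻¹) := by
  set f : ℕ → ℝ≥0∞ := fun j => ENNReal.ofReal ((g j ω - g (j - 1) ω) ^ 2) with hf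
  set S : Set ℕ := {j | σ ω < (j : ℕ∞) ∧ (j : ℕ∞) ≤ τ ω} with hS
  have hterm : ∀ j, ENNReal.ofReal ((windowIntegrand F σ τ T j ω * (g (j + 1) ω - g j ω)) ^ 2) ≤
      ENNReal.ofReal T ^ (2 : ℝ) * S.indicator f (j + 1) := by
    intro j
    by_cases h : σ ω ≤ j ∧ (j : ℕ∞) < τ ω
    · have hj : j + 1 ∈ S := by
        refine ⟨?_, ?_⟩
        · rw [Nat.cast_add, Nat.cast_one]
          exact (ENat.lt_add_one_iff (ENat.natCast_ne_top j)).2 h.1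
        · rw [Nat.cast_add, Nat.cast_one]
          exact Order.add_one_le_of_lt h.2
      rw [Set.indicator_of_mem hj, mul_pow, ENNReal.ofReal_mul (sq_nonneg _), ENNReal.rpow_two,
        ← ENNReal.ofReal_pow hT]
      refine mul_le_mul' (ENNReal.ofReal_le_ofReal (sq_le_sq.2 ?_)) le_rfl
      exact (abs_windowIntegrand_le hT j ω).trans (le_abs_self T)
    · simp [windowIntegrand_eq_zero h]
  have hsum : ∑ j ∈ Finset.range n,
      ENNReal.ofReal ((windowIntegrand F σ τ T j ω * (g (j + 1) ω - g j ω)) ^ 2) ≤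
        ENNReal.ofReal T ^ (2 : ℝ) * ∑' j : S, f j := by
    refine (Finset.sum_le_sum fun j _ => hterm j).trans ?_
    rw [← Finset.mul_sum, tsum_subtype]
    refine mul_le_mul_right ((ENNReal.sum_le_tsum _).trans ?_) _
    exact ENNReal.tsum_comp_le_tsum_of_injective Nat.succ_injective _
  have hsq : ENNReal.ofReal (PathSeminorm.squareFunction n fun j =>
      windowIntegrand F σ τ T j ω * (g (j + 1) ω - g j ω)) =
        (∑ j ∈ Finset.range n, ENNReal.ofReal
          ((windowIntegrand F σ τ T j ω * (g (j + 1) ω - g j ω)) ^ 2)) ^ ((2 : ℝ)⁻¹) := by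
    rw [← ENNReal.ofReal_sum_of_nonneg fun j _ => sq_nonneg _,
      ENNReal.ofReal_rpow_of_nonneg (by positivity) (by norm_num), ← one_div, ← Real.sqrt_eq_rpow]
    rfl
  rw [hsq]
  refine (ENNReal.rpow_le_rpow hsum (by norm_num)).trans_eq ?_
  rw [ENNReal.mul_rpow_of_nonneg _ _ (by norm_num), ← ENNReal.rpow_mul]
  norm_num
  rfl

end Window

lemma measurable_maxAbsSum_windowIntegrand {Ω : Type} {mΩ : MeasurableSpace Ω} {μ : Measure Ω}
    {ℱ : Filtration ℕ mΩ} {g : ℕ → Ω → ℝ} {F : ℕ → ℕ → Ω → ℝ} {σ τ : Ω → ℕ∞}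
    (hg : Martingale g ℱ μ) (hF : ∀ s t, s ≤ t → StronglyMeasurable[ℱ t] (F s t))
    (hσ : IsStoppingTime ℱ σ) (hτ : IsStoppingTime ℱ τ) {T : ℝ} (n : ℕ) :
    Measurable fun ω => maxAbsSum n fun j =>
      windowIntegrand F σ τ T j ω * (g (j + 1) ω - g j ω) := by
  have hgm : ∀ j, Measurable (g j) := fun j =>
    (hg.stronglyMeasurable j).measurable.mono (ℱ.le j) le_rfl
  exact PathSeminorm.maximalFunction.measurable_comp n fun j _ =>
    ((measurable_windowIntegrand hF hσ hτ j).mono (ℱ.le j) le_rfl).mul ((hgm (j + 1)).sub (hgm j))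

lemma lintegral_iSup_maxAbsSum_windowIntegrand_le {r q : ℝ} (hr : 1 ≤ r) (hq : 1 ≤ q)
    {p : ℝ≥0∞} [Fact (1 ≤ p)] (hp : p ≠ ∞) (hpr : p.toReal = r) {C : ℝ≥0∞}
    (hC : ∀ (ι : Type) [Fintype ι], StrongBound (PathSeminorm.maximalFunction.lp ι hp)
      (PathSeminorm.squareFunction.lp ι hp) q C)
    {Ω : Type} {mΩ : MeasurableSpace Ω} {μ : Measure Ω} [hμ : IsProbabilityMeasure μ]
    {ℱ : Filtration ℕ mΩ} {g : ℕ → ℕ → Ω → ℝ} {F : ℕ → ℕ → ℕ → Ω → ℝ} {σ τ : ℕ → Ω → ℕ∞}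
    (hg : ∀ k, Martingale (g k) ℱ μ)
    (hF : ∀ k s t, s ≤ t → StronglyMeasurable[ℱ t] (F k s t)) (hσ : ∀ k, IsStoppingTime ℱ (σ k))
    (hτ : ∀ k, IsStoppingTime ℱ (τ k)) {T : ℝ} (hT : 0 ≤ T) :
    ∫⁻ ω, (∑' k, (⨆ n, ENNReal.ofReal (maxAbsSum n fun j =>
        windowIntegrand (F k) (σ k) (τ k) T j ω * (g k (j + 1) ω - g k j ω))) ^ r) ^ (1 / r * q) ∂μ ≤
      C * (ENNReal.ofReal T ^ q *
        ∫⁻ ω, ((∑' k, ((∑' j : {j : ℕ // σ k ω < (j : ℕ∞) ∧ (j : ℕ∞) ≤ τ k ω},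
          ENNReal.ofReal ((g k (j : ℕ) ω - g k ((j : ℕ) - 1) ω) ^ 2)) ^ ((2 : ℝ)⁻¹)) ^ r) ^
            (1 / r)) ^ q ∂μ) := by
  have hr0 : 0 < r := by linarith
  have hq0 : 0 < q := by linarith
  set d : ℕ → ℕ → Ω → ℝ := fun k j ω =>
    windowIntegrand (F k) (σ k) (τ k) T j ω * (g k (j + 1) ω - g k j ω) with hd
  have hdm : ∀ k, IsMartingaleDiff ℱ μ (d k) := fun k =>
    (hg k).isMartingaleDiff.bounded_mul (measurable_windowIntegrand (hF k) (hσ k) (hτ k))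
      (abs_windowIntegrand_le hT)
  have hdN : ∀ N : ℕ, IsMartingaleDiff ℱ μ fun j ω => WithLp.toLp p fun k : Fin N => d k j ω :=
    fun N => IsMartingaleDiff.toLp fun k => hdm k
  have hmeas : ∀ k n, Measurable fun ω => maxAbsSum n fun j => d k j ω := fun k n =>
    measurable_maxAbsSum_windowIntegrand (hg k) (hF k) (hσ k) (hτ k) n
  have hlp : ∀ (Z : PathSeminorm ℝ) (N : ℕ) (ω : Ω),
      ENNReal.ofReal (Z.lp (Fin N) hp N fun j => WithLp.toLp p fun k : Fin N => d k j ω) ^ q =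
        (∑ k ∈ Finset.range N, ENNReal.ofReal (Z N fun j => d k j ω) ^ r) ^ (1 / r * q) := by
    intro Z N ω
    have h := Z.ofReal_lp_rpow hp N fun j => WithLp.toLp p fun k : Fin N => d k j ω
    rw [hpr] at h
    rw [Finset.sum_range fun k => ENNReal.ofReal (Z N fun j => d k j ω) ^ r, ← h,
      ← ENNReal.rpow_mul, ← mul_assoc, mul_one_div_cancel hr0.ne', one_mul]
  have hmono : ∀ k ω, Monotone fun n => ENNReal.ofReal (maxAbsSum n fun j => d k j ω) :=
    fun k ω m n hmn => ENNReal.ofReal_le_ofReal (maxAbsSum_mono _ hmn)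
  refine (lintegral_mono fun ω => ENNReal.rpow_tsum_iSup_le_iSup
    (a := fun k n => ENNReal.ofReal (maxAbsSum n fun j => d k j ω)) (fun k => hmono k ω) hr0
      (show 0 < 1 / r * q by positivity)).trans ?_
  have hmeas' : ∀ N, Measurable fun ω => (∑ k ∈ Finset.range N,
      ENNReal.ofReal (maxAbsSum N fun j => d k j ω) ^ r) ^ (1 / r * q) := fun N =>
    (Finset.measurable_fun_sum _ fun k _ => (hmeas k N).ennreal_ofReal.pow_const _).pow_const _
  have hmono' : Monotone fun N ω => (∑ k ∈ Finset.range N,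
      ENNReal.ofReal (maxAbsSum N fun j => d k j ω) ^ r) ^ (1 / r * q) := fun m n hmn ω => by
    refine ENNReal.rpow_le_rpow ?_ (by positivity)
    refine (Finset.sum_le_sum fun k _ => ENNReal.rpow_le_rpow (hmono k ω hmn) hr0.le).trans ?_
    exact Finset.sum_le_sum_of_subset (Finset.range_mono hmn)
  rw [lintegral_iSup hmeas' hmono']
  refine iSup_le fun N => ?_
  have h := hC (Fin N) Ω mΩ μ hμ ℱ _ (hdN N) N
  rw [lintegral_congr fun ω => hlp _ N ω] at h
  refine h.trans (mul_le_mul_right ?_ _)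
  rw [← lintegral_const_mul' _ _ (ENNReal.rpow_ne_top_of_nonneg hq0.le ENNReal.ofReal_ne_top)]
  refine lintegral_mono fun ω => ?_
  dsimp only
  rw [hlp, ENNReal.rpow_mul, ← ENNReal.mul_rpow_of_nonneg _ _ hq0.le]
  refine ENNReal.rpow_le_rpow ?_ hq0.le
  have hTr : ENNReal.ofReal T = (ENNReal.ofReal T ^ r) ^ (1 / r) := by
    rw [← ENNReal.rpow_mul, mul_one_div_cancel hr0.ne', ENNReal.rpow_one]
  rw [hTr, ← ENNReal.mul_rpow_of_nonneg _ _ (by positivity), ← ENNReal.tsum_mul_left]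
  refine ENNReal.rpow_le_rpow (le_trans (Finset.sum_le_sum fun k _ => ?_)
    (ENNReal.sum_le_tsum (Finset.range N))) (by positivity)
  rw [← ENNReal.mul_rpow_of_nonneg _ _ hr0.le]
  exact ENNReal.rpow_le_rpow (ofReal_squareFunction_windowIntegrand_le hT N ω) hr0.le

lemma ofReal_abs_pp_le_iSup_maxAbsSum {Ω : Type} {F : ℕ → ℕ → Ω → ℝ} {g : ℕ → Ω → ℝ}
    {σ τ : Ω → ℕ∞} {T : ℝ} {ω : Ω} {s t : ℕ} (hs : s = σ ω) (hst : s ≤ t) (ht : (t : ℕ∞) ≤ τ ω)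
    (hFT : ∀ j, s ≤ j → j < t → |F s j ω| ≤ T) :
    ENNReal.ofReal |pp F g s t ω| ≤ ⨆ n, ENNReal.ofReal (maxAbsSum n fun j =>
      windowIntegrand F σ τ T j ω * (g (j + 1) ω - g j ω)) := by
  refine le_iSup_of_le t (ENNReal.ofReal_le_ofReal ?_)
  rw [pp_eq_sum_windowIntegrand hs.symm hst ht hFT]
  exact abs_sum_le_maxAbsSum le_rfl _

/-- maximal paraproduct estimate in the bounded-integrand case
(`(q₁, r₁) = (∞, ∞)`): for stopping times `τ'_k ≤ τ_k`,
`‖(Σ_k sup_{τ'_k ≤ t ≤ τ_k} |Π(F^{(k)},g^{(k)})_{τ'_k,t}|^{r₀})^{1/r₀}‖_{L^{q₀}}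
  ≤ C ‖sup_k sup_{τ'_k ≤ t < τ_k} |F^{(k)}_{τ'_k,t}|‖_{L^∞} ‖(Σ_k (Sg^{(k)}_{τ'_k,τ_k})^{r₀})^{1/r₀}‖_{L^{q₀}}`. -/
theorem maximal_paraproduct_bounded_integrand (q₀ r₀ : ℝ) (hq₀ : 1 ≤ q₀) (hr₀ : 1 ≤ r₀) :
    ∃ C : ℝ≥0∞, C < ∞ ∧
      ∀ (Ω : Type) (mΩ : MeasurableSpace Ω) (μ : Measure Ω), IsProbabilityMeasure μ →
      ∀ (ℱ : Filtration ℕ mΩ) (g : ℕ → ℕ → Ω → ℝ) (F : ℕ → ℕ → ℕ → Ω → ℝ)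
        (τ' τ : ℕ → Ω → ℕ∞),
        (∀ k, Martingale (g k) ℱ μ) →
        (∀ k s t, s ≤ t → StronglyMeasurable[ℱ t] (F k s t)) →
        (∀ k (n : ℕ), MeasurableSet[ℱ n] {ω | τ' k ω ≤ (n : ℕ∞)}) →
        (∀ k (n : ℕ), MeasurableSet[ℱ n] {ω | τ k ω ≤ (n : ℕ∞)}) →
        (∀ k ω, τ' k ω ≤ τ k ω) →
        (∫⁻ ω, ((∑' k : ℕ,
              (⨆ (s : ℕ) (t : ℕ) (_ : (s : ℕ∞) = τ' k ω) (_ : s ≤ t) (_ : (t : ℕ∞) ≤ τ k ω),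
                ENNReal.ofReal |pp (F k) (g k) s t ω|) ^ r₀) ^ (1 / r₀)) ^ q₀ ∂μ) ^ (1 / q₀)
          ≤ C * essSup (fun ω =>
                ⨆ (k : ℕ) (s : ℕ) (t : ℕ) (_ : (s : ℕ∞) = τ' k ω) (_ : s ≤ t)
                    (_ : (t : ℕ∞) < τ k ω),
                  ENNReal.ofReal |F k s t ω|) μ
              * (∫⁻ ω, ((∑' k : ℕ,
                    ((∑' j : {j : ℕ // τ' k ω < (j : ℕ∞) ∧ (j : ℕ∞) ≤ τ k ω},
                        ENNReal.ofReal ((g k (j : ℕ) ω - g k ((j : ℕ) - 1) ω) ^ 2))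
                      ^ ((2 : ℝ)⁻¹)) ^ r₀) ^ (1 / r₀)) ^ q₀ ∂μ) ^ (1 / q₀) := by
  have : Fact (1 ≤ ENNReal.ofReal r₀) := ⟨ENNReal.one_le_ofReal.2 hr₀⟩
  have hr0 : 0 < r₀ := by linarith
  have hq0 : 0 < q₀ := by linarith
  obtain ⟨C, hC, hbound⟩ := exists_strongBound_lp (p := ENNReal.ofReal r₀) ENNReal.ofReal_ne_top hq₀
  have hCq : C ^ (1 / q₀) ≠ ∞ := ENNReal.rpow_ne_top_of_nonneg (by positivity) hC.ne
  refine ⟨C ^ (1 / q₀) + 1, lt_top_iff_ne_top.2 (ENNReal.add_ne_top.2 ⟨hCq, by simp⟩), ?_⟩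
  intro Ω mΩ μ hμ ℱ g F τ' τ hg hF hτ' hτ _
  have hmain := fun (T : ℝ) (hT : 0 ≤ T) => lintegral_iSup_maxAbsSum_windowIntegrand_le hr₀ hq₀ _
    (ENNReal.toReal_ofReal hr0.le) hbound hg hF hτ' hτ hT
  set I := ∫⁻ ω, ((∑' k : ℕ, ((∑' j : {j : ℕ // τ' k ω < (j : ℕ∞) ∧ (j : ℕ∞) ≤ τ k ω},
    ENNReal.ofReal ((g k (j : ℕ) ω - g k ((j : ℕ) - 1) ω) ^ 2)) ^ ((2 : ℝ)⁻¹)) ^ r₀) ^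
      (1 / r₀)) ^ q₀ ∂μ with hI
  set Fmax : Ω → ℝ≥0∞ := fun ω => ⨆ (k : ℕ) (s : ℕ) (t : ℕ) (_ : (s : ℕ∞) = τ' k ω) (_ : s ≤ t)
    (_ : (t : ℕ∞) < τ k ω), ENNReal.ofReal |F k s t ω| with hFmax
  have hle_Fmax : ∀ ω (k s t : ℕ), s = τ' k ω → s ≤ t → (t : ℕ∞) < τ k ω →
      ENNReal.ofReal |F k s t ω| ≤ Fmax ω := fun ω k s t hs hst ht =>
    le_iSup_of_le k (le_iSup_of_le s (le_iSup_of_le t (le_iSup_of_le hs (le_iSup_of_le hst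
      (le_iSup_of_le ht le_rfl)))))
  by_cases hM : essSup Fmax μ = ∞
  · by_cases hI0 : I = 0
    · have hzero : ∀ᵐ ω ∂μ, ∀ T k n : ℕ, ENNReal.ofReal (maxAbsSum n fun j =>
          windowIntegrand (F k) (τ' k) (τ k) T j ω * (g k (j + 1) ω - g k j ω)) = 0 := by
        refine ae_all_iff.2 fun T => ?_
        have hT := hmain T T.cast_nonneg
        rw [hI0, mul_zero, mul_zero, nonpos_iff_eq_zero, lintegral_eq_zero_iff
          ((Measurable.tsum fun k => (Measurable.iSup fun n =>
            (measurable_maxAbsSum_windowIntegrand (hg k) (hF k) (hτ' k) (hτ k)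
              n).ennreal_ofReal).pow_const _).pow_const _)] at hT
        filter_upwards [hT] with ω hω k n
        have h := (ENNReal.rpow_eq_zero_iff_of_pos (by positivity)).1 hω
        have h' := (ENNReal.rpow_eq_zero_iff_of_pos hr0).1 (ENNReal.tsum_eq_zero.1 h k)
        exact iSup_eq_zero.1 h' n
      refine le_of_eq_of_le ?_ zero_le
      rw [ENNReal.rpow_eq_zero_iff_of_pos (by positivity)]
      refine (lintegral_congr_ae (g := fun _ => 0) ?_).trans lintegral_zero
      filter_upwards [hzero] with ω hω
      rw [ENNReal.rpow_eq_zero_iff_of_pos hq0, ENNReal.rpow_eq_zero_iff_of_pos (by positivity),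
        ENNReal.tsum_eq_zero]
      intro k
      rw [ENNReal.rpow_eq_zero_iff_of_pos hr0, ← nonpos_iff_eq_zero]
      refine iSup_le fun s => iSup_le fun t => iSup_le fun hs => iSup_le fun hst =>
        iSup_le fun ht => ?_
      obtain ⟨T, hT⟩ := exists_nat_ge (∑ j ∈ Finset.range t, |F k s j ω|)
      refine (ofReal_abs_pp_le_iSup_maxAbsSum hs hst ht fun j _ hj =>
        (Finset.single_le_sum (f := fun j => |F k s j ω|) (fun j _ => abs_nonneg _)
          (Finset.mem_range.2 hj)).trans hT).trans ?_
      exact iSup_le fun n => (hω T k n).le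
    · rw [hM, ENNReal.mul_top (by simp), ENNReal.top_mul]
      · exact le_top
      · simp [hI0, hq0.le]
  · set T : ℝ := (essSup Fmax μ).toReal with hT
    have hTM : ENNReal.ofReal T = essSup Fmax μ := ENNReal.ofReal_toReal hM
    have hle : ∀ᵐ ω ∂μ, ∀ k s t : ℕ, s = τ' k ω → s ≤ t → (t : ℕ∞) < τ k ω → |F k s t ω| ≤ T := by
      filter_upwards [ENNReal.ae_le_essSup Fmax] with ω hω k s t hs hst ht
      rw [← ENNReal.ofReal_le_ofReal_iff ENNReal.toReal_nonneg, hTM]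
      exact (hle_Fmax ω k s t hs hst ht).trans hω
    refine (ENNReal.rpow_le_rpow (le_trans (lintegral_mono_ae ?_) (hmain T ENNReal.toReal_nonneg))
      (by positivity)).trans ?_
    · filter_upwards [hle] with ω hω
      rw [← ENNReal.rpow_mul]
      refine ENNReal.rpow_le_rpow (ENNReal.tsum_le_tsum fun k => ?_) (by positivity)
      refine ENNReal.rpow_le_rpow (iSup_le fun s => iSup_le fun t => iSup_le fun hs =>
        iSup_le fun hst => iSup_le fun ht => ?_) hr0.le
      exact ofReal_abs_pp_le_iSup_maxAbsSum hs hst ht fun j hsj hj =>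
        hω k s j hs hsj ((Nat.cast_lt.2 hj).trans_le ht)
    · rw [hTM, ENNReal.mul_rpow_of_nonneg _ _ (by positivity),
        ENNReal.mul_rpow_of_nonneg _ _ (by positivity), ← ENNReal.rpow_mul,
        mul_one_div_cancel hq0.ne', ENNReal.rpow_one, ← mul_assoc]
      gcongr
      exact le_self_add
end

section
/- Product of differences against a martingale: let 1 ≤ q_0 < ∞, 0 < q_j ≤ ∞, 1 ≤ r_j ≤ ∞ with 1/q = 1/q_0 + Σ_j 1/q_j and 1/r = 1/2 + Σ_j 1/r_j, r ≥ 1. For one-parameter adapted processes f^{(j)}, a martingale g, and an adapted partition (τ_k), ‖ (Σ_k sup_{τ_{k-1} ≤ s < t ≤ τ_k} |Π_{s,t}(Π_j δf^{(j)}, g)|^r)^{1/r} ‖_{L^q} ≤ C Π_j ‖ (Σ_k sup_{τ_{k-1} ≤ s < t ≤ τ_k} |δf^{(j)}_{s,t}|^{r_j})^{1/r_j} ‖_{L^{q_j}} · ‖Sg‖_{L^{q_0}}, where Π_j δf^{(j)} denotes the two-parameter process F_{s,t} := Π_j (f^{(j)}_t − f^{(j)}_s). -/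
open MeasureTheory ENNReal

/-- The `L^q` "norm" (for `q ∈ (0,∞]`) of an `ℝ≥0∞`-valued function. -/
noncomputable def lqNorm {Ω : Type*} [MeasurableSpace Ω] (μ : Measure Ω) (q : ℝ≥0∞)
    (f : Ω → ℝ≥0∞) : ℝ≥0∞ :=
  if q = ∞ then essSup f μ else (∫⁻ ω, f ω ^ q.toReal ∂μ) ^ (1 / q.toReal)

/-- The `ℓ^p` norm (for `p ∈ (0,∞]`) of a sequence in `ℝ≥0∞`. -/
noncomputable def lpSum (p : ℝ≥0∞) (a : ℕ → ℝ≥0∞) : ℝ≥0∞ :=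
  if p = ∞ then ⨆ k, a k else (∑' k, a k ^ p.toReal) ^ (1 / p.toReal)

theorem davis_step {x d s m φ φ' σ σ' m' : ℝ} (hs : 0 ≤ s) (hm : 0 ≤ m) (hxm : |x| ≤ m)
    (hm' : m' = max m |x + d|) (hφ : φ = √(s + m ^ 2)) (hφ' : φ' = √(s + d ^ 2 + m' ^ 2))
    (hσ : σ = √s) (hσ' : σ' = √(s + d ^ 2)) :
    ((x + d) ^ 2 + (s + d ^ 2) + φ' ^ 2) / (2 * φ') - (x ^ 2 + s + φ ^ 2) / (2 * φ)
      ≤ x / φ * d + 12 * (σ' - σ) := by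
  have hφ0 : 0 ≤ φ := hφ ▸ Real.sqrt_nonneg _
  have hφ'0 : 0 ≤ φ' := hφ' ▸ Real.sqrt_nonneg _
  have hσ0 : 0 ≤ σ := hσ ▸ Real.sqrt_nonneg _
  have hσ'0 : 0 ≤ σ' := hσ' ▸ Real.sqrt_nonneg _
  have hφ2 : φ ^ 2 = s + m ^ 2 := by rw [hφ, Real.sq_sqrt (by positivity)]
  have hφ'2 : φ' ^ 2 = s + d ^ 2 + m' ^ 2 := by rw [hφ', Real.sq_sqrt (by positivity)]
  have hσ2 : σ ^ 2 = s := by rw [hσ, Real.sq_sqrt hs]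
  have hσ'2 : σ' ^ 2 = s + d ^ 2 := by rw [hσ', Real.sq_sqrt (by positivity)]
  have hD := abs_nonneg d
  have hD2 : |d| ^ 2 = d ^ 2 := sq_abs d
  have hσσ : σ ≤ σ' := by nlinarith
  have hmφ : m ≤ φ := by nlinarith
  have hσφ : σ' ≤ φ + |d| := by nlinarith
  have key : d ^ 2 ≤ (σ' - σ) * (2 * (φ + |d|)) := by
    have : d ^ 2 = (σ' - σ) * (σ' + σ) := by nlinarith
    rw [this]
    apply mul_le_mul_of_nonneg_left _ (by linarith)
    linarith
  have hmm : m ≤ m' := hm' ▸ le_max_left _ _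
  have hφφ : φ ≤ φ' := by nlinarith
  rcases hφ0.eq_or_lt with h0 | h0
  · -- nothing has happened before this step
    have hm0 : m = 0 := by linarith
    have hx0 : x = 0 := by
      rw [hm0] at hxm
      exact abs_nonpos_iff.mp hxm
    have hs0 : s = 0 := by rw [← h0, hm0] at hφ2; nlinarith
    have hm'd : m' = |d| := by rw [hm', hm0, hx0]; simp
    have : σ = 0 := by rw [hσ, hs0]; simp
    have hσd : σ' = |d| := by rw [hσ', hs0, zero_add, Real.sqrt_sq_eq_abs]
    rw [← h0, hx0, hs0, this, hσd]
    rw [hm'd, hs0] at hφ'2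
    have hd : |d| ≤ φ' := by nlinarith
    have h1 : (d ^ 2 + d ^ 2 + φ' ^ 2) / (2 * φ') ≤ 12 * |d| := by
      refine div_le_of_le_mul₀ (by positivity) (by positivity) ?_
      nlinarith
    simpa using h1
  have hpos' : 0 < φ' := by linarith
  have hφφ0 : 0 ≤ φ' - φ := sub_nonneg.2 hφφ
  have hσσ0 : 0 ≤ σ' - σ := sub_nonneg.2 hσσ
  have expand : ((x + d) ^ 2 + (s + d ^ 2) + φ' ^ 2) / (2 * φ') - (x ^ 2 + s + φ ^ 2) / (2 * φ)
      - x / φ * d = (φ' - φ) / 2 * (1 - ((x + d) ^ 2 + (s + d ^ 2)) / (φ * φ')) + d ^ 2 / φ := by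
    field_simp
    ring
  suffices h : (φ' - φ) / 2 * (1 - ((x + d) ^ 2 + (s + d ^ 2)) / (φ * φ')) + d ^ 2 / φ
      ≤ 12 * (σ' - σ) by linarith
  have small (h : |d| ≤ 2 * φ) : d ^ 2 / φ ≤ 6 * (σ' - σ) := by
    rw [div_le_iff₀ h0]
    have := mul_le_mul_of_nonneg_left (show 2 * (φ + |d|) ≤ 6 * φ by linarith) hσσ0
    linarith
  have triangle : |d| ≤ |x + d| + |x| := by simpa using abs_sub (x + d) x
  rcases le_or_gt |x + d| m with hc | hc
  · have hm'm : m' = m := by rw [hm', max_eq_left hc]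
    have h1 : φ' - φ ≤ d ^ 2 / φ := by
      rw [le_div_iff₀ h0]
      rw [hm'm] at hφ'2
      linarith [mul_nonneg hφφ0 hφ'0, show (φ' - φ) * φ + (φ' - φ) * φ' = φ' ^ 2 - φ ^ 2 by ring]
    have h2 : 0 ≤ ((x + d) ^ 2 + (s + d ^ 2)) / (φ * φ') := by positivity
    have := small (by linarith)
    have h3 : 0 ≤ d ^ 2 / φ := by positivity
    linarith [mul_nonneg hφφ0 h2]
  · have hm'm : m' = |x + d| := by rw [hm', max_eq_right hc.le]
    have ha : (x + d) ^ 2 + (s + d ^ 2) = φ' ^ 2 := by rw [hφ'2, hm'm, sq_abs]; ring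
    have e : (φ' - φ) / 2 * (1 - φ' ^ 2 / (φ * φ')) + d ^ 2 / φ
        = (d ^ 2 - (φ' - φ) ^ 2 / 2) / φ := by
      field_simp
      ring
    rw [ha, e]
    rcases le_or_gt |d| (2 * φ) with hd | hd
    · have h1 : (d ^ 2 - (φ' - φ) ^ 2 / 2) / φ ≤ d ^ 2 / φ := by
        gcongr
        linarith [sq_nonneg (φ' - φ)]
      linarith [small hd]
    · have hd0 : 0 < |d| := by linarith
      have h1 : |d| ≤ 3 * (σ' - σ) := by
        have := mul_le_mul_of_nonneg_left (show 2 * (φ + |d|) ≤ 3 * |d| by linarith) hσσ0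
        refine le_of_mul_le_mul_right ?_ hd0
        linarith
      have h2 : |d| - φ ≤ |x + d| := by linarith
      have h3 : (|d| - φ) ^ 2 ≤ |x + d| ^ 2 := by
        apply pow_le_pow_left₀ _ h2
        linarith
      have h4 : |d| ≤ φ' := by
        refine (sq_le_sq₀ (by positivity) hφ'0).1 ?_
        rw [hφ'2, hm'm]
        linarith [sq_nonneg |x + d|]
      have h5 : φ' ≤ 2 * |d| := by
        refine (sq_le_sq₀ (by positivity) (by linarith)).1 ?_
        have h6 : |x + d| ≤ φ + |d| := (abs_add_le x d).trans (by linarith)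
        have h7 : |x + d| ^ 2 ≤ (φ + |d|) ^ 2 := pow_le_pow_left₀ (abs_nonneg _) h6 2
        rw [hφ'2, hm'm]
        have h8 := mul_le_mul_of_nonneg_right hd.le hD
        have h9 := mul_le_mul_of_nonneg_left hd.le h0.le
        linarith [sq_nonneg m]
      rw [div_le_iff₀ h0]
      have h6 : 2 * d ^ 2 ≤ (φ' + φ) ^ 2 := by
        have : φ' ^ 2 = s + d ^ 2 + |x + d| ^ 2 := by rw [hφ'2, hm'm]
        linarith only [mul_le_mul_of_nonneg_left h4 h0.le, this, h3, hD2, hs, sq_nonneg φ]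
      have h7 := mul_le_mul_of_nonneg_left h5 h0.le
      have h8 := mul_le_mul_of_nonneg_left h1 h0.le
      linarith only [h6, h7, h8]

/-- The running maximum of the absolute values of a sequence. -/
noncomputable def runMax (x : ℕ → ℝ) : ℕ → ℝ
  | 0 => |x 0|
  | n + 1 => max (runMax x n) |x (n + 1)|

/-- The sum of the first `n` squared increments of a sequence. -/
noncomputable def sqSum (x : ℕ → ℝ) (n : ℕ) : ℝ :=
  ∑ i ∈ Finset.range n, (x (i + 1) - x i) ^ 2

/-- The integrand in the pathwise Davis inequality. -/
noncomputable def davisWeight (x : ℕ → ℝ) (n : ℕ) : ℝ :=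
  x n / √(sqSum x n + runMax x n ^ 2)

theorem abs_le_runMax (x : ℕ → ℝ) (n : ℕ) : |x n| ≤ runMax x n := by
  cases n with
  | zero => exact le_rfl
  | succ n => exact le_max_right _ _

theorem runMax_nonneg (x : ℕ → ℝ) (n : ℕ) : 0 ≤ runMax x n :=
  (abs_nonneg _).trans (abs_le_runMax x n)

theorem runMax_mono (x : ℕ → ℝ) : Monotone (runMax x) :=
  monotone_nat_of_le_succ fun _ => le_max_left _ _

theorem sqSum_succ (x : ℕ → ℝ) (n : ℕ) : sqSum x (n + 1) = sqSum x n + (x (n + 1) - x n) ^ 2 :=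
  Finset.sum_range_succ _ _

theorem sqSum_nonneg (x : ℕ → ℝ) (n : ℕ) : 0 ≤ sqSum x n :=
  Finset.sum_nonneg fun _ _ => sq_nonneg _

theorem sqSum_mono (x : ℕ → ℝ) : Monotone (sqSum x) :=
  monotone_nat_of_le_succ fun n => by
    rw [sqSum_succ]
    linarith [sq_nonneg (x (n + 1) - x n)]

theorem abs_sub_le_sqrt_sqSum (x : ℕ → ℝ) {i n : ℕ} (h : i < n) :
    |x (i + 1) - x i| ≤ √(sqSum x n) := by
  rw [← Real.sqrt_sq_eq_abs]
  apply Real.sqrt_le_sqrt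
  exact Finset.single_le_sum (f := fun i => (x (i + 1) - x i) ^ 2) (fun _ _ => sq_nonneg _)
    (Finset.mem_range.2 h)

theorem abs_davisWeight_le (x : ℕ → ℝ) (n : ℕ) : |davisWeight x n| ≤ 1 := by
  rw [davisWeight, abs_div, abs_of_nonneg (Real.sqrt_nonneg _)]
  refine div_le_one_of_le₀ ((abs_le_runMax x n).trans ?_) (Real.sqrt_nonneg _)
  apply Real.le_sqrt_of_sq_le
  linarith [sqSum_nonneg x n]

theorem pathwise_davis (x : ℕ → ℝ) (h0 : x 0 = 0) (N : ℕ) :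
    runMax x N ≤ 24 * √(sqSum x N)
      + 2 * ∑ i ∈ Finset.range N, davisWeight x i * (x (i + 1) - x i) := by
  have main : (x N ^ 2 + sqSum x N + √(sqSum x N + runMax x N ^ 2) ^ 2) /
      (2 * √(sqSum x N + runMax x N ^ 2)) ≤
      ∑ i ∈ Finset.range N, davisWeight x i * (x (i + 1) - x i) + 12 * √(sqSum x N) := by
    induction N with
    | zero => simp [sqSum, runMax, h0]
    | succ n ih =>
      have step := davis_step (x := x n) (d := x (n + 1) - x n) (sqSum_nonneg x n)
        (runMax_nonneg x n) (abs_le_runMax x n) rfl rfl rfl rfl rfl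
      rw [add_sub_cancel, ← sqSum_succ] at step
      rw [Finset.sum_range_succ]
      change _ ≤ davisWeight x n * _ + _ at step
      simp only [runMax]
      linarith
  have hle : runMax x N ≤ √(sqSum x N + runMax x N ^ 2) := by
    apply Real.le_sqrt_of_sq_le
    linarith [sqSum_nonneg x N]
  have hs := sqSum_nonneg x N
  generalize √(sqSum x N + runMax x N ^ 2) = φ at *
  have hφ : φ / 2 ≤ (x N ^ 2 + sqSum x N + φ ^ 2) / (2 * φ) := by
    rcases ((runMax_nonneg x N).trans hle).eq_or_lt with h | h
    · simp [← h]
    · rw [le_div_iff₀ (by positivity)]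
      nlinarith [sq_nonneg (x N)]
  linarith

theorem runMax_add_le (x : ℕ → ℝ) (n k : ℕ) :
    runMax x (n + k) ≤ runMax x n + runMax (fun i => x (n + i) - x n) k := by
  induction k with
  | zero => simpa using runMax_nonneg _ _
  | succ k ih =>
    apply max_le
    · exact ih.trans (add_le_add_right (le_max_left _ _) _)
    · have h1 : |x (n + k + 1)| ≤ |x n| + |x (n + (k + 1)) - x n| := by
        have := abs_add_le (x n) (x (n + (k + 1)) - x n)
        rwa [add_sub_cancel] at this
      exact h1.trans (add_le_add (abs_le_runMax x n) (le_max_right _ _))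

theorem sqSum_shift_le (x : ℕ → ℝ) (n k : ℕ) :
    sqSum (fun i => x (n + i) - x n) k ≤ sqSum x (n + k) := by
  induction k with
  | zero => simpa [sqSum] using sqSum_nonneg x n
  | succ k ih =>
    rw [sqSum_succ, ← add_assoc, sqSum_succ]
    simp only [sub_sub_sub_cancel_right, add_assoc] at *
    linarith

/-- The Davis integral of a path restarted at time `n`, up to time `n + k`. -/
noncomputable def davisIntegral (x : ℕ → ℝ) (n k : ℕ) : ℝ :=
  ∑ i ∈ Finset.range k, davisWeight (fun l => x (n + l) - x n) i * (x (n + i + 1) - x (n + i))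

theorem runMax_sub_le (x : ℕ → ℝ) (n k : ℕ) :
    runMax x (n + k) - runMax x n ≤ 24 * √(sqSum x (n + k)) + 2 * davisIntegral x n k := by
  have h1 := pathwise_davis (fun i => x (n + i) - x n) (by simp) k
  have h2 := runMax_add_le x n k
  have h3 := Real.sqrt_le_sqrt (sqSum_shift_le x n k)
  simp only [sub_sub_sub_cancel_right, ← add_assoc] at h1
  rw [davisIntegral]
  linarith

theorem rpow_sub_rpow_le {a b p : ℝ} (ha : 0 ≤ a) (hab : a ≤ b) (hp : 1 ≤ p) :
    b ^ p - a ^ p ≤ p * (b - a) * b ^ (p - 1) := by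
  rcases (ha.trans hab).eq_or_lt with h | hb
  · have : a = 0 := by linarith
    simp [this, ← h]
  have h1 := one_add_mul_self_le_rpow_one_add (s := a / b - 1) (by
    have : 0 ≤ a / b := by positivity
    linarith) hp
  rw [add_sub_cancel, Real.div_rpow ha hb.le, le_div_iff₀ (by positivity)] at h1
  have h2 : b ^ p = b ^ (p - 1) * b := by
    rw [← Real.rpow_add_one hb.ne']
    simp
  have h3 : (1 + p * (a / b - 1)) * b ^ p = b ^ p - p * (b - a) * b ^ (p - 1) := by
    rw [h2]
    field_simp
    ring
  linarith

theorem rpow_le_sum_by_parts {A : ℕ → ℝ} (hA : Monotone A) (h0 : A 0 = 0) {p : ℝ} (hp : 1 ≤ p)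
    (N : ℕ) :
    A N ^ p ≤ p * (A N * A 0 ^ (p - 1)
      + ∑ n ∈ Finset.range N, (A N - A n) * (A (n + 1) ^ (p - 1) - A n ^ (p - 1))) := by
  induction N with
  | zero => simp [h0, Real.zero_rpow (by linarith : p ≠ 0)]
  | succ N ih =>
    have h1 := rpow_sub_rpow_le (h0 ▸ hA (Nat.zero_le N)) (hA (Nat.le_succ N)) hp
    have h2 : ∑ n ∈ Finset.range (N + 1),
        (A (N + 1) - A n) * (A (n + 1) ^ (p - 1) - A n ^ (p - 1)) =
        ∑ n ∈ Finset.range N, (A N - A n) * (A (n + 1) ^ (p - 1) - A n ^ (p - 1))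
        + (A (N + 1) - A N) * (A (N + 1) ^ (p - 1) - A 0 ^ (p - 1)) := by
      rw [← Finset.sum_range_sub (fun n => A n ^ (p - 1)), Finset.mul_sum,
        Finset.sum_range_succ, Finset.sum_range_succ (fun n => (A (N + 1) - A N) * _), ← add_assoc,
        ← Finset.sum_add_distrib]
      congr 1
      exact Finset.sum_congr rfl fun n _ => by ring
    rw [h2]
    simp only [Nat.succ_eq_add_one] at h1
    linarith

/-- The mean-zero correction in the pathwise `L ^ p` inequality. -/
noncomputable def pathCorrection (p : ℝ) (x : ℕ → ℝ) (N : ℕ) : ℝ :=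
  runMax x 0 ^ (p - 1) * davisIntegral x 0 N + ∑ n ∈ Finset.range N,
    (runMax x (n + 1) ^ (p - 1) - runMax x n ^ (p - 1)) * davisIntegral x (n + 1) (N - (n + 1))

theorem runMax_rpow_le (x : ℕ → ℝ) (h0 : x 0 = 0) {p : ℝ} (hp : 1 ≤ p) (N : ℕ) :
    runMax x N ^ p ≤ (50 * p) ^ p * √(sqSum x N) ^ p + 4 * p * pathCorrection p x N := by
  set S := √(sqSum x N) with hS
  have hS0 : 0 ≤ S := Real.sqrt_nonneg _
  set A := runMax x with hA
  have hA0 : A 0 = 0 := by simp [hA, runMax, h0]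
  have hAn (n) : 0 ≤ A n := runMax_nonneg x n
  have hw (n) : A n ^ (p - 1) ≤ A (n + 1) ^ (p - 1) :=
    Real.rpow_le_rpow (hAn n) (runMax_mono x (Nat.le_succ n)) (by linarith)
  have h1 := rpow_le_sum_by_parts (runMax_mono x) hA0 hp N
  have h2 : A N * A 0 ^ (p - 1) ≤
      25 * S * A 0 ^ (p - 1) + 2 * (A 0 ^ (p - 1) * davisIntegral x 0 N) := by
    have h := runMax_sub_le x 0 N
    rw [zero_add, ← hA, hA0, ← hS] at h
    have := mul_le_mul_of_nonneg_right h (Real.rpow_nonneg (hAn 0) (p - 1))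
    linarith [mul_nonneg hS0 (Real.rpow_nonneg (hAn 0) (p - 1))]
  have h3 : ∑ n ∈ Finset.range N, (A N - A n) * (A (n + 1) ^ (p - 1) - A n ^ (p - 1)) ≤
      ∑ n ∈ Finset.range N, (25 * S * (A (n + 1) ^ (p - 1) - A n ^ (p - 1)) +
        2 * ((A (n + 1) ^ (p - 1) - A n ^ (p - 1)) * davisIntegral x (n + 1) (N - (n + 1)))) := by
    apply Finset.sum_le_sum
    intro n hn
    have hn := Finset.mem_range.1 hn
    have h := runMax_sub_le x (n + 1) (N - (n + 1))
    rw [Nat.add_sub_of_le hn, ← hA, ← hS] at h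
    have h' : A (n + 1) ≤ A n + S := by
      have hd := abs_sub_le_sqrt_sqSum x hn
      apply max_le
      · exact le_add_of_nonneg_right hS0
      · have := abs_add_le (x n) (x (n + 1) - x n)
        rw [add_sub_cancel] at this
        exact this.trans (add_le_add (abs_le_runMax x n) hd)
    have := mul_le_mul_of_nonneg_right (show A N - A n ≤ 25 * S +
      2 * davisIntegral x (n + 1) (N - (n + 1)) by linarith) (sub_nonneg.2 (hw n))
    linarith
  rw [Finset.sum_add_distrib, ← Finset.mul_sum, ← Finset.mul_sum,
    Finset.sum_range_sub (fun n => A n ^ (p - 1))] at h3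
  have h4 : A N ^ p ≤ p * (25 * S * A N ^ (p - 1) + 2 * pathCorrection p x N) := by
    refine h1.trans (mul_le_mul_of_nonneg_left ?_ (by linarith))
    rw [pathCorrection]
    linarith
  have h5 : p * (25 * S * A N ^ (p - 1)) ≤ A N ^ p / 2 + (50 * p) ^ p * S ^ p / 2 := by
    rw [← Real.mul_rpow (by positivity) hS0]
    have e {y : ℝ} (hy : 0 ≤ y) : y ^ p = y * y ^ (p - 1) := by
      rw [mul_comm, ← Real.rpow_add_one' hy (by linarith)]
      simp
    have hB : 0 ≤ 50 * p * S := by positivity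
    rcases le_total (A N) (50 * p * S) with h | h
    · have := Real.rpow_le_rpow (hAn N) h (show 0 ≤ p - 1 by linarith)
      have := mul_le_mul_of_nonneg_left this hB
      rw [e hB]
      linarith [Real.rpow_nonneg (hAn N) p]
    · have := mul_le_mul_of_nonneg_right h (Real.rpow_nonneg (hAn N) (p - 1))
      rw [← e (hAn N)] at this
      linarith [Real.rpow_nonneg hB p]
  linarith

/-- The martingale transform of `g` by `w`. -/
noncomputable def transform (w g : ℕ → ℝ) (n : ℕ) : ℝ :=
  ∑ i ∈ Finset.range n, w i * (g (i + 1) - g i)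

theorem transform_succ_sub (w g : ℕ → ℝ) (n : ℕ) :
    transform w g (n + 1) - transform w g n = w n * (g (n + 1) - g n) := by
  rw [transform, Finset.sum_range_succ, transform, add_sub_cancel_left]

theorem sqSum_transform_le {w : ℕ → ℝ} (hw : ∀ n, |w n| ≤ 1) (g : ℕ → ℝ) (n : ℕ) :
    sqSum (transform w g) n ≤ sqSum g n := by
  apply Finset.sum_le_sum
  intro i _
  rw [transform_succ_sub, mul_pow]
  exact mul_le_of_le_one_left (sq_nonneg _) ((sq_le_one_iff_abs_le_one _).2 (hw i))

theorem runMax_transform_le {w : ℕ → ℝ} (hw : ∀ n, |w n| ≤ 1) (g : ℕ → ℝ) (n : ℕ) :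
    runMax (transform w g) n ≤ n * √(sqSum g n) := by
  induction n with
  | zero => simp [runMax, transform]
  | succ n ih =>
    have h0 := Real.sqrt_nonneg (sqSum g (n + 1))
    have h1 := Real.sqrt_le_sqrt (sqSum_mono g n.le_succ)
    have h2 : runMax (transform w g) n ≤ n * √(sqSum g (n + 1)) := ih.trans (by gcongr)
    have h3 := abs_sub_le_sqrt_sqSum g (Nat.lt_succ_self n)
    push_cast
    apply max_le
    · linarith
    · rw [← add_sub_cancel (transform w g n) (transform w g (n + 1)), transform_succ_sub]
      refine (abs_add_le _ _).trans ?_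
      rw [abs_mul]
      have := abs_le_runMax (transform w g) n
      have := mul_le_of_le_one_left (abs_nonneg (g (n + 1) - g n)) (hw n)
      simp only [Nat.succ_eq_add_one] at h3
      linarith

section Adapted

variable {Ω : Type*} {m : ℕ → MeasurableSpace Ω} {x w : Ω → ℕ → ℝ}

theorem measurable_runMax (hm : Monotone m) (hx : ∀ n, Measurable[m n] fun ω => x ω n) (n : ℕ) :
    Measurable[m n] fun ω => runMax (x ω) n := by
  induction n with
  | zero => exact continuous_abs.measurable.comp (hx 0)
  | succ n ih =>
    exact (ih.mono (hm n.le_succ) le_rfl).max (continuous_abs.measurable.comp (hx (n + 1)))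

theorem measurable_sqSum (hm : Monotone m) (hx : ∀ n, Measurable[m n] fun ω => x ω n) (n : ℕ) :
    Measurable[m n] fun ω => sqSum (x ω) n := by
  apply Finset.measurable_fun_sum
  intro i hi
  have hi := Finset.mem_range.1 hi
  exact (((hx (i + 1)).mono (hm hi) le_rfl).sub ((hx i).mono (hm hi.le) le_rfl)).pow_const 2

theorem measurable_davisWeight (hm : Monotone m) (hx : ∀ n, Measurable[m n] fun ω => x ω n)
    (n : ℕ) : Measurable[m n] fun ω => davisWeight (x ω) n :=
  (hx n).div ((measurable_sqSum hm hx n).add ((measurable_runMax hm hx n).pow_const 2)).sqrt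

theorem measurable_transform (hm : Monotone m) (hw : ∀ n, Measurable[m n] fun ω => w ω n)
    (hx : ∀ n, Measurable[m n] fun ω => x ω n) (n : ℕ) :
    Measurable[m n] fun ω => transform (w ω) (x ω) n := by
  apply Finset.measurable_fun_sum
  intro i hi
  have hi := Finset.mem_range.1 hi
  exact ((hw i).mono (hm hi.le) le_rfl).mul
    (((hx (i + 1)).mono (hm hi) le_rfl).sub ((hx i).mono (hm hi.le) le_rfl))

end Adapted

section Burkholder

variable {Ω : Type*} {mΩ : MeasurableSpace Ω} {μ : Measure Ω} [IsProbabilityMeasure μ]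
  {ℱ : Filtration ℕ mΩ} {g : ℕ → Ω → ℝ} {w : Ω → ℕ → ℝ}

theorem integral_mul_increment_eq_zero (hg : Martingale g ℱ μ) {φ : Ω → ℝ} {n : ℕ}
    (hφ : Measurable[ℱ n] φ) (hi : Integrable (fun ω => φ ω * (g (n + 1) ω - g n ω)) μ) :
    ∫ ω, φ ω * (g (n + 1) ω - g n ω) ∂μ = 0 := by
  have hd : Integrable (g (n + 1) - g n) μ := (hg.integrable _).sub (hg.integrable _)
  have h1 : μ[φ * (g (n + 1) - g n) | ℱ n] =ᵐ[μ] φ * μ[g (n + 1) - g n | ℱ n] :=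
    condExp_mul_of_stronglyMeasurable_left hφ.stronglyMeasurable hi hd
  have h2 : μ[g (n + 1) - g n | ℱ n] =ᵐ[μ] 0 := by
    filter_upwards [condExp_sub (hg.integrable (n + 1)) (hg.integrable n) (ℱ n),
      hg.2 n (n + 1) n.le_succ, hg.2 n n le_rfl] with ω h1 h2 h3
    rw [h1, Pi.sub_apply, h2, h3, sub_self, Pi.zero_apply]
  change ∫ ω, (φ * (g (n + 1) - g n)) ω ∂μ = 0
  rw [← integral_condExp (ℱ.le n)]
  apply integral_eq_zero_of_ae
  filter_upwards [h1, h2] with ω h1 h2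
  rw [h1, Pi.mul_apply, h2]
  simp

theorem integrable_mul_davisIntegral (hg : Martingale g ℱ μ)
    (hw : ∀ n, Measurable[ℱ n] fun ω => w ω n) {p : ℝ} (hp : 1 ≤ p) {N n k : ℕ} (hN : n + k = N)
    (hi : Integrable (fun ω => runMax (transform (w ω) fun n => g n ω) N ^ p) μ) {φ : Ω → ℝ}
    (hφm : Measurable[ℱ n] φ)
    (hφ : ∀ ω, |φ ω| ≤ runMax (transform (w ω) fun n => g n ω) N ^ (p - 1)) :
    Integrable (fun ω => φ ω * davisIntegral (transform (w ω) fun n => g n ω) n k) μ ∧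
      ∫ ω, φ ω * davisIntegral (transform (w ω) fun n => g n ω) n k ∂μ = 0 := by
  set x : Ω → ℕ → ℝ := fun ω => transform (w ω) fun n => g n ω with hx
  have hgm (n) : Measurable[ℱ n] (g n) := (hg.stronglyMeasurable n).measurable
  have hxm (n) : Measurable[ℱ n] fun ω => x ω n := measurable_transform ℱ.mono' hw hgm n
  set D : ℕ → Ω → ℝ := fun i ω => davisWeight (fun l => x ω (n + l) - x ω n) i with hD
  have hDm (i) : Measurable[ℱ (n + i)] (D i) :=
    measurable_davisWeight (m := fun i => ℱ (n + i)) (fun i j h => ℱ.mono (by omega))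
      (fun i => (hxm (n + i)).sub ((hxm n).mono (ℱ.mono (by omega)) le_rfl)) i
  have expand (ω) : φ ω * davisIntegral (x ω) n k = ∑ i ∈ Finset.range k,
      φ ω * D i ω * w ω (n + i) * (g (n + i + 1) ω - g (n + i) ω) := by
    rw [davisIntegral, Finset.mul_sum]
    refine Finset.sum_congr rfl fun i _ => ?_
    rw [hx, transform_succ_sub]
    simp only [hD, hx]
    ring
  have hcm (i) : Measurable[ℱ (n + i)] fun ω => φ ω * D i ω * w ω (n + i) :=
    ((hφm.mono (ℱ.mono (by omega)) le_rfl).mul (hDm i)).mul (hw _)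
  have hterm (i) (hik : i ∈ Finset.range k) : Integrable
      (fun ω => φ ω * D i ω * w ω (n + i) * (g (n + i + 1) ω - g (n + i) ω)) μ := by
    have hik := Finset.mem_range.1 hik
    refine (hi.const_mul 2).mono' ?_ (.of_forall fun ω => ?_)
    · exact (((hcm i).mono (ℱ.le _) le_rfl).mul (((hgm _).mono (ℱ.le _) le_rfl).sub
        ((hgm _).mono (ℱ.le _) le_rfl))).aestronglyMeasurable
    · have e : φ ω * D i ω * w ω (n + i) * (g (n + i + 1) ω - g (n + i) ω) =
          φ ω * D i ω * (x ω (n + i + 1) - x ω (n + i)) := by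
        rw [hx, transform_succ_sub]
        ring
      set A := runMax (x ω) N with hA
      have hA0 : 0 ≤ A := runMax_nonneg _ _
      have h1 : |x ω (n + i + 1)| ≤ A :=
        (abs_le_runMax _ _).trans (runMax_mono _ (by omega))
      have h2 : |x ω (n + i)| ≤ A := (abs_le_runMax _ _).trans (runMax_mono _ (by omega))
      have h3 : |x ω (n + i + 1) - x ω (n + i)| ≤ 2 * A := (abs_sub _ _).trans (by linarith)
      have h4 : A ^ p = A ^ (p - 1) * A := by
        rw [← Real.rpow_add_one' hA0 (by linarith)]
        simp
      rw [e, Real.norm_eq_abs, abs_mul, abs_mul, h4]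
      calc |φ ω| * |D i ω| * |x ω (n + i + 1) - x ω (n + i)|
          ≤ A ^ (p - 1) * 1 * (2 * A) := by
            gcongr
            · exact hφ ω
            · exact abs_davisWeight_le _ _
        _ = 2 * (A ^ (p - 1) * A) := by ring
  change Integrable (fun ω => φ ω * davisIntegral (x ω) n k) μ ∧
    ∫ ω, φ ω * davisIntegral (x ω) n k ∂μ = 0
  simp only [expand]
  refine ⟨integrable_finsetSum _ hterm, ?_⟩
  rw [integral_finsetSum _ hterm]
  exact Finset.sum_eq_zero fun i hi => integral_mul_increment_eq_zero hg (hcm i) (hterm i hi)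

theorem integrable_pathCorrection (hg : Martingale g ℱ μ)
    (hw : ∀ n, Measurable[ℱ n] fun ω => w ω n) {p : ℝ} (hp : 1 ≤ p) (N : ℕ)
    (hi : Integrable (fun ω => runMax (transform (w ω) fun n => g n ω) N ^ p) μ) :
    Integrable (fun ω => pathCorrection p (transform (w ω) fun n => g n ω) N) μ ∧
      ∫ ω, pathCorrection p (transform (w ω) fun n => g n ω) N ∂μ = 0 := by
  set x : Ω → ℕ → ℝ := fun ω => transform (w ω) fun n => g n ω with hx
  have hgm (n) : Measurable[ℱ n] (g n) := (hg.stronglyMeasurable n).measurable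
  have hAm (n) : Measurable[ℱ n] fun ω => runMax (x ω) n ^ (p - 1) :=
    (measurable_runMax ℱ.mono' (measurable_transform ℱ.mono' hw hgm) n).pow_const _
  have hA0 (ω n) : 0 ≤ runMax (x ω) n ^ (p - 1) := Real.rpow_nonneg (runMax_nonneg _ _) _
  have hAmono (ω) : Monotone fun n => runMax (x ω) n ^ (p - 1) := fun i j h =>
    Real.rpow_le_rpow (runMax_nonneg _ _) (runMax_mono _ h) (by linarith)
  have h1 := integrable_mul_davisIntegral hg hw hp (zero_add N) hi (hAm 0) fun ω => by
    rw [abs_of_nonneg (hA0 _ _)]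
    exact hAmono ω (Nat.zero_le N)
  have h2 (n) (hn : n ∈ Finset.range N) :=
    integrable_mul_davisIntegral hg hw hp (Nat.add_sub_of_le (Finset.mem_range.1 hn)) hi
      ((hAm (n + 1)).sub ((hAm n).mono (ℱ.mono n.le_succ) le_rfl)) fun ω => by
        simp only [Pi.sub_apply]
        rw [abs_of_nonneg (sub_nonneg.2 (hAmono ω n.le_succ))]
        exact (sub_le_self _ (hA0 _ _)).trans (hAmono ω (Finset.mem_range.1 hn))
  have h3 := integrable_finsetSum _ fun n hn => (h2 n hn).1
  refine ⟨h1.1.add h3, ?_⟩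
  simp only [pathCorrection]
  refine (integral_add h1.1 h3).trans ?_
  rw [h1.2, integral_finsetSum _ fun n hn => (h2 n hn).1, zero_add]
  exact Finset.sum_eq_zero fun n hn => (h2 n hn).2

theorem lintegral_runMax_transform_le (hg : Martingale g ℱ μ)
    (hw : ∀ n, Measurable[ℱ n] fun ω => w ω n) (hw1 : ∀ ω n, |w ω n| ≤ 1) {p : ℝ} (hp : 1 ≤ p)
    (N : ℕ) :
    ∫⁻ ω, ENNReal.ofReal (runMax (transform (w ω) fun n => g n ω) N ^ p) ∂μ ≤
      ENNReal.ofReal ((50 * p) ^ p) *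
        ∫⁻ ω, ENNReal.ofReal (√(sqSum (fun n => g n ω) N) ^ p) ∂μ := by
  set x : Ω → ℕ → ℝ := fun ω => transform (w ω) fun n => g n ω with hx
  have hgm (n) : Measurable[ℱ n] (g n) := (hg.stronglyMeasurable n).measurable
  have hxm (n) : Measurable[ℱ n] fun ω => x ω n := measurable_transform ℱ.mono' hw hgm n
  have hAm : Measurable fun ω => runMax (x ω) N ^ p :=
    ((measurable_runMax ℱ.mono' hxm N).mono (ℱ.le N) le_rfl).pow_const p
  have hSm : Measurable fun ω => √(sqSum (fun n => g n ω) N) ^ p :=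
    ((measurable_sqSum (x := fun ω n => g n ω) ℱ.mono' hgm N).mono (ℱ.le N) le_rfl).sqrt.pow_const p
  have hK : 0 < (50 * p) ^ p := by positivity
  rcases eq_or_ne (∫⁻ ω, ENNReal.ofReal (√(sqSum (fun n => g n ω) N) ^ p) ∂μ) ∞ with h | h
  · rw [h, ENNReal.mul_top (by simpa using hK)]
    exact le_top
  have hS0 (ω) : 0 ≤ √(sqSum (fun n => g n ω) N) ^ p := Real.rpow_nonneg (Real.sqrt_nonneg _) _
  have hA0 (ω) : 0 ≤ runMax (x ω) N ^ p := Real.rpow_nonneg (runMax_nonneg _ _) _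
  have hSi : Integrable (fun ω => √(sqSum (fun n => g n ω) N) ^ p) μ :=
    ⟨hSm.aestronglyMeasurable, (hasFiniteIntegral_iff_ofReal (.of_forall hS0)).2 h.lt_top⟩
  have hAi : Integrable (fun ω => runMax (x ω) N ^ p) μ := by
    refine (hSi.const_mul ((N : ℝ) ^ p)).mono' hAm.aestronglyMeasurable (.of_forall fun ω => ?_)
    rw [Real.norm_of_nonneg (hA0 ω), ← Real.mul_rpow (by positivity) (Real.sqrt_nonneg _)]
    exact Real.rpow_le_rpow (runMax_nonneg _ _) (runMax_transform_le (hw1 ω) _ N) (by linarith)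
  obtain ⟨hCi, hC0⟩ := integrable_pathCorrection hg hw hp N hAi
  rw [← ofReal_integral_eq_lintegral_ofReal hAi (.of_forall hA0),
    ← ofReal_integral_eq_lintegral_ofReal hSi (.of_forall hS0), ← ENNReal.ofReal_mul hK.le]
  apply ENNReal.ofReal_le_ofReal
  calc ∫ ω, runMax (x ω) N ^ p ∂μ
      ≤ ∫ ω, ((50 * p) ^ p * √(sqSum (fun n => g n ω) N) ^ p
          + 4 * p * pathCorrection p (x ω) N) ∂μ := by
        refine integral_mono hAi ((hSi.const_mul _).add (hCi.const_mul _)) fun ω => ?_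
        refine (runMax_rpow_le (x ω) (by simp [hx, transform]) hp N).trans ?_
        have := sqSum_transform_le (hw1 ω) (fun n => g n ω) N
        simp only [hx]
        gcongr
    _ = (50 * p) ^ p * ∫ ω, √(sqSum (fun n => g n ω) N) ^ p ∂μ := by
        rw [integral_add (hSi.const_mul _) (hCi.const_mul _), integral_const_mul,
          integral_const_mul, hC0]
        ring

end Burkholder

open Classical in
/-- The value of `x` at the last time before or at `n` at which `e` holds. -/
noncomputable def restart (e : ℕ → Prop) (x : ℕ → ℝ) : ℕ → ℝ
  | 0 => x 0
  | n + 1 => if e (n + 1) then x (n + 1) else restart e x n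

open Classical in
/-- The running maximum of `|z|` since the last time at which `e` holds. -/
noncomputable def localMax (e : ℕ → Prop) (z : ℕ → ℝ) : ℕ → ℝ
  | 0 => |z 0|
  | n + 1 => if e (n + 1) then |z (n + 1)| else max (localMax e z n) |z (n + 1)|

/-- The increment of `x` since the last time at which `e` holds. -/
noncomputable def sinceRestart (e : ℕ → Prop) (x : ℕ → ℝ) (n : ℕ) : ℝ :=
  x n - restart e x n

/-- The running sum of the squared maximal increments of `x` over the intervals between
consecutive times at which `e` holds. -/
noncomputable def oscSum (e : ℕ → Prop) (x : ℕ → ℝ) : ℕ → ℝ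
  | 0 => 0
  | n + 1 => oscSum e x n + max (localMax e (sinceRestart e x) n) |x (n + 1) - restart e x n| ^ 2
      - localMax e (sinceRestart e x) n ^ 2

/-- The integrand of the martingale correction in the pathwise bound for `oscSum`. -/
noncomputable def doobWeight (e : ℕ → Prop) (x : ℕ → ℝ) (n : ℕ) : ℝ :=
  4 * sinceRestart e x n
    - 2 * localMax e (sinceRestart e x) n * SignType.sign (sinceRestart e x n)

/-- `doobWeight`, normalized to be bounded by one. -/
noncomputable def oscWeight (e : ℕ → Prop) (x : ℕ → ℝ) (n : ℕ) : ℝ :=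
  doobWeight e x n / (2 * √(oscSum e x n))

theorem abs_le_localMax (e : ℕ → Prop) (z : ℕ → ℝ) (n : ℕ) : |z n| ≤ localMax e z n := by
  cases n with
  | zero => exact le_rfl
  | succ n =>
    rw [localMax]
    split_ifs
    · exact le_rfl
    · exact le_max_right _ _

theorem localMax_nonneg (e : ℕ → Prop) (z : ℕ → ℝ) (n : ℕ) : 0 ≤ localMax e z n :=
  (abs_nonneg _).trans (abs_le_localMax e z n)

theorem oscSum_mono (e : ℕ → Prop) (x : ℕ → ℝ) : Monotone (oscSum e x) :=
  monotone_nat_of_le_succ fun n => by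
    rw [oscSum]
    have := pow_le_pow_left₀ (localMax_nonneg e (sinceRestart e x) n)
      (le_max_left _ |x (n + 1) - restart e x n|) 2
    linarith

theorem oscSum_nonneg (e : ℕ → Prop) (x : ℕ → ℝ) (n : ℕ) : 0 ≤ oscSum e x n :=
  oscSum_mono e x (Nat.zero_le n)

theorem localMax_sq_le_oscSum (e : ℕ → Prop) (x : ℕ → ℝ) (n : ℕ) :
    localMax e (sinceRestart e x) n ^ 2 ≤ oscSum e x n := by
  induction n with
  | zero => simp [localMax, sinceRestart, restart, oscSum]
  | succ n ih =>
    by_cases h : e (n + 1)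
    · have : localMax e (sinceRestart e x) (n + 1) = 0 := by
        simp [localMax, sinceRestart, restart, h]
      rw [this]
      simpa using oscSum_nonneg e x (n + 1)
    · rw [oscSum, localMax, sinceRestart, restart, if_neg h, if_neg h]
      linarith

theorem abs_doobWeight_le (e : ℕ → Prop) (x : ℕ → ℝ) (n : ℕ) :
    |doobWeight e x n| ≤ 2 * localMax e (sinceRestart e x) n := by
  have h := abs_le_localMax e (sinceRestart e x) n
  rw [doobWeight]
  generalize sinceRestart e x n = y at *
  generalize localMax e _ n = m at *
  rw [abs_le] at *
  rcases lt_trichotomy y 0 with hy | rfl | hy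
  · rw [sign_neg hy, SignType.coe_neg_one]
    constructor <;> linarith
  · simp only [sign_zero, SignType.coe_zero]
    constructor <;> linarith
  · rw [sign_pos hy, SignType.coe_one]
    constructor <;> linarith

theorem localMax_le_sqrt_oscSum (e : ℕ → Prop) (x : ℕ → ℝ) (n : ℕ) :
    localMax e (sinceRestart e x) n ≤ √(oscSum e x n) :=
  Real.le_sqrt_of_sq_le (localMax_sq_le_oscSum e x n)

theorem abs_oscWeight_le (e : ℕ → Prop) (x : ℕ → ℝ) (n : ℕ) : |oscWeight e x n| ≤ 1 := by
  rw [oscWeight, abs_div, abs_of_nonneg (by positivity : 0 ≤ 2 * √(oscSum e x n))]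
  refine div_le_one_of_le₀ ((abs_doobWeight_le e x n).trans ?_) (by positivity)
  linarith [localMax_le_sqrt_oscSum e x n]

theorem doobWeight_eq (e : ℕ → Prop) (x : ℕ → ℝ) (n : ℕ) :
    doobWeight e x n = 2 * √(oscSum e x n) * oscWeight e x n := by
  rcases eq_or_ne (√(oscSum e x n)) 0 with h | h
  · have h1 := localMax_le_sqrt_oscSum e x n
    have h2 := abs_doobWeight_le e x n
    rw [h, mul_zero, zero_mul]
    exact abs_nonpos_iff.1 (by linarith)
  · rw [oscWeight]
    field_simp

theorem doob_potential_step {m y d : ℝ} (h : |y| ≤ m) :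
    (max m |y + d| - |y + d|) ^ 2 + (y + d) ^ 2 ≤
      (m - |y|) ^ 2 + y ^ 2 + (4 * y - 2 * m * SignType.sign y) * d + 2 * d ^ 2 := by
  have hm : 0 ≤ m := (abs_nonneg y).trans h
  have h1 : |y| + SignType.sign y * d ≤ |y + d| := by
    rcases lt_trichotomy y 0 with hy | rfl | hy
    · rw [sign_neg hy, abs_of_neg hy, SignType.coe_neg_one]
      linarith [neg_le_abs (y + d)]
    · simp
    · rw [sign_pos hy, abs_of_pos hy, SignType.coe_one]
      linarith [le_abs_self (y + d)]
  have h2 : (max m |y + d| - |y + d|) ^ 2 ≤ (m - |y + d|) ^ 2 := by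
    rcases le_total m |y + d| with h | h
    · rw [max_eq_right h, sub_self]
      nlinarith [sq_nonneg (m - |y + d|)]
    · rw [max_eq_left h]
  have h3 := mul_le_mul_of_nonneg_left h1 hm
  have h4 := sq_abs (y + d)
  have h5 := sq_abs y
  linarith

theorem oscSum_le (e : ℕ → Prop) (x : ℕ → ℝ) (N : ℕ) :
    oscSum e x N ≤ 4 * sqSum x N
      + 2 * ∑ i ∈ Finset.range N, doobWeight e x i * (x (i + 1) - x i) := by
  have main : oscSum e x N - localMax e (sinceRestart e x) N ^ 2
      + 2 * ((localMax e (sinceRestart e x) N - |sinceRestart e x N|) ^ 2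
        + sinceRestart e x N ^ 2) ≤ 4 * sqSum x N
      + 2 * ∑ i ∈ Finset.range N, doobWeight e x i * (x (i + 1) - x i) := by
    induction N with
    | zero => simp [oscSum, sqSum, localMax, sinceRestart, restart]
    | succ n ih =>
      have step := doob_potential_step (d := x (n + 1) - x n)
        (abs_le_localMax e (sinceRestart e x) n)
      have hy : sinceRestart e x n + (x (n + 1) - x n) = x (n + 1) - restart e x n := by
        rw [sinceRestart]
        ring
      rw [hy] at step
      change _ ≤ _ + doobWeight e x n * _ + _ at step
      rw [sqSum_succ, Finset.sum_range_succ]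
      by_cases h : e (n + 1)
      · have h1 : sinceRestart e x (n + 1) = 0 := by simp [sinceRestart, restart, h]
        have h2 : localMax e (sinceRestart e x) (n + 1) = 0 := by simp [localMax, h, h1]
        rw [h1, h2, oscSum]
        simp only [abs_zero, sub_zero]
        have h3 := sq_abs (x (n + 1) - restart e x n)
        generalize |x (n + 1) - restart e x n| = z at *
        nlinarith [sq_nonneg (max (localMax e (sinceRestart e x) n) z - 2 * z)]
      · have h1 : sinceRestart e x (n + 1) = x (n + 1) - restart e x n := by
          simp [sinceRestart, restart, h]
        rw [oscSum, localMax, if_neg h, h1]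
        linarith
  have h3 := sq_abs (sinceRestart e x N)
  nlinarith [sq_nonneg (localMax e (sinceRestart e x) N - 2 * |sinceRestart e x N|)]

theorem abs_sum_mul_increment_le {K y : ℕ → ℝ} {n : ℕ} {b : ℝ} (h0 : 0 ≤ K 0)
    (hK : ∀ i < n, K i ≤ K (i + 1)) (hy : ∀ i ≤ n + 1, |y i - y 0| ≤ b) :
    |∑ i ∈ Finset.range (n + 1), K i * (y (i + 1) - y i)| ≤ 2 * K n * b := by
  have hb : 0 ≤ b := (abs_nonneg _).trans (hy 0 (Nat.zero_le _))
  have main : 0 ≤ K n ∧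
      |∑ i ∈ Finset.range (n + 1), K i * (y (i + 1) - y i) - K n * (y (n + 1) - y 0)|
        ≤ K n * b := by
    induction n with
    | zero =>
      refine ⟨h0, ?_⟩
      simp only [zero_add, Finset.range_one, Finset.sum_singleton, sub_self, abs_zero]
      positivity
    | succ n ih =>
      obtain ⟨h1, h2⟩ := ih (fun i hi => hK i (by omega)) (fun i hi => hy i (by omega))
      have h3 := hK n n.lt_succ_self
      refine ⟨h1.trans h3, ?_⟩
      rw [Finset.sum_range_succ]
      have e : ∑ i ∈ Finset.range (n + 1), K i * (y (i + 1) - y i)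
          + K (n + 1) * (y (n + 1 + 1) - y (n + 1)) - K (n + 1) * (y (n + 1 + 1) - y 0)
          = (∑ i ∈ Finset.range (n + 1), K i * (y (i + 1) - y i) - K n * (y (n + 1) - y 0))
            - (K (n + 1) - K n) * (y (n + 1) - y 0) := by ring
      rw [e]
      refine (abs_sub _ _).trans ?_
      rw [abs_mul, abs_of_nonneg (sub_nonneg.2 h3)]
      have := mul_le_mul_of_nonneg_left (hy (n + 1) (by omega)) (sub_nonneg.2 h3)
      linarith
  have h1 := abs_add_le (∑ i ∈ Finset.range (n + 1), K i * (y (i + 1) - y i)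
    - K n * (y (n + 1) - y 0)) (K n * (y (n + 1) - y 0))
  rw [sub_add_cancel, abs_mul, abs_of_nonneg main.1] at h1
  have := mul_le_mul_of_nonneg_left (hy (n + 1) le_rfl) main.1
  linarith [main.2]

theorem sqrt_oscSum_le (e : ℕ → Prop) (x : ℕ → ℝ) (N : ℕ) :
    √(oscSum e x N) ≤ 2 * √(sqSum x N) + 8 * runMax (transform (oscWeight e x) x) N := by
  set A := runMax (transform (oscWeight e x) x) N with hA
  have hA0 : 0 ≤ A := runMax_nonneg _ _
  have hS0 : 0 ≤ √(sqSum x N) := Real.sqrt_nonneg _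
  cases N with
  | zero =>
    have : oscSum e x 0 = 0 := rfl
    rw [this, Real.sqrt_zero]
    positivity
  | succ n =>
    have h1 := abs_sum_mul_increment_le (K := fun i => √(oscSum e x i))
      (y := transform (oscWeight e x) x) (n := n) (b := A) (Real.sqrt_nonneg _)
      (fun i _ => Real.sqrt_le_sqrt (oscSum_mono e x i.le_succ)) fun i hi => by
        have h0 : transform (oscWeight e x) x 0 = 0 := by simp [transform]
        rw [h0, sub_zero]
        exact (abs_le_runMax _ _).trans (runMax_mono _ hi)
    have h2 := oscSum_le e x (n + 1)
    have h3 : ∑ i ∈ Finset.range (n + 1), doobWeight e x i * (x (i + 1) - x i) =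
        2 * ∑ i ∈ Finset.range (n + 1), √(oscSum e x i) *
          (transform (oscWeight e x) x (i + 1) - transform (oscWeight e x) x i) := by
      rw [Finset.mul_sum]
      refine Finset.sum_congr rfl fun i _ => ?_
      rw [transform_succ_sub, doobWeight_eq]
      ring
    have h4 := Real.sqrt_le_sqrt (oscSum_mono e x n.le_succ)
    have h5 := mul_le_mul_of_nonneg_right h4 hA0
    have h6 := (le_abs_self _).trans h1
    rw [h3] at h2
    simp only [Nat.succ_eq_add_one] at h4 h5
    have h7 : √(oscSum e x (n + 1)) ^ 2 = _ := Real.sq_sqrt (oscSum_nonneg e x (n + 1))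
    have h8 : √(sqSum x (n + 1)) ^ 2 = _ := Real.sq_sqrt (sqSum_nonneg x (n + 1))
    have h9 := Real.sqrt_nonneg (oscSum e x (n + 1))
    generalize √(oscSum e x (n + 1)) = R at *
    generalize √(sqSum x (n + 1)) = S at *
    have h10 : R ^ 2 ≤ 4 * S ^ 2 + 8 * R * A := by linarith
    by_contra! hc
    nlinarith

section Interval

variable {e : ℕ → Prop} {a c : ℕ}

theorem restart_eq (ha : a = 0 ∨ e a) (he : ∀ l, a < l → l < c → ¬ e l) (x : ℕ → ℝ) {i : ℕ}
    (hai : a ≤ i) (hic : i < c ∨ i = a) : restart e x i = x a := by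
  induction i, hai using Nat.le_induction with
  | base =>
    cases a with
    | zero => rfl
    | succ a => rw [restart, if_pos (ha.resolve_left a.succ_ne_zero)]
  | succ i hi ih => rw [restart, if_neg (he _ (by omega) (by omega)), ih (by omega)]

theorem localMax_le_succ (he : ∀ l, a < l → l < c → ¬ e l) (z : ℕ → ℝ) {i : ℕ} (hai : a ≤ i)
    (hic : i + 1 < c) : localMax e z i ≤ localMax e z (i + 1) := by
  rw [localMax, if_neg (he _ (by omega) hic)]
  exact le_max_left _ _

theorem localMax_le (ha : a = 0 ∨ e a) (he : ∀ l, a < l → l < c → ¬ e l) (z : ℕ → ℝ) {i : ℕ}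
    {b : ℝ} (hai : a ≤ i) (hic : i < c ∨ i = a) (hz : ∀ l, a ≤ l → l ≤ i → |z l| ≤ b) :
    localMax e z i ≤ b := by
  induction i, hai using Nat.le_induction with
  | base =>
    cases a with
    | zero => exact hz 0 le_rfl le_rfl
    | succ a =>
      rw [localMax, if_pos (ha.resolve_left a.succ_ne_zero)]
      exact hz _ le_rfl le_rfl
  | succ i hi ih =>
    rw [localMax, if_neg (he _ (by omega) (by omega))]
    exact max_le (ih (by omega) fun l h1 h2 => hz l h1 (by omega)) (hz _ (by omega) le_rfl)

theorem sq_increment_le_oscSum_sub (ha : a = 0 ∨ e a) (he : ∀ l, a < l → l < c → ¬ e l)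
    (x : ℕ → ℝ) {i : ℕ} (hai : a ≤ i) (hic : i ≤ c ∨ i = a) :
    (x i - x a) ^ 2 ≤ oscSum e x i - oscSum e x a := by
  have main {j : ℕ} (haj : a ≤ j) (hjc : j < c ∨ j = a) :
      oscSum e x j - oscSum e x a = localMax e (sinceRestart e x) j ^ 2 := by
    induction j, haj using Nat.le_induction with
    | base =>
      have h1 : sinceRestart e x a = 0 := by
        rw [sinceRestart, restart_eq ha he x le_rfl (.inr rfl), sub_self]
      have h2 : localMax e (sinceRestart e x) a = 0 := by
        apply le_antisymm _ (localMax_nonneg _ _ _)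
        refine localMax_le ha he _ le_rfl (.inr rfl) fun l h3 h4 => ?_
        obtain rfl : l = a := by omega
        simp [h1]
      rw [h2]
      simp
    | succ j hj ih =>
      have hn := he (j + 1) (by omega) (by omega)
      rw [oscSum, localMax, if_neg hn, sinceRestart, restart, if_neg hn]
      linarith [ih (by omega)]
  rcases hai.eq_or_lt with rfl | hlt
  · simp
  obtain ⟨j, rfl⟩ : ∃ j, i = j + 1 := ⟨i - 1, by omega⟩
  have h1 := main (j := j) (by omega) (by omega)
  have h2 := restart_eq ha he x (i := j) (by omega) (by omega)
  rw [oscSum, h2, ← sq_abs]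
  have := pow_le_pow_left₀ (abs_nonneg _)
    (le_max_right (localMax e (sinceRestart e x) j) |x (j + 1) - x a|) 2
  linarith

end Interval

/-- The maximal increment of `x` over the interval `[τ k, τ (k + 1)]`. -/
noncomputable def osc (τ : ℕ → ℕ∞) (x : ℕ → ℝ) (k : ℕ) : ℝ≥0∞ :=
  ⨆ (s : ℕ) (t : ℕ) (_ : τ k ≤ (s : ℕ∞)) (_ : s < t) (_ : (t : ℕ∞) ≤ τ (k + 1)),
    ENNReal.ofReal |x t - x s|

/-- The property of being one of the partition times. -/
def IsPartitionTime (τ : ℕ → ℕ∞) (n : ℕ) : Prop :=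
  ∃ k, τ k = n

/-- The square function of a path. -/
noncomputable def squareFun (x : ℕ → ℝ) : ℝ≥0∞ :=
  (∑' n, ENNReal.ofReal ((x (n + 1) - x n) ^ 2)) ^ ((2 : ℝ)⁻¹)

/-- The maximal function of a path. -/
noncomputable def maxFun (x : ℕ → ℝ) : ℝ≥0∞ :=
  ⨆ N, ENNReal.ofReal (runMax x N)

theorem sqrt_sqSum_le_squareFun (x : ℕ → ℝ) (N : ℕ) :
    ENNReal.ofReal √(sqSum x N) ≤ squareFun x := by
  rw [Real.sqrt_eq_rpow, ← ENNReal.ofReal_rpow_of_nonneg (sqSum_nonneg _ _) (by norm_num),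
    one_div]
  apply ENNReal.rpow_le_rpow _ (by norm_num)
  rw [sqSum, ENNReal.ofReal_sum_of_nonneg fun _ _ => sq_nonneg _]
  exact ENNReal.sum_le_tsum _

theorem squareFun_transform_le {w : ℕ → ℝ} (hw : ∀ n, |w n| ≤ 1) (g : ℕ → ℝ) :
    squareFun (transform w g) ≤ squareFun g := by
  apply ENNReal.rpow_le_rpow _ (by norm_num)
  refine ENNReal.tsum_le_tsum fun n => ENNReal.ofReal_le_ofReal ?_
  rw [transform_succ_sub, mul_pow]
  exact mul_le_of_le_one_left (sq_nonneg _) ((sq_le_one_iff_abs_le_one _).2 (hw n))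

theorem transform_transform (v u g : ℕ → ℝ) :
    transform v (transform u g) = transform (fun n => v n * u n) g := by
  funext n
  refine Finset.sum_congr rfl fun i _ => ?_
  rw [transform_succ_sub]
  ring

section Partition

variable {τ : ℕ → ℕ∞} {k s t : ℕ}

theorem le_osc (x : ℕ → ℝ) (hs : τ k ≤ s) (hst : s ≤ t) (ht : (t : ℕ∞) ≤ τ (k + 1)) :
    ENNReal.ofReal |x t - x s| ≤ osc τ x k := by
  rcases hst.eq_or_lt with rfl | hst
  · simp
  · exact le_iSup_of_le s (le_iSup_of_le t (le_iSup_of_le hs (le_iSup_of_le hst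
      (le_iSup_of_le ht le_rfl))))

theorem exists_bound_increment (x : ℕ → ℝ) (hs : τ k ≤ s) (hst : s ≤ t)
    (ht : (t : ℕ∞) ≤ τ (k + 1)) :
    ∃ b : ℝ, 0 ≤ b ∧ (∀ l, s ≤ l → l ≤ t → |x l - x s| ≤ b) ∧ ENNReal.ofReal b ≤ osc τ x k := by
  obtain ⟨l, hl, h⟩ := Finset.exists_max_image (Finset.Icc s t) (fun l => |x l - x s|)
    ⟨s, Finset.left_mem_Icc.2 hst⟩
  rw [Finset.mem_Icc] at hl
  exact ⟨|x l - x s|, abs_nonneg _, fun i h1 h2 => h i (Finset.mem_Icc.2 ⟨h1, h2⟩),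
    le_osc x hs hl.1 (le_trans (by exact_mod_cast hl.2) ht)⟩

theorem not_isPartitionTime (hτ : Monotone τ) {a : ℕ} (ha : τ k = a) (ht : (t : ℕ∞) ≤ τ (k + 1))
    (l : ℕ) (hal : a < l) (hlt : l < t) : ¬ IsPartitionTime τ l := by
  rintro ⟨i, hi⟩
  rcases Nat.lt_or_ge k i with h | h
  · have h1 := ht.trans (hτ h)
    rw [hi] at h1
    have : t ≤ l := by exact_mod_cast h1
    omega
  · have h1 := hτ h
    rw [hi, ha] at h1
    have : l ≤ a := by exact_mod_cast h1
    omega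

theorem sum_osc_sq_le (hτ : Monotone τ) (x : ℕ → ℝ) (n : ℕ) :
    ∑ k ∈ Finset.range n, osc τ x k ^ (2 : ℝ) ≤
      4 * ⨆ (i : ℕ) (_ : (i : ℕ∞) ≤ τ n), ENNReal.ofReal (oscSum (IsPartitionTime τ) x i) := by
  induction n with
  | zero => simp
  | succ k ih =>
    set X := oscSum (IsPartitionTime τ) x with hX
    have hmono : (⨆ (i : ℕ) (_ : (i : ℕ∞) ≤ τ k), ENNReal.ofReal (X i)) ≤
        ⨆ (i : ℕ) (_ : (i : ℕ∞) ≤ τ (k + 1)), ENNReal.ofReal (X i) :=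
      iSup_mono fun i => iSup_le fun h => le_iSup_of_le (h.trans (hτ k.le_succ)) le_rfl
    rw [Finset.sum_range_succ]
    refine (add_le_add_left ih _).trans ?_
    apply add_le_of_le_tsub_left_of_le (by gcongr)
    rw [← ENNReal.le_rpow_inv_iff (by norm_num)]
    refine iSup_le fun s => iSup_le fun t => iSup_le fun hs => iSup_le fun hst => iSup_le fun ht => ?_
    rw [ENNReal.le_rpow_inv_iff (by norm_num)]
    obtain ⟨a, ha⟩ := ENat.ne_top_iff_exists.1 (ne_top_of_le_ne_top (ENat.natCast_ne_top s) hs)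
    have has : a ≤ s := by
      rw [← ha] at hs
      exact_mod_cast hs
    have h1 : (⨆ (i : ℕ) (_ : (i : ℕ∞) ≤ τ k), ENNReal.ofReal (X i)) ≤ ENNReal.ofReal (X a) :=
      iSup_le fun i => iSup_le fun h => ENNReal.ofReal_le_ofReal <| oscSum_mono _ _ <| by
        rw [← ha] at h
        exact_mod_cast h
    have h2 : ENNReal.ofReal (X t) ≤ ⨆ (i : ℕ) (_ : (i : ℕ∞) ≤ τ (k + 1)), ENNReal.ofReal (X i) :=
      le_iSup_of_le t (le_iSup_of_le ht le_rfl)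
    refine le_trans ?_ (tsub_le_tsub (mul_le_mul_right h2 4) (mul_le_mul_right h1 4))
    have h3 : ENNReal.ofReal |x t - x s| ^ (2 : ℝ) = ENNReal.ofReal ((x t - x s) ^ 2) := by
      rw [ENNReal.ofReal_rpow_of_nonneg (abs_nonneg _) (by norm_num)]
      simp
    have h4 (y : ℝ) : 4 * ENNReal.ofReal y = ENNReal.ofReal (4 * y) := by
      rw [ENNReal.ofReal_mul (by norm_num)]
      norm_num
    have hX0 := oscSum_nonneg (IsPartitionTime τ) x a
    rw [h3, h4, h4, ← ENNReal.ofReal_sub _ (by positivity)]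
    apply ENNReal.ofReal_le_ofReal
    have he := not_isPartitionTime hτ ha.symm ht
    have h5 := sq_increment_le_oscSum_sub (.inr ⟨k, ha.symm⟩) he x has (.inl hst.le)
    have h6 := sq_increment_le_oscSum_sub (.inr ⟨k, ha.symm⟩) he x (has.trans hst.le) (.inl le_rfl)
    have h7 := oscSum_mono (IsPartitionTime τ) x hst.le
    nlinarith [sq_nonneg ((x t - x a) + (x s - x a))]

theorem lpSum_osc_le (hτ : Monotone τ) (x : ℕ → ℝ) :
    lpSum 2 (osc τ x) ≤ 4 * squareFun x
      + 16 * maxFun (transform (oscWeight (IsPartitionTime τ) x) x) := by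
  set B := 2 * squareFun x + 8 * maxFun (transform (oscWeight (IsPartitionTime τ) x) x) with hB
  have h1 (i) : ENNReal.ofReal (oscSum (IsPartitionTime τ) x i) ≤ B ^ (2 : ℝ) := by
    have h2 := ENNReal.ofReal_le_ofReal (sqrt_oscSum_le (IsPartitionTime τ) x i)
    rw [ENNReal.ofReal_add (by positivity) (mul_nonneg (by norm_num) (runMax_nonneg _ _)),
      ENNReal.ofReal_mul (by norm_num), ENNReal.ofReal_mul (by norm_num)] at h2
    have h3 : ENNReal.ofReal √(oscSum (IsPartitionTime τ) x i) ≤ B := by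
      refine h2.trans ?_
      have h5 : ENNReal.ofReal (runMax (transform (oscWeight (IsPartitionTime τ) x) x) i) ≤
          maxFun (transform (oscWeight (IsPartitionTime τ) x) x) :=
        le_iSup (fun N => ENNReal.ofReal (runMax _ N)) i
      have h6 := sqrt_sqSum_le_squareFun x i
      rw [hB]
      gcongr <;> norm_num
    refine le_trans (le_of_eq ?_) (ENNReal.rpow_le_rpow h3 (by norm_num))
    rw [ENNReal.ofReal_rpow_of_nonneg (Real.sqrt_nonneg _) (by norm_num)]
    simp [Real.sq_sqrt (oscSum_nonneg _ _ _)]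
  have h2 : ∑' k, osc τ x k ^ (2 : ℝ) ≤ 4 * B ^ (2 : ℝ) := by
    refine ENNReal.tsum_le_of_sum_range_le fun n => (sum_osc_sq_le hτ x n).trans ?_
    gcongr
    exact iSup_le fun i => iSup_le fun _ => h1 i
  have h3 : (4 : ℝ≥0∞) * B ^ (2 : ℝ) = (2 * B) ^ (2 : ℝ) := by
    rw [ENNReal.mul_rpow_of_nonneg _ _ (by norm_num)]
    norm_num
  rw [lpSum, if_neg (by norm_num), ENNReal.toReal_ofNat, one_div,
    ENNReal.rpow_inv_le_iff (by norm_num)]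
  refine (h2.trans h3.le).trans (ENNReal.rpow_le_rpow (le_of_eq ?_) (by norm_num))
  rw [hB]
  ring

theorem lpSum_osc_transform_le (hτ : Monotone τ) {u : ℕ → ℝ} (hu : ∀ n, |u n| ≤ 1) (g : ℕ → ℝ) :
    lpSum 2 (osc τ (transform u g)) ≤ 4 * squareFun g + 16 * maxFun (transform
      (fun n => oscWeight (IsPartitionTime τ) (transform u g) n * u n) g) := by
  refine (lpSum_osc_le hτ _).trans ?_
  rw [transform_transform]
  gcongr
  exact squareFun_transform_le hu g

/-- The running products of increments of the `f j`, `j ∈ A`, normalized by their maximum. -/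
noncomputable def prodWeight {ι : Type*} (e : ℕ → Prop) (f : ι → ℕ → ℝ) (A : Finset ι) (n : ℕ) : ℝ :=
  (∏ j ∈ A, sinceRestart e (f j) n) / localMax e (fun i => ∏ j ∈ A, sinceRestart e (f j) i) n

theorem abs_prodWeight_le {ι : Type*} (e : ℕ → Prop) (f : ι → ℕ → ℝ) (A : Finset ι) (n : ℕ) :
    |prodWeight e f A n| ≤ 1 := by
  rw [prodWeight, abs_div, abs_of_nonneg (localMax_nonneg _ _ _)]
  exact div_le_one_of_le₀ (abs_le_localMax e (fun i => ∏ j ∈ A, sinceRestart e (f j) i) n)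
    (localMax_nonneg _ _ _)

theorem localMax_mul_prodWeight {ι : Type*} (e : ℕ → Prop) (f : ι → ℕ → ℝ) (A : Finset ι) (n : ℕ) :
    localMax e (fun i => ∏ j ∈ A, sinceRestart e (f j) i) n * prodWeight e f A n =
      ∏ j ∈ A, sinceRestart e (f j) n := by
  rw [prodWeight]
  apply mul_div_cancel_of_imp'
  intro h
  have := abs_le_localMax e (fun i => ∏ j ∈ A, sinceRestart e (f j) i) n
  rw [h] at this
  exact abs_nonpos_iff.1 this

theorem abs_paraproduct_le {ι : Type*} [Fintype ι] [DecidableEq ι] (hτ : Monotone τ)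
    (f : ι → ℕ → ℝ) (g : ℕ → ℝ) (hs : τ k ≤ s) (hst : s < t) (ht : (t : ℕ∞) ≤ τ (k + 1)) :
    ENNReal.ofReal |∑ i ∈ Finset.Ioc s t, (∏ j, (f j (i - 1) - f j s)) * (g i - g (i - 1))| ≤
      2 * (∏ j, osc τ (f j) k) *
        ∑ A : Finset ι, osc τ (transform (prodWeight (IsPartitionTime τ) f A) g) k := by
  obtain ⟨a, ha⟩ := ENat.ne_top_iff_exists.1 (ne_top_of_le_ne_top (ENat.natCast_ne_top s) hs)
  have has : a ≤ s := by
    rw [← ha] at hs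
    exact_mod_cast hs
  obtain ⟨n, rfl⟩ : ∃ n, t = s + n + 1 := ⟨t - s - 1, by omega⟩
  set e := IsPartitionTime τ with he
  have hea : a = 0 ∨ e a := .inr ⟨k, ha.symm⟩
  have hel := not_isPartitionTime hτ ha.symm ht
  choose α hα0 hα hαo using fun j =>
    exists_bound_increment (f j) ha.symm.le (has.trans hst.le) ht
  choose β hβ0 hβ hβo using fun A =>
    exists_bound_increment (transform (prodWeight e f A) g) hs hst.le ht
  have hD (j l) (h1 : a ≤ l) (h2 : l ≤ s + n) : sinceRestart e (f j) l = f j l - f j a := by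
    rw [sinceRestart, restart_eq hea hel _ h1 (.inl (by omega))]
  set K : Finset ι → ℕ → ℝ := fun A => localMax e fun i => ∏ j ∈ A, sinceRestart e (f j) i with hK
  have hsum : ∑ i ∈ Finset.Ioc s (s + n + 1), (∏ j, (f j (i - 1) - f j s)) * (g i - g (i - 1)) =
      ∑ A : Finset ι, (∏ j ∈ Finset.univ \ A, -(f j s - f j a)) *
        ∑ i ∈ Finset.range (n + 1), K A (s + i) *
          (transform (prodWeight e f A) g (s + (i + 1)) - transform (prodWeight e f A) g (s + i)) := by
    have h1 (i) (hi : i ∈ Finset.range (n + 1)) : (∏ j, (f j (s + i) - f j s)) *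
        (g (s + i + 1) - g (s + i)) = ∑ A : Finset ι, (∏ j ∈ Finset.univ \ A, -(f j s - f j a)) *
        (K A (s + i) * (transform (prodWeight e f A) g (s + (i + 1))
          - transform (prodWeight e f A) g (s + i))) := by
      have hi := Finset.mem_range.1 hi
      have h2 : ∏ j, (f j (s + i) - f j s) =
          ∏ j, (sinceRestart e (f j) (s + i) + -(f j s - f j a)) :=
        Finset.prod_congr rfl fun j _ => by
          rw [hD j (s + i) (by omega) (by omega)]
          ring
      rw [h2, Finset.prod_add, Finset.powerset_univ, Finset.sum_mul]
      refine Finset.sum_congr rfl fun A _ => ?_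
      rw [← add_assoc, transform_succ_sub, ← mul_assoc (K A (s + i)), hK,
        localMax_mul_prodWeight]
      ring
    simp only [Finset.mul_sum]
    rw [Finset.sum_comm, ← Finset.sum_congr rfl h1]
    refine (Finset.sum_nbij' (fun i => s + i + 1) (fun i => i - s - 1) ?_ ?_ ?_ ?_ ?_).symm
    · intro i hi
      rw [Finset.mem_range] at hi
      rw [Finset.mem_Ioc]
      omega
    · intro i hi
      rw [Finset.mem_Ioc] at hi
      rw [Finset.mem_range]
      omega
    · intro i _
      omega
    · intro i hi
      rw [Finset.mem_Ioc] at hi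
      omega
    · intro i _
      rw [Nat.add_sub_cancel]
  have hbound (A : Finset ι) : |(∏ j ∈ Finset.univ \ A, -(f j s - f j a)) *
      ∑ i ∈ Finset.range (n + 1), K A (s + i) * (transform (prodWeight e f A) g (s + (i + 1))
        - transform (prodWeight e f A) g (s + i))| ≤ 2 * (∏ j, α j) * β A := by
    have h1 := abs_sum_mul_increment_le (K := fun i => K A (s + i))
      (y := fun i => transform (prodWeight e f A) g (s + i)) (n := n) (b := β A)
      (localMax_nonneg _ _ _)
      (fun i hi => localMax_le_succ (a := a) hel _ (by omega) (by omega))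
      fun i hi => hβ A (s + i) (by omega) (by omega)
    have h2 : K A (s + n) ≤ ∏ j ∈ A, α j := by
      refine localMax_le hea hel _ (by omega) (.inl (by omega)) fun l h3 h4 => ?_
      rw [Finset.abs_prod]
      refine Finset.prod_le_prod (fun _ _ => abs_nonneg _) fun j _ => ?_
      rw [hD j l h3 h4]
      exact hα j l h3 (by omega)
    have h3 : |∏ j ∈ Finset.univ \ A, -(f j s - f j a)| ≤ ∏ j ∈ Finset.univ \ A, α j := by
      rw [Finset.abs_prod]
      refine Finset.prod_le_prod (fun _ _ => abs_nonneg _) fun j _ => ?_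
      rw [abs_neg]
      exact hα j s has (by omega)
    rw [abs_mul]
    calc _ ≤ (∏ j ∈ Finset.univ \ A, α j) * (2 * (∏ j ∈ A, α j) * β A) := by
          refine mul_le_mul h3 (h1.trans ?_) (abs_nonneg _) (Finset.prod_nonneg fun j _ => hα0 j)
          have := hβ0 A
          gcongr
      _ = 2 * (∏ j, α j) * β A := by
          rw [← Finset.prod_sdiff (Finset.subset_univ A)]
          ring
  rw [hsum]
  refine (ENNReal.ofReal_le_ofReal ((Finset.abs_sum_le_sum_abs _ _).trans
    (Finset.sum_le_sum fun A _ => hbound A))).trans ?_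
  rw [← Finset.mul_sum, ENNReal.ofReal_mul (mul_nonneg zero_le_two
    (Finset.prod_nonneg fun j _ => hα0 j)), ENNReal.ofReal_mul zero_le_two,
    ENNReal.ofReal_prod_of_nonneg fun j _ => hα0 j,
    ENNReal.ofReal_sum_of_nonneg fun A _ => hβ0 A, ENNReal.ofReal_ofNat]
  gcongr with j _ A _
  · exact hαo j
  · exact hβo A

end Partition

section AdaptedPaths

variable {Ω : Type*} {m : ℕ → MeasurableSpace Ω} {e : Ω → ℕ → Prop} {x : Ω → ℕ → ℝ}

theorem measurable_restart (hm : Monotone m) (he : ∀ n, MeasurableSet[m n] {ω | e ω n})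
    (hx : ∀ n, Measurable[m n] fun ω => x ω n) (n : ℕ) :
    Measurable[m n] fun ω => restart (e ω) (x ω) n := by
  classical
  induction n with
  | zero => exact hx 0
  | succ n ih => exact Measurable.ite (he (n + 1)) (hx (n + 1)) (ih.mono (hm n.le_succ) le_rfl)

theorem measurable_localMax (hm : Monotone m) (he : ∀ n, MeasurableSet[m n] {ω | e ω n})
    (hx : ∀ n, Measurable[m n] fun ω => x ω n) (n : ℕ) :
    Measurable[m n] fun ω => localMax (e ω) (x ω) n := by
  classical
  have hx' (n) : Measurable[m n] fun ω => |x ω n| := continuous_abs.measurable.comp (hx n)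
  induction n with
  | zero => exact hx' 0
  | succ n ih =>
    exact Measurable.ite (he (n + 1)) (hx' (n + 1))
      ((ih.mono (hm n.le_succ) le_rfl).max (hx' (n + 1)))

theorem measurable_sinceRestart (hm : Monotone m) (he : ∀ n, MeasurableSet[m n] {ω | e ω n})
    (hx : ∀ n, Measurable[m n] fun ω => x ω n) (n : ℕ) :
    Measurable[m n] fun ω => sinceRestart (e ω) (x ω) n :=
  (hx n).sub (measurable_restart hm he hx n)

theorem measurable_oscSum (hm : Monotone m) (he : ∀ n, MeasurableSet[m n] {ω | e ω n})
    (hx : ∀ n, Measurable[m n] fun ω => x ω n) (n : ℕ) :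
    Measurable[m n] fun ω => oscSum (e ω) (x ω) n := by
  induction n with
  | zero => exact measurable_const
  | succ n ih =>
    have h1 : Measurable[m (n + 1)] fun ω => localMax (e ω) (sinceRestart (e ω) (x ω)) n :=
      (measurable_localMax hm he (measurable_sinceRestart hm he hx) n).mono (hm n.le_succ) le_rfl
    have h2 : Measurable[m (n + 1)] fun ω => |x ω (n + 1) - restart (e ω) (x ω) n| :=
      continuous_abs.measurable.comp ((hx (n + 1)).sub
        ((measurable_restart hm he hx n).mono (hm n.le_succ) le_rfl))
    exact ((ih.mono (hm n.le_succ) le_rfl).add ((h1.max h2).pow_const 2)).sub (h1.pow_const 2)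

theorem measurable_oscWeight (hm : Monotone m) (he : ∀ n, MeasurableSet[m n] {ω | e ω n})
    (hx : ∀ n, Measurable[m n] fun ω => x ω n) (n : ℕ) :
    Measurable[m n] fun ω => oscWeight (e ω) (x ω) n := by
  have hsign : Measurable fun y : ℝ => (SignType.sign y : ℝ) := by
    simp only [sign_apply, apply_ite ((↑) : SignType → ℝ)]
    exact Measurable.ite measurableSet_Ioi measurable_const
      (Measurable.ite measurableSet_Iio measurable_const measurable_const)
  have h1 := measurable_sinceRestart hm he hx
  have h2 := measurable_localMax hm he h1 n
  exact (((h1 n).const_mul 4).sub ((h2.const_mul 2).mul (hsign.comp (h1 n)))).div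
    ((measurable_oscSum hm he hx n).sqrt.const_mul 2)

theorem measurable_prodWeight {ι : Type*} {f : ι → Ω → ℕ → ℝ} (hm : Monotone m)
    (he : ∀ n, MeasurableSet[m n] {ω | e ω n}) (hf : ∀ j n, Measurable[m n] fun ω => f j ω n)
    (A : Finset ι) (n : ℕ) : Measurable[m n] fun ω => prodWeight (e ω) (fun j => f j ω) A n := by
  have h1 (n) : Measurable[m n] fun ω => ∏ j ∈ A, sinceRestart (e ω) (f j ω) n :=
    Finset.measurable_fun_prod A fun j _ => measurable_sinceRestart hm he (hf j) n
  exact (h1 n).div (measurable_localMax hm he h1 n)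

end AdaptedPaths

section RandomPartition

variable {Ω : Type*} {mΩ : MeasurableSpace Ω} {τ : ℕ → Ω → ℕ∞}

theorem measurableSet_isPartitionTime {ℱ : Filtration ℕ mΩ}
    (hτ : ∀ k (n : ℕ), MeasurableSet[ℱ n] {ω | τ k ω ≤ (n : ℕ∞)}) (n : ℕ) :
    MeasurableSet[ℱ n] {ω | IsPartitionTime (fun k => τ k ω) n} := by
  have h : {ω | IsPartitionTime (fun k => τ k ω) n} =
      ⋃ k, {ω | τ k ω ≤ (n : ℕ∞)} \ ⋃ i, ⋃ (_ : i < n), {ω | τ k ω ≤ (i : ℕ∞)} := by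
    ext ω
    simp only [IsPartitionTime, Set.mem_ofPred_eq, Set.mem_iUnion, Set.mem_sdiff, not_exists, not_le]
    refine exists_congr fun k => ⟨fun h => ?_, fun ⟨h1, h2⟩ => h1.antisymm ?_⟩
    · rw [h]
      exact ⟨le_rfl, fun i hi => by exact_mod_cast hi⟩
    · by_contra! h
      obtain ⟨i, hi⟩ := ENat.ne_top_iff_exists.1 (ne_top_of_lt h)
      rw [← hi] at h
      have := h2 i (by exact_mod_cast h)
      rw [← hi] at this
      exact lt_irrefl _ this
  rw [h]
  exact MeasurableSet.iUnion fun k => (hτ k n).diff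
    (MeasurableSet.iUnion fun i => MeasurableSet.iUnion fun hi => ℱ.mono hi.le _ (hτ k i))

theorem measurable_osc (hτ : ∀ k (n : ℕ), MeasurableSet {ω | τ k ω ≤ (n : ℕ∞)}) {x : Ω → ℕ → ℝ}
    (hx : ∀ n, Measurable fun ω => x ω n) (k : ℕ) :
    Measurable fun ω => osc (fun k => τ k ω) (x ω) k := by
  classical
  have iSup_prop {P : Ω → Prop} {c : Ω → ℝ≥0∞} (hP : MeasurableSet {ω | P ω})
      (hc : Measurable c) : Measurable fun ω => ⨆ _ : P ω, c ω := by
    simp only [iSup_eq_if]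
    exact Measurable.ite hP hc measurable_const
  have hτ' (k) (n : ℕ) : MeasurableSet {ω | (n : ℕ∞) ≤ τ k ω} := by
    cases n with
    | zero => simp
    | succ n =>
      convert (hτ k n).compl using 1
      ext ω
      simp [ENat.add_one_le_iff]
  exact .iSup fun s => .iSup fun t => iSup_prop (hτ k s) (iSup_prop (.const _) (iSup_prop (hτ' _ t)
    ((hx t).sub (hx s)).abs.ennreal_ofReal))

end RandomPartition

section Holder

variable {α : Type*} [MeasurableSpace α] {μ : Measure α} {f g : α → ℝ≥0∞}

theorem lqNorm_mono (q : ℝ≥0∞) (h : ∀ ω, f ω ≤ g ω) : lqNorm μ q f ≤ lqNorm μ q g := by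
  rw [lqNorm, lqNorm]
  split_ifs
  · exact essSup_mono_ae (.of_forall h)
  · exact ENNReal.rpow_le_rpow (lintegral_mono fun ω => ENNReal.rpow_le_rpow (h ω)
      ENNReal.toReal_nonneg) (by positivity)

theorem lqNorm_top_mul_le {q : ℝ≥0∞} (hq : q ≠ 0) (f : α → ℝ≥0∞) (hg : Measurable g) :
    lqNorm μ q (fun ω => f ω * g ω) ≤ lqNorm μ ∞ f * lqNorm μ q g := by
  rcases eq_or_ne q ∞ with rfl | hq'
  · simp only [lqNorm, if_pos]
    exact ENNReal.essSup_mul_le f g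
  have hpos := ENNReal.toReal_pos hq hq'
  rw [lqNorm, lqNorm, lqNorm, if_neg hq', if_neg hq', if_pos rfl, one_div,
    ENNReal.rpow_inv_le_iff hpos, ENNReal.mul_rpow_of_nonneg _ _ hpos.le,
    ENNReal.rpow_inv_rpow hpos.ne', ← lintegral_const_mul _ (hg.pow_const _)]
  apply lintegral_mono_ae
  filter_upwards [ENNReal.ae_le_essSup f] with ω hω
  rw [← ENNReal.mul_rpow_of_nonneg _ _ hpos.le]
  gcongr

theorem lqNorm_const_mul_le {q : ℝ≥0∞} (hq : q ≠ 0) (c : ℝ≥0∞) (hg : Measurable g) :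
    lqNorm μ q (fun ω => c * g ω) ≤ c * lqNorm μ q g := by
  refine (lqNorm_top_mul_le hq (fun _ => c) hg).trans ?_
  gcongr
  rw [lqNorm, if_pos rfl]
  exact essSup_le_of_ae_le c (.of_forall fun _ => le_rfl)

theorem lqNorm_mul_le {p₁ p₂ q : ℝ≥0∞} (h₁ : p₁ ≠ 0) (h₂ : p₂ ≠ 0) (h : 1 / q = 1 / p₁ + 1 / p₂)
    (hf : Measurable f) (hg : Measurable g) :
    lqNorm μ q (fun ω => f ω * g ω) ≤ lqNorm μ p₁ f * lqNorm μ p₂ g := by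
  rcases eq_or_ne p₁ ∞ with rfl | h₁'
  · obtain rfl : q = p₂ := by simpa using h
    exact lqNorm_top_mul_le h₂ f hg
  rcases eq_or_ne p₂ ∞ with rfl | h₂'
  · obtain rfl : q = p₁ := by simpa using h
    simpa only [mul_comm] using lqNorm_top_mul_le h₁ g hf
  have hp₁ := ENNReal.toReal_pos h₁ h₁'
  have hp₂ := ENNReal.toReal_pos h₂ h₂'
  have e : 1 / q.toReal = 1 / p₁.toReal + 1 / p₂.toReal := by
    have := congrArg ENNReal.toReal h
    rw [ENNReal.toReal_add (by simpa using h₁) (by simpa using h₂)] at this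
    simpa using this
  have hq : 0 < q.toReal := one_div_pos.1 (by rw [e]; positivity)
  have hq' : q ≠ ∞ := (ENNReal.toReal_pos_iff.1 hq).2.ne
  have hlt : q.toReal < p₁.toReal := lt_of_one_div_lt_one_div hp₁ <|
    e ▸ lt_add_of_pos_right _ (by positivity)
  rw [lqNorm, lqNorm, lqNorm, if_neg hq', if_neg h₁', if_neg h₂']
  exact ENNReal.lintegral_Lp_mul_le_Lq_mul_Lr hq hlt e μ hf.aemeasurable hg.aemeasurable

theorem lqNorm_mul_prod_le {ι : Type*} (s : Finset ι) {p₀ q : ℝ≥0∞} {p : ι → ℝ≥0∞}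
    {f : ι → α → ℝ≥0∞} (h₀ : p₀ ≠ 0) (hp : ∀ j, p j ≠ 0) (h : 1 / q = 1 / p₀ + ∑ j ∈ s, 1 / p j)
    (hg : Measurable g) (hf : ∀ j, Measurable (f j)) :
    lqNorm μ q (fun ω => g ω * ∏ j ∈ s, f j ω) ≤ lqNorm μ p₀ g * ∏ j ∈ s, lqNorm μ (p j) (f j) := by
  classical
  induction s using Finset.induction_on generalizing q with
  | empty =>
    obtain rfl : q = p₀ := by simpa using h
    simp
  | insert i s hi ih =>
    set c := 1 / p₀ + ∑ j ∈ s, 1 / p j with hc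
    have hc' : c ≠ ∞ := by
      simp only [hc, one_div, ne_eq, ENNReal.add_eq_top, ENNReal.inv_eq_top, h₀,
        ENNReal.sum_eq_top, hp, and_false, exists_false, or_self, not_false_eq_true]
    have h1 : 1 / q = 1 / c⁻¹ + 1 / p i := by
      rw [h, Finset.sum_insert hi, one_div c⁻¹, inv_inv, hc]
      ring
    have h2 := lqNorm_mul_le (μ := μ) (by simpa using hc') (hp i) h1
      (hg.mul (Finset.measurable_fun_prod s fun j _ => hf j)) (hf i)
    simp only [Finset.prod_insert hi]
    refine le_trans (le_of_eq ?_) (h2.trans ?_)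
    · congr 1
      funext ω
      simp only [Pi.mul_apply]
      ring
    · rw [mul_comm (lqNorm μ (p i) (f i)), ← mul_assoc]
      gcongr
      exact ih (by rw [one_div, inv_inv])

theorem lqNorm_add_le {q : ℝ≥0∞} (hq : 1 ≤ q) (hq' : q ≠ ∞) (hf : Measurable f)
    (hg : Measurable g) :
    lqNorm μ q (fun ω => f ω + g ω) ≤ lqNorm μ q f + lqNorm μ q g := by
  rw [lqNorm, lqNorm, lqNorm, if_neg hq', if_neg hq', if_neg hq']
  exact ENNReal.lintegral_Lp_add_le hf.aemeasurable hg.aemeasurable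
    (by simpa using ENNReal.toReal_mono hq' hq)

theorem lqNorm_sum_le {ι : Type*} (s : Finset ι) {q : ℝ≥0∞} (hq : 1 ≤ q) (hq' : q ≠ ∞)
    {f : ι → α → ℝ≥0∞} (hf : ∀ i, Measurable (f i)) :
    lqNorm μ q (fun ω => ∑ i ∈ s, f i ω) ≤ ∑ i ∈ s, lqNorm μ q (f i) := by
  classical
  induction s using Finset.induction_on with
  | empty =>
    have := ENNReal.toReal_pos (zero_lt_one.trans_le hq).ne' hq'
    simp [lqNorm, hq', this]
  | insert i s hi ih =>
    simp only [Finset.sum_insert hi]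
    exact (lqNorm_add_le hq hq' (hf i) (Finset.measurable_fun_sum s fun i _ => hf i)).trans
      (by gcongr)

theorem lpSum_eq_lqNorm (p : ℝ≥0∞) (a : ℕ → ℝ≥0∞) : lpSum p a = lqNorm Measure.count p a := by
  rw [lpSum, lqNorm, lintegral_count, essSup_count]

theorem measurable_lpSum (p : ℝ≥0∞) {a : α → ℕ → ℝ≥0∞} (ha : ∀ k, Measurable fun ω => a ω k) :
    Measurable fun ω => lpSum p (a ω) := by
  simp only [lpSum]
  split_ifs
  · exact .iSup ha
  · exact (Measurable.tsum fun k => (ha k).pow_const _).pow_const _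

end Holder

section SquareFunction

variable {Ω : Type*} {mΩ : MeasurableSpace Ω} {μ : Measure Ω} {x : Ω → ℕ → ℝ}

theorem measurable_squareFun (hx : ∀ n, Measurable fun ω => x ω n) :
    Measurable fun ω => squareFun (x ω) :=
  (Measurable.tsum fun n =>
    (((hx (n + 1)).sub (hx n)).pow_const 2).ennreal_ofReal).pow_const _

theorem measurable_maxFun (hx : ∀ n, Measurable fun ω => x ω n) :
    Measurable fun ω => maxFun (x ω) :=
  .iSup fun N => (measurable_runMax (m := fun _ => mΩ) monotone_const hx N).ennreal_ofReal

theorem lqNorm_maxFun_transform_le [IsProbabilityMeasure μ] {ℱ : Filtration ℕ mΩ}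
    {g : ℕ → Ω → ℝ} {w : Ω → ℕ → ℝ} (hg : Martingale g ℱ μ)
    (hw : ∀ n, Measurable[ℱ n] fun ω => w ω n) (hw1 : ∀ ω n, |w ω n| ≤ 1) {p : ℝ} (hp : 1 ≤ p) :
    lqNorm μ (ENNReal.ofReal p) (fun ω => maxFun (transform (w ω) fun n => g n ω)) ≤
      ENNReal.ofReal (50 * p) *
        lqNorm μ (ENNReal.ofReal p) (fun ω => squareFun fun n => g n ω) := by
  have hp0 : 0 < p := by linarith
  have hgm (n) : Measurable[ℱ n] (g n) := (hg.stronglyMeasurable n).measurable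
  have hxm (n) : Measurable fun ω => transform (w ω) (fun n => g n ω) n :=
    (measurable_transform (x := fun ω n => g n ω) ℱ.mono' hw hgm n).mono (ℱ.le n) le_rfl
  have hmax (ω) : maxFun (transform (w ω) fun n => g n ω) ^ p =
      ⨆ N, ENNReal.ofReal (runMax (transform (w ω) fun n => g n ω) N ^ p) := by
    rw [maxFun, ← ENNReal.orderIsoRpow_apply p hp0, OrderIso.map_iSup]
    simp only [ENNReal.orderIsoRpow_apply]
    exact iSup_congr fun N => ENNReal.ofReal_rpow_of_nonneg (runMax_nonneg _ _) hp0.le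
  rw [lqNorm, lqNorm, if_neg ENNReal.ofReal_ne_top, if_neg ENNReal.ofReal_ne_top,
    ENNReal.toReal_ofReal hp0.le, one_div, ENNReal.rpow_inv_le_iff hp0,
    ENNReal.mul_rpow_of_nonneg _ _ hp0.le, ENNReal.rpow_inv_rpow hp0.ne',
    ENNReal.ofReal_rpow_of_nonneg (by positivity) hp0.le]
  simp only [hmax]
  rw [lintegral_iSup]
  · refine iSup_le fun N => (lintegral_runMax_transform_le hg hw hw1 hp N).trans ?_
    gcongr with ω
    rw [← ENNReal.ofReal_rpow_of_nonneg (Real.sqrt_nonneg _) hp0.le]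
    exact ENNReal.rpow_le_rpow (sqrt_sqSum_le_squareFun _ N) hp0.le
  · exact fun N => ((measurable_runMax (m := fun _ => mΩ) monotone_const hxm N).pow_const
      p).ennreal_ofReal
  · exact fun M N h ω => ENNReal.ofReal_le_ofReal
      (Real.rpow_le_rpow (runMax_nonneg _ _) (runMax_mono _ h) hp0.le)

end SquareFunction

theorem lpSum_le_of_le_mul_prod {ι : Type*} [Fintype ι] {r : ℝ≥0∞} {r₁ : ι → ℝ≥0∞}
    (hr₁ : ∀ j, r₁ j ≠ 0) (hr : 1 / r = 1 / 2 + ∑ j, 1 / r₁ j) {θ b : ℕ → ℝ≥0∞} {a : ι → ℕ → ℝ≥0∞}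
    (h : ∀ k, θ k ≤ b k * ∏ j, a j k) : lpSum r θ ≤ lpSum 2 b * ∏ j, lpSum (r₁ j) (a j) := by
  simp only [lpSum_eq_lqNorm]
  exact (lqNorm_mono r h).trans (lqNorm_mul_prod_le _ two_ne_zero hr₁ hr
    measurable_from_nat fun _ => measurable_from_nat)

theorem lpSum_two_mul_sum_le {ι : Type*} (s : Finset ι) (a : ι → ℕ → ℝ≥0∞) :
    lpSum 2 (fun k => 2 * ∑ i ∈ s, a i k) ≤ 2 * ∑ i ∈ s, lpSum 2 (a i) := by
  simp only [lpSum_eq_lqNorm]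
  refine (lqNorm_const_mul_le two_ne_zero _ measurable_from_nat).trans ?_
  gcongr
  exact lqNorm_sum_le s one_le_two (by norm_num) fun _ => measurable_from_nat

theorem lpSum_paraproduct_le {ι : Type*} [Fintype ι] [DecidableEq ι] {r : ℝ≥0∞} {r₁ : ι → ℝ≥0∞}
    (hr₁ : ∀ j, r₁ j ≠ 0) (hr : 1 / r = 1 / 2 + ∑ j, 1 / r₁ j) {τ : ℕ → ℕ∞} (hτ : Monotone τ)
    (f : ι → ℕ → ℝ) (g : ℕ → ℝ) :
    lpSum r (fun k => ⨆ (s : ℕ) (t : ℕ) (_ : τ k ≤ (s : ℕ∞)) (_ : s < t)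
        (_ : (t : ℕ∞) ≤ τ (k + 1)), ENNReal.ofReal
          |∑ i ∈ Finset.Ioc s t, (∏ j, (f j (i - 1) - f j s)) * (g i - g (i - 1))|) ≤
      (∑ A : Finset ι, (8 * squareFun g + 32 * maxFun (transform (fun n =>
        oscWeight (IsPartitionTime τ) (transform (prodWeight (IsPartitionTime τ) f A) g) n *
          prodWeight (IsPartitionTime τ) f A n) g))) *
        ∏ j, lpSum (r₁ j) (osc τ (f j)) := by
  refine (lpSum_le_of_le_mul_prod (a := fun j => osc τ (f j)) (b := fun k => 2 * ∑ A : Finset ι,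
    osc τ (transform (prodWeight (IsPartitionTime τ) f A) g) k) hr₁ hr fun k => ?_).trans ?_
  · refine iSup_le fun s => iSup_le fun t => iSup_le fun hs => iSup_le fun hst => iSup_le fun ht =>
      (abs_paraproduct_le hτ f g hs hst ht).trans (le_of_eq ?_)
    ring
  · gcongr
    refine (lpSum_two_mul_sum_le _ _).trans ?_
    rw [Finset.mul_sum]
    refine Finset.sum_le_sum fun A _ => ?_
    refine (mul_le_mul_right (lpSum_osc_transform_le hτ (abs_prodWeight_le _ f A) g) 2).trans
      (le_of_eq ?_)
    ring

/-- product of differences against a martingale (discrete time):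
with `F_{s,t} = Π_j (f^{(j)}_t − f^{(j)}_s)`, `1/q = 1/q₀ + Σ_j 1/q_j`,
`1/r = 1/2 + Σ_j 1/r_j` and an adapted partition `(τ_k)`,
`‖ℓ^r_k sup_{τ_k ≤ s<t ≤ τ_{k+1}} |Π_{s,t}(F,g)|‖_{L^q}
  ≤ C Π_j ‖ℓ^{r_j}_k sup |δf^{(j)}_{s,t}|‖_{L^{q_j}} · ‖Sg‖_{L^{q₀}}`. -/
theorem product_of_differences_paraproduct
    (J : ℕ) (q₀ : ℝ) (q₁ : Fin J → ℝ≥0∞) (q : ℝ≥0∞) (r : ℝ) (r₁ : Fin J → ℝ≥0∞)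
    (hq₀ : 1 ≤ q₀) (hq₁ : ∀ j, 0 < q₁ j) (hr₁ : ∀ j, 1 ≤ r₁ j) (hr : 1 ≤ r)
    (hq : 1 / q = ENNReal.ofReal (1 / q₀) + ∑ j : Fin J, 1 / q₁ j)
    (hrsum : ENNReal.ofReal (1 / r) = 1 / 2 + ∑ j : Fin J, 1 / r₁ j) :
    ∃ C : ℝ≥0∞, C < ∞ ∧
      ∀ (Ω : Type) (mΩ : MeasurableSpace Ω) (μ : Measure Ω), IsProbabilityMeasure μ →
      ∀ (ℱ : Filtration ℕ mΩ) (f : Fin J → ℕ → Ω → ℝ) (g : ℕ → Ω → ℝ) (τ : ℕ → Ω → ℕ∞),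
        Martingale g ℱ μ →
        (∀ j t, StronglyMeasurable[ℱ t] (f j t)) →
        (∀ ω, τ 0 ω = 0) →
        (∀ k ω, τ k ω ≤ τ (k + 1) ω) →
        (∀ k (n : ℕ), MeasurableSet[ℱ n] {ω | τ k ω ≤ (n : ℕ∞)}) →
        lqNorm μ q (fun ω =>
            (∑' k : ℕ,
              (⨆ (s : ℕ) (t : ℕ) (_ : τ k ω ≤ (s : ℕ∞)) (_ : s < t) (_ : (t : ℕ∞) ≤ τ (k + 1) ω),
                ENNReal.ofReal
                  |pp (fun s' t' ω' => ∏ j : Fin J, (f j t' ω' - f j s' ω')) g s t ω|) ^ r)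
              ^ (1 / r))
          ≤ C * (∏ j : Fin J, lqNorm μ (q₁ j) fun ω => lpSum (r₁ j) fun k =>
                ⨆ (s : ℕ) (t : ℕ) (_ : τ k ω ≤ (s : ℕ∞)) (_ : s < t) (_ : (t : ℕ∞) ≤ τ (k + 1) ω),
                  ENNReal.ofReal |f j t ω - f j s ω|)
              * lqNorm μ (ENNReal.ofReal q₀) (fun ω =>
                  (∑' n : ℕ, ENNReal.ofReal ((g (n + 1) ω - g n ω) ^ 2)) ^ ((2 : ℝ)⁻¹)) := by
  refine ⟨∑ A : Finset (Fin J), (8 + 32 * ENNReal.ofReal (50 * q₀)),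
    ENNReal.sum_lt_top.2 fun _ _ => by finiteness, ?_⟩
  intro Ω mΩ μ hμ ℱ f g τ hg hf _ hτs hτm
  have hq₀' : (1 : ℝ≥0∞) ≤ ENNReal.ofReal q₀ := by simpa using hq₀
  have hτ (ω) : Monotone fun k => τ k ω := monotone_nat_of_le_succ fun k => hτs k ω
  set r' := ENNReal.ofReal r
  have hrsum' : 1 / r' = 1 / 2 + ∑ j, 1 / r₁ j := by
    rw [← hrsum, ENNReal.ofReal_div_of_pos (by linarith), ENNReal.ofReal_one]
  have hq' : 1 / q = 1 / ENNReal.ofReal q₀ + ∑ j, 1 / q₁ j := by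
    rw [hq, ENNReal.ofReal_div_of_pos (by linarith), ENNReal.ofReal_one]
  have hfm (j n) : Measurable[ℱ n] (f j n) := (hf j n).measurable
  have hgm (n) : Measurable[ℱ n] (g n) := (hg.stronglyMeasurable n).measurable
  set e : Ω → ℕ → Prop := fun ω => IsPartitionTime fun k => τ k ω
  have hem (n) : MeasurableSet[ℱ n] {ω | e ω n} := measurableSet_isPartitionTime hτm n
  set u : Finset (Fin J) → Ω → ℕ → ℝ := fun A ω => prodWeight (e ω) (fun j n => f j n ω) A
  have hum (A n) : Measurable[ℱ n] fun ω => u A ω n :=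
    measurable_prodWeight (f := fun j ω n => f j n ω) ℱ.mono' hem hfm A n
  set w : Finset (Fin J) → Ω → ℕ → ℝ := fun A ω n =>
    oscWeight (e ω) (transform (u A ω) fun n => g n ω) n * u A ω n with hw
  have hwm (A n) : Measurable[ℱ n] fun ω => w A ω n :=
    (measurable_oscWeight ℱ.mono' hem
      (measurable_transform (x := fun ω n => g n ω) ℱ.mono' (hum A) hgm) n).mul (hum A n)
  have hw1 (A ω n) : |w A ω n| ≤ 1 := by
    rw [hw, abs_mul]
    exact mul_le_one₀ (abs_oscWeight_le _ _ _) (abs_nonneg _) (abs_prodWeight_le _ _ _ _)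
  have hSm : Measurable fun ω => squareFun fun n => g n ω :=
    measurable_squareFun fun n => (hgm n).mono (ℱ.le n) le_rfl
  have hMm (A) : Measurable fun ω => maxFun (transform (w A ω) fun n => g n ω) :=
    measurable_maxFun fun n =>
      (measurable_transform (x := fun ω n => g n ω) ℱ.mono' (hwm A) hgm n).mono (ℱ.le n) le_rfl
  have hGm (A) : Measurable fun ω =>
      8 * squareFun (fun n => g n ω) + 32 * maxFun (transform (w A ω) fun n => g n ω) :=
    (hSm.const_mul 8).add ((hMm A).const_mul 32)
  have hG (A) : lqNorm μ (ENNReal.ofReal q₀) (fun ω =>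
      8 * squareFun (fun n => g n ω) + 32 * maxFun (transform (w A ω) fun n => g n ω)) ≤
      (8 + 32 * ENNReal.ofReal (50 * q₀)) *
        lqNorm μ (ENNReal.ofReal q₀) fun ω => squareFun fun n => g n ω := by
    have h0 : ENNReal.ofReal q₀ ≠ 0 := (zero_lt_one.trans_le hq₀').ne'
    refine (lqNorm_add_le hq₀' ENNReal.ofReal_ne_top (hSm.const_mul 8)
      ((hMm A).const_mul 32)).trans ?_
    rw [add_mul, mul_assoc]
    exact add_le_add (lqNorm_const_mul_le h0 _ hSm) ((lqNorm_const_mul_le h0 _ (hMm A)).trans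
      (mul_le_mul_right (lqNorm_maxFun_transform_le hg (hwm A) (hw1 A) hq₀) _))
  have key := lqNorm_mul_prod_le (μ := μ) Finset.univ (p := q₁)
    (f := fun j ω => lpSum (r₁ j) (osc (fun k => τ k ω) fun n => f j n ω))
    (zero_lt_one.trans_le hq₀').ne' (fun j => (hq₁ j).ne') hq'
    (Finset.measurable_fun_sum Finset.univ fun A _ => hGm A)
    fun j => measurable_lpSum _ (measurable_osc (fun k n => ℱ.le n _ (hτm k n))
      fun n => (hfm j n).mono (ℱ.le n) le_rfl)
  refine le_trans (lqNorm_mono q fun ω => ?_) (key.trans ?_)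
  · refine le_trans (le_of_eq ?_) (lpSum_paraproduct_le
      (fun j => (zero_lt_one.trans_le (hr₁ j)).ne') hrsum' (hτ ω) (fun j n => f j n ω)
      fun n => g n ω)
    rw [lpSum, if_neg ENNReal.ofReal_ne_top, ENNReal.toReal_ofReal (by linarith)]
    rfl
  · rw [mul_right_comm, Finset.sum_mul]
    refine mul_le_mul' ?_ le_rfl
    exact (lqNorm_sum_le _ hq₀' ENNReal.ofReal_ne_top hGm).trans (Finset.sum_le_sum fun A _ => hG A)
end
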